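/- Let A and B be nontrivial groups such that each of A and B admits a surjective homomorphism onto some nontrivial left-orderable group. Then the free product G = A ∗ B has normal rank greater than one: for every element w ∈ G, the normal closure ⟨⟨w⟩⟩ of w in G is a proper subgroup of G. -/

import Mathlib

/-- A group is left-orderable if there is a strict total order on it invariant
under left multiplication. -/
def IsLeftOrderable (H : Type*) [Group H] : Prop :=
  ∃ lt : H → H → Prop, IsStrictTotalOrder H lt ∧ ∀ f g h : H, lt f g → lt (h * f) (h * g)

/-- The order automorphism of `ℝ` extending an order automorphism of `ℚ`. -/
noncomputable def ratExt (f : ℚ ≃o ℚ) (x : ℝ) : ℝ :=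
  sSup {y : ℝ | ∃ q : ℚ, (q : ℝ) < x ∧ y = f q}

theorem lt_ratExt_iff (f : ℚ ≃o ℚ) (x : ℝ) (q : ℚ) :
    (q : ℝ) < ratExt f x ↔ ((f.symm q : ℚ) : ℝ) < x := by
  obtain ⟨u, hu⟩ := exists_rat_gt x
  obtain ⟨l, hl⟩ := exists_rat_lt x
  have hb : BddAbove {y : ℝ | ∃ q : ℚ, (q : ℝ) < x ∧ y = f q} := by
    refine ⟨f u, ?_⟩
    rintro _ ⟨r, hr, rfl⟩
    have : r < u := by exact_mod_cast hr.trans hu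
    exact_mod_cast (f.lt_iff_lt.2 this).le
  have hne : {y : ℝ | ∃ q : ℚ, (q : ℝ) < x ∧ y = f q}.Nonempty := ⟨f l, l, hl, rfl⟩
  constructor
  · intro h
    obtain ⟨_, ⟨r, hr, rfl⟩, hqr⟩ := exists_lt_of_lt_csSup hne h
    have h1 : q < f r := by exact_mod_cast hqr
    have h2 : f.symm q < r := by rw [← f.lt_iff_lt]; simpa using h1
    exact lt_trans (by exact_mod_cast h2) hr
  · intro h
    obtain ⟨r, hr1, hr2⟩ := exists_rat_btwn h
    have h1 : q < f r := by
      have : f.symm q < r := by exact_mod_cast hr1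
      rw [← f.lt_iff_lt] at this
      simpa using this
    exact lt_of_lt_of_le (by exact_mod_cast h1) (le_csSup hb ⟨r, hr2, rfl⟩)

theorem eq_of_forall_rat_lt_iff {x y : ℝ} (h : ∀ q : ℚ, (q : ℝ) < x ↔ (q : ℝ) < y) : x = y := by
  apply le_antisymm <;> refine le_of_not_gt fun hlt ↦ ?_
  · obtain ⟨q, h1, h2⟩ := exists_rat_btwn hlt
    exact absurd ((h q).1 h2) h1.not_gt
  · obtain ⟨q, h1, h2⟩ := exists_rat_btwn hlt
    exact absurd ((h q).2 h2) h1.not_gt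

theorem ratExt_mul (f g : ℚ ≃o ℚ) (x : ℝ) : ratExt (f * g) x = ratExt f (ratExt g x) :=
  eq_of_forall_rat_lt_iff fun q ↦ by
    rw [lt_ratExt_iff, lt_ratExt_iff, lt_ratExt_iff]; rfl

theorem ratExt_one (x : ℝ) : ratExt 1 x = x :=
  eq_of_forall_rat_lt_iff fun q ↦ by rw [lt_ratExt_iff]; rfl

theorem ratExt_coe (f : ℚ ≃o ℚ) (r : ℚ) : ratExt f r = f r :=
  eq_of_forall_rat_lt_iff fun q ↦ by
    rw [lt_ratExt_iff]
    norm_cast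
    rw [← f.lt_iff_lt]; simp

theorem ratExt_mono (f : ℚ ≃o ℚ) {x y : ℝ} (h : x ≤ y) : ratExt f x ≤ ratExt f y := by
  refine le_of_not_gt fun hlt ↦ ?_
  obtain ⟨q, h1, h2⟩ := exists_rat_btwn hlt
  rw [lt_ratExt_iff] at h2
  exact absurd ((lt_ratExt_iff f y q).2 (h2.trans_le h)) h1.not_gt

/-- Extension of order automorphisms from `ℚ` to `ℝ`, as a homomorphism. -/
noncomputable def ratExtHom : (ℚ ≃o ℚ) →* (ℝ ≃o ℝ) where
  toFun f :=
    { toFun := ratExt f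
      invFun := ratExt f⁻¹
      left_inv := fun x ↦ by rw [← ratExt_mul, inv_mul_cancel, ratExt_one]
      right_inv := fun x ↦ by rw [← ratExt_mul, mul_inv_cancel, ratExt_one]
      map_rel_iff' := by
        intro x y
        refine ⟨fun h ↦ ?_, ratExt_mono f⟩
        have := ratExt_mono f⁻¹ h
        simpa [← ratExt_mul, ratExt_one] using this }
  map_one' := by ext x; exact ratExt_one x
  map_mul' f g := by ext x; exact ratExt_mul f g x

theorem abs_ratExt_sub_le {f : ℚ ≃o ℚ} {D : ℚ} (hf : ∀ q, |f q - q| ≤ D) (x : ℝ) :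
    |ratExt f x - x| ≤ D := by
  have h1 : ratExt f x ≤ x + D := by
    refine le_of_not_gt fun hlt ↦ ?_
    obtain ⟨q, ha, hb⟩ := exists_rat_btwn hlt
    rw [lt_ratExt_iff] at hb
    have := (abs_le.1 (hf (f.symm q))).2
    rw [OrderIso.apply_symm_apply] at this
    have h3 : (q : ℝ) - (f.symm q : ℚ) ≤ D := by exact_mod_cast this
    linarith
  have h2 : x - D ≤ ratExt f x := by
    refine le_of_not_gt fun hlt ↦ ?_
    obtain ⟨q, ha, hb⟩ := exists_rat_btwn hlt
    refine absurd ((lt_ratExt_iff f x q).2 ?_) ha.not_gt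
    have := (abs_le.1 (hf (f.symm q))).1
    rw [OrderIso.apply_symm_apply] at this
    have h3 : -(D : ℝ) ≤ (q : ℝ) - (f.symm q : ℚ) := by exact_mod_cast this
    linarith
  rw [abs_le]; constructor <;> linarith

/-- A countable left-orderable group acts on `ℝ` by order automorphisms of bounded displacement
such that `0` has trivial stabilizer. -/
theorem IsLeftOrderable.exists_real_action {K : Type*} [Group K] [Countable K]
    (hK : IsLeftOrderable K) :
    ∃ ρ : K →* (ℝ ≃o ℝ), (∀ g t, |ρ g t - t| ≤ 2) ∧ ∀ g, ρ g 0 = 0 → g = 1 := by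
  classical
  obtain ⟨lt, hsto, hinv⟩ := hK
  let _ : LinearOrder K := linearOrderOfSTO lt
  have hlt : ∀ a b c : K, a < b → c * a < c * b := fun a b c h ↦ hinv a b c h
  let Y := Set.Ioo (-1 : ℚ) 1
  have : Nonempty Y := ⟨⟨0, by norm_num, by norm_num⟩⟩
  have : Nonempty (K ×ₗ ℚ) := ⟨toLex (1, 0)⟩
  have : Countable (K ×ₗ ℚ) := inferInstanceAs (Countable (K × ℚ))
  obtain ⟨e⟩ : Nonempty ((K ×ₗ ℚ) ≃o Y) := Order.iso_of_countable_dense _ _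
  let act : K → (K ×ₗ ℚ) → (K ×ₗ ℚ) := fun g p ↦ toLex (g * (ofLex p).1, (ofLex p).2)
  have hact1 : ∀ p, act 1 p = p := fun p ↦ by simp [act]
  have hactm : ∀ g h p, act (g * h) p = act g (act h p) := fun g h p ↦ by
    simp [act, mul_assoc]
  have hactlt : ∀ g p q, p < q → act g p < act g q := by
    intro g p q h
    rw [Prod.Lex.lt_iff] at h ⊢
    rcases h with h | ⟨h, h'⟩
    · exact Or.inl (hlt _ _ _ h)
    · exact Or.inr ⟨by simp [act, h], h'⟩
  let permY : K →* Equiv.Perm Y :=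
    { toFun := fun g ↦
        { toFun := fun y ↦ e (act g (e.symm y))
          invFun := fun y ↦ e (act g⁻¹ (e.symm y))
          left_inv := fun y ↦ by simp [← hactm, hact1]
          right_inv := fun y ↦ by simp [← hactm, hact1] }
      map_one' := by ext y; simp [hact1]
      map_mul' := fun g h ↦ by ext y; simp [hactm] }
  have hpermY : ∀ g y, permY g y = e (act g (e.symm y)) := fun g y ↦ rfl
  let permQ : K →* Equiv.Perm ℚ := (Equiv.Perm.ofSubtype (p := (· ∈ Y))).comp permY
  have hin : ∀ g q (h : q ∈ Y), permQ g q = permY g ⟨q, h⟩ := fun g q h ↦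
    Equiv.Perm.ofSubtype_apply_of_mem _ h
  have hout : ∀ g q, q ∉ Y → permQ g q = q := fun g q h ↦
    Equiv.Perm.ofSubtype_apply_of_not_mem _ h
  have hmono : ∀ g, StrictMono (permQ g) := by
    intro g p q hpq
    by_cases hp : p ∈ Y <;> by_cases hq : q ∈ Y
    · rw [hin g p hp, hin g q hq, hpermY, hpermY]
      have : e.symm ⟨p, hp⟩ < e.symm ⟨q, hq⟩ := by
        rw [e.symm.lt_iff_lt]; exact hpq
      exact e.lt_iff_lt.2 (hactlt g _ _ this)
    · rw [hin g p hp, hout g q hq]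
      have h1 := (permY g ⟨p, hp⟩).2
      have : ¬ q < 1 := fun h ↦ hq ⟨hp.1.trans hpq, h⟩
      exact h1.2.trans_le (not_lt.1 this)
    · rw [hout g p hp, hin g q hq]
      have h1 := (permY g ⟨q, hq⟩).2
      have : ¬ -1 < p := fun h ↦ hp ⟨h, hpq.trans hq.2⟩
      exact (not_lt.1 this).trans_lt h1.1
    · rwa [hout g p hp, hout g q hq]
  let isoQ : K →* (ℚ ≃o ℚ) :=
    { toFun := fun g ↦
        { toEquiv := permQ g
          map_rel_iff' := (hmono g).le_iff_le }
      map_one' := by ext q; simp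
      map_mul' := fun g h ↦ by ext q; simp }
  have hisoQ : ∀ g q, isoQ g q = permQ g q := fun g q ↦ rfl
  have hdisp : ∀ g q, |isoQ g q - q| ≤ 2 := by
    intro g q
    rw [hisoQ]
    by_cases hq : q ∈ Y
    · rw [hin g q hq]
      have h1 := (permY g ⟨q, hq⟩).2
      rw [abs_le]
      constructor <;> linarith [h1.1, h1.2, hq.1, hq.2]
    · rw [hout g q hq]; simp
  let z : Y := e (toLex (1, 0))
  let τ : ℝ ≃o ℝ := OrderIso.addRight (z : ℚ).cast
  refine ⟨((MulAut.conj τ⁻¹).toMonoidHom.comp ratExtHom).comp isoQ, ?_, ?_⟩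
  · intro g t
    have := abs_ratExt_sub_le (hdisp g) (t + (z : ℚ))
    change |ratExt (isoQ g) (t + (z : ℚ)) + -((z : ℚ) : ℝ) - t| ≤ 2
    have h2 : ratExt (isoQ g) (t + (z : ℚ)) + -((z : ℚ) : ℝ) - t =
      ratExt (isoQ g) (t + (z : ℚ)) - (t + (z : ℚ)) := by ring
    rw [h2]; exact_mod_cast this
  · intro g hg
    change ratExt (isoQ g) (0 + (z : ℚ)) + -((z : ℚ) : ℝ) = 0 at hg
    rw [zero_add, ratExt_coe, hisoQ, hin g _ z.2, hpermY] at hg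
    have h1 : ((e (act g (e.symm z)) : Y) : ℚ) = (z : ℚ) := by
      have : (((e (act g (e.symm z)) : Y) : ℚ) : ℝ) = ((z : ℚ) : ℝ) := by linarith
      exact_mod_cast this
    have h2 : act g (e.symm z) = e.symm z := e.injective (by
      rw [e.apply_symm_apply]; exact Subtype.ext h1)
    simp only [z, OrderIso.symm_apply_apply, act] at h2
    simpa using congrArg (fun p ↦ (ofLex p).1) h2

/-- `CornerPath x R v i o g`: there is a list of signed corners with parity `v`, the first one
entered at position `i` and the last one left at position `o`, such that `g` is the product of the
letters `x q ^ (±1)` read at these corners and such that `R j j'` whenever a corner left at `j` is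
followed by a corner entered at `j'`. -/
inductive CornerPath {L : Type*} [Group L] (x : ℤ → L) (R : ℤ → ℤ → Prop) (v : ℤ) :
    ℤ → ℤ → L → Prop
  | fwd (q : ℤ) : 2 ∣ q - v → CornerPath x R v (q - 1) q (x q)
  | bwd (q : ℤ) : 2 ∣ q - v → CornerPath x R v q (q - 1) (x q)⁻¹
  | append {i j i' o : ℤ} {g h : L} : CornerPath x R v i j g → R j i' →
      CornerPath x R v i' o h → CornerPath x R v i o (g * h)

section Corners

variable {L : Type*} [Group L] {x : ℤ → L}

theorem CornerPath.mono {R S : ℤ → ℤ → Prop} (hRS : ∀ i j, R i j → S i j) {v i o : ℤ} {g : L}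
    (h : CornerPath x R v i o g) : CornerPath x S v i o g := by
  induction h with
  | fwd q hq => exact .fwd q hq
  | bwd q hq => exact .bwd q hq
  | append _ hR _ ih₁ ih₂ => exact .append ih₁ (hRS _ _ hR) ih₂

/-- A weak order on positions such that closed corner paths cannot descend strictly. -/
def Admissible {E : Type*} [LE E] (x : ℤ → L) (f : ℤ → E) : Prop :=
  ∀ v i o, CornerPath x (fun j i ↦ f i ≤ f j) v i o 1 → f o ≤ f i

theorem Admissible.path_eq {E : Type*} [LinearOrder E] {f : ℤ → E} (hf : Admissible x f)
    {R : ℤ → ℤ → Prop} (hR : ∀ j i, R j i → f i ≤ f j) {v i o : ℤ} {g : L}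
    (h : CornerPath x R v i o g) :
    ∀ i₀ o₀ g₀, CornerPath x (fun j i ↦ f i ≤ f j) v i₀ o₀ g₀ → f i ≤ f o₀ → f i₀ ≤ f o →
      g₀ * g = 1 → CornerPath x (fun j i ↦ f i = f j ∧ R j i) v i o g := by
  induction h with
  | fwd q hq => exact fun _ _ _ _ _ _ _ ↦ .fwd q hq
  | bwd q hq => exact fun _ _ _ _ _ _ _ ↦ .bwd q hq
  | @append i j i' o g h h₁ hji h₂ ih₁ ih₂ =>
    intro i₀ o₀ g₀ h₀ hi ho hprod
    have h₁' := h₁.mono hR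
    have h₂' := h₂.mono hR
    have e₁ : h * g₀ * g = 1 := by
      have : h * (g₀ * (g * h)) * h⁻¹ = 1 := by rw [hprod]; simp
      simpa [mul_assoc] using this
    refine .append (ih₁ _ _ _ (.append h₂' ho h₀) hi (hR _ _ hji) e₁) ⟨?_, hji⟩
      (ih₂ _ _ _ (.append h₀ hi h₁') (hR _ _ hji) ho (by rw [mul_assoc]; exact hprod))
    refine le_antisymm (hR _ _ hji) (hf v i' j ?_)
    rw [← e₁]
    exact .append (.append h₂' ho h₀) hi h₁'

theorem Admissible.lex {E : Type*} [LinearOrder E] {f : ℤ → E} (hf : Admissible x f) {p : ℤ → ℝ}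
    (hp : ∀ v i o, CornerPath x (fun j i ↦ f i = f j ∧ p i ≤ p j) v i o 1 → f i = f o →
      p o ≤ p i) : Admissible x (fun q ↦ toLex (f q, p q)) := by
  intro v i o h
  have hle : ∀ j i, toLex (f i, p i) ≤ toLex (f j, p j) → f i ≤ f j := by
    intro j i hji
    rcases Prod.Lex.le_iff.1 hji with h | ⟨h, -⟩
    exacts [h.le, h.le]
  by_contra hlt
  have hle' := (not_le.1 hlt).le
  have h1 := hf.path_eq hle h i o 1 (h.mono hle) (hle _ _ hle') (hle _ _ hle') (one_mul 1)
  have h2 := hf v i o (h.mono hle)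
  have hEq : f i = f o := le_antisymm (hle _ _ hle') h2
  refine hlt (Prod.Lex.le_iff.2 (Or.inr ⟨hEq.symm, hp v i o (h1.mono ?_) hEq⟩))
  rintro j i ⟨he, hl⟩
  rcases Prod.Lex.le_iff.1 hl with h | ⟨-, h⟩
  exacts [absurd he h.ne, ⟨he, h⟩]

theorem Admissible.comp {E F : Type*} [LinearOrder E] [LinearOrder F] {f : ℤ → E} {g : ℤ → F}
    (hf : Admissible x f) (hfg : ∀ i j, g i ≤ g j ↔ f i ≤ f j) : Admissible x g := by
  intro v i o h
  exact (hfg _ _).2 (hf v i o (h.mono fun j i ↦ (hfg _ _).1))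

theorem range_finite_of_periodic {E : Type*} {f : ℤ → E} {M : ℤ} (hM : 0 < M)
    (hf : Function.Periodic f M) : (Set.range f).Finite := by
  refine ((Set.finite_Ico 0 M).image f).subset ?_
  rintro _ ⟨q, rfl⟩
  refine ⟨q % M, ⟨Int.emod_nonneg _ hM.ne', Int.emod_lt_of_pos _ hM⟩, ?_⟩
  have h := hf.int_mul (q / M) (q % M)
  rw [← h]; congr 1
  have := Int.emod_add_mul_ediv q M
  push_cast
  linarith [mul_comm M (q / M)]

theorem card_le_of_periodic {e : ℕ} {f : ℤ → Fin e} {M : ℤ} (hM : 0 < M)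
    (hf : Function.Periodic f M) (hs : Function.Surjective f) : (e : ℤ) ≤ M := by
  have h : Function.Surjective (fun t : Finset.Ico 0 M ↦ f t) := by
    intro y
    obtain ⟨q, rfl⟩ := hs y
    refine ⟨⟨q % M, by simp [Int.emod_nonneg _ hM.ne', Int.emod_lt_of_pos _ hM]⟩, ?_⟩
    have h := hf.int_mul (q / M) (q % M)
    change f (q % M) = f q
    rw [← h]; congr 1
    have := Int.emod_add_mul_ediv q M
    push_cast
    linarith [mul_comm M (q / M)]
  have := Fintype.card_le_of_surjective _ h
  simp at this
  omega

theorem exists_compress {E : Type*} [LinearOrder E] {f : ℤ → E} {M : ℤ} (hM : 0 < M)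
    (hf : Function.Periodic f M) :
    ∃ (e : ℕ) (g : ℤ → Fin e), Function.Surjective g ∧ Function.Periodic g M ∧
      ∀ i j, g i ≤ g j ↔ f i ≤ f j := by
  set s := (range_finite_of_periodic hM hf).toFinset with hs
  have hmem : ∀ q, f q ∈ s := fun q ↦ by simp [hs]
  refine ⟨s.card, fun q ↦ (s.orderIsoOfFin rfl).symm ⟨f q, hmem q⟩, ?_, ?_, ?_⟩
  · intro y
    obtain ⟨⟨z, hz⟩, rfl⟩ := (s.orderIsoOfFin rfl).symm.surjective y
    obtain ⟨q, rfl⟩ : z ∈ Set.range f := by simpa [hs] using hz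
    exact ⟨q, rfl⟩
  · intro q
    simp only [hf q]
  · intro i j
    simp

/-- An admissible function with the maximal number of values. -/
structure MaxAdmissible (x : ℤ → L) (M : ℤ) {e : ℕ} (f : ℤ → Fin e) : Prop where
  surj : Function.Surjective f
  periodic : Function.Periodic f M
  admissible : Admissible x f
  maximal : ∀ (e' : ℕ) (g : ℤ → Fin e'), Function.Surjective g → Function.Periodic g M →
    Admissible x g → e' ≤ e

theorem exists_maxAdmissible (x : ℤ → L) {M : ℤ} (hM : 0 < M) :
    ∃ (e : ℕ) (f : ℤ → Fin e), MaxAdmissible x M f := by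
  classical
  let P : ℕ → Prop := fun e ↦ ∃ f : ℤ → Fin e, Function.Surjective f ∧ Function.Periodic f M ∧
    Admissible x f
  have h1 : P 1 := ⟨fun _ ↦ 0, fun y ↦ ⟨0, Subsingleton.elim _ _⟩, fun _ ↦ rfl,
    fun _ _ _ _ ↦ le_rfl⟩
  have hb : ∀ e, P e → e ≤ M.toNat := by
    rintro e ⟨f, hs, hp, -⟩
    have := card_le_of_periodic hM hp hs
    omega
  have hg : P (Nat.findGreatest P M.toNat) := Nat.findGreatest_spec (hb 1 h1) h1
  obtain ⟨f, hs, hp, ha⟩ := hg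
  exact ⟨_, f, hs, hp, ha, fun e' g h1 h2 h3 ↦
    Nat.le_findGreatest (hb e' ⟨g, h1, h2, h3⟩) ⟨g, h1, h2, h3⟩⟩

theorem MaxAdmissible.factors {M : ℤ} (hM : 0 < M) {e : ℕ} {f : ℤ → Fin e}
    (hf : MaxAdmissible x M f) {p : ℤ → ℝ} (hper : Function.Periodic p M)
    (hp : ∀ v i o, CornerPath x (fun j i ↦ f i = f j ∧ p i ≤ p j) v i o 1 → f i = f o →
      p o ≤ p i) {i j : ℤ} (hij : f i = f j) : p i = p j := by
  have ha := hf.admissible.lex hp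
  have hper' : Function.Periodic (fun q ↦ toLex (f q, p q)) M := fun q ↦ by
    simp only [hf.periodic q, hper q]
  obtain ⟨e', g, hs, hg, hle⟩ := exists_compress hM hper'
  have hcard := hf.maximal e' g hs hg (ha.comp hle)
  have heq : ∀ i j, g i = g j ↔ f i = f j ∧ p i = p j := by
    intro i j
    rw [le_antisymm_iff, hle, hle, ← le_antisymm_iff]
    simp
  choose r hr using hs
  have hsurj : Function.Surjective (fun y ↦ f (r y)) := by
    intro c
    obtain ⟨q, rfl⟩ := hf.surj c
    exact ⟨g q, ((heq _ _).1 (hr (g q))).1⟩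
  have he : e' = e := le_antisymm hcard (by simpa using Fintype.card_le_of_surjective _ hsurj)
  subst he
  have hinj := Finite.injective_iff_surjective.2 hsurj
  have key : g i = g j := hinj (by
    change f (r (g i)) = f (r (g j))
    rw [((heq _ _).1 (hr (g i))).1, ((heq _ _).1 (hr (g j))).1, hij])
  exact ((heq _ _).1 key).2

end Corners

/-- The orbit of `0` under successively applying `m (b + 1), m (b + 2), …`. -/
def moverOrbit (m : ℤ → ℝ → ℝ) (b : ℤ) : ℕ → ℝ
  | 0 => 0
  | t + 1 => m (b + t + 1) (moverOrbit m b t)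

theorem exists_periodic_orbit {M : ℕ} (hM : 0 < M) {m : ℤ → ℝ → ℝ}
    (hm : Function.Periodic m (M : ℤ)) {b : ℤ} (h : moverOrbit m b M = 0) :
    ∃ p : ℤ → ℝ, Function.Periodic p (M : ℤ) ∧ p b = 0 ∧ ∀ q, p q = m q (p (q - 1)) := by
  have hM' : (0 : ℤ) < M := by exact_mod_cast hM
  refine ⟨fun q ↦ moverOrbit m b ((q - b) % M).toNat, fun q ↦ ?_, ?_, fun q ↦ ?_⟩
  · have : (q + M - b) % (M : ℤ) = (q - b) % M := by
      rw [show q + M - b = q - b + M by ring, Int.add_emod_right]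
    simp only [this]
  · simp [moverOrbit]
  · obtain ⟨t, ht⟩ : ∃ t : ℕ, (t : ℤ) = (q - 1 - b) % M :=
      ⟨_, Int.toNat_of_nonneg (Int.emod_nonneg _ hM'.ne')⟩
    have htlt : (t : ℤ) < M := ht ▸ Int.emod_lt_of_pos _ hM'
    have hdm := Int.emod_add_mul_ediv (q - 1 - b) M
    rw [← ht] at hdm
    have hmq : m q = m (b + t + 1) := by
      have h1 := hm.int_mul ((q - 1 - b) / M) (b + t + 1)
      rw [← h1]; congr 1
      push_cast
      linarith [mul_comm (M : ℤ) ((q - 1 - b) / M)]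
    have hstep : m q (moverOrbit m b t) = moverOrbit m b (t + 1) := by rw [hmq]; rfl
    simp only [← ht, Int.toNat_natCast, hstep]
    have hq : (q - b) % (M : ℤ) = ((t : ℤ) + 1) % M := by
      rw [show q - b = t + 1 + M * ((q - 1 - b) / M) by linarith, Int.add_mul_emod_self_left]
    by_cases htM : (t : ℤ) + 1 = M
    · rw [hq, htM, Int.emod_self]
      have : t + 1 = M := by exact_mod_cast htM
      rw [this, h]; rfl
    · rw [hq, Int.emod_eq_of_lt (by omega) (by omega)]
      congr 1

/-- Conjugation of an order automorphism of `ℝ` by a homothety; the identity for ratio `0`. -/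
noncomputable def scaleHom (s : ℝ) : (ℝ ≃o ℝ) →* (ℝ ≃o ℝ) where
  toFun φ :=
    { toFun := fun x ↦ if s = 0 then x else s * φ (x / s)
      invFun := fun x ↦ if s = 0 then x else s * φ⁻¹ (x / s)
      left_inv := fun x ↦ by
        by_cases hs : s = 0
        · simp [hs]
        · simp only [hs, if_false, mul_div_cancel_left₀ _ hs]
          rw [show φ⁻¹ (φ (x / s)) = x / s from φ.symm_apply_apply _, mul_div_cancel₀ _ hs]
      right_inv := fun x ↦ by
        by_cases hs : s = 0
        · simp [hs]
        · simp only [hs, if_false, mul_div_cancel_left₀ _ hs]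
          rw [show φ (φ⁻¹ (x / s)) = x / s from φ.apply_symm_apply _, mul_div_cancel₀ _ hs]
      map_rel_iff' := by
        intro x y
        rcases lt_trichotomy s 0 with hs | hs | hs
        · simp only [Equiv.coe_fn_mk, hs.ne, if_false, mul_le_mul_left_of_neg hs, φ.le_iff_le,
            div_le_div_right_of_neg hs]
        · simp [hs]
        · simp only [Equiv.coe_fn_mk, hs.ne', if_false, mul_le_mul_iff_right₀ hs, φ.le_iff_le,
            div_le_div_iff_of_pos_right hs] }
  map_one' := by
    ext x
    by_cases hs : s = 0
    · simp [hs]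
    · simp [hs, mul_div_cancel₀]
  map_mul' φ ψ := by
    ext x
    by_cases hs : s = 0
    · simp [hs]
    · simp [hs]

theorem scaleHom_zero (φ : ℝ ≃o ℝ) (x : ℝ) : scaleHom 0 φ x = x := by simp [scaleHom]

theorem scaleHom_apply {s : ℝ} (hs : s ≠ 0) (φ : ℝ ≃o ℝ) (x : ℝ) :
    scaleHom s φ x = s * φ (x / s) := by simp [scaleHom, hs]

theorem scaleHom_one_left (φ : ℝ ≃o ℝ) (x : ℝ) : scaleHom 1 φ x = φ x := by
  simp [scaleHom_apply]

theorem abs_scaleHom_sub_le {φ : ℝ ≃o ℝ} {D : ℝ} (hφ : ∀ t, |φ t - t| ≤ D) (s x : ℝ) :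
    |scaleHom s φ x - x| ≤ |s| * D := by
  by_cases hs : s = 0
  · subst hs; simp [scaleHom_zero]
  · rw [scaleHom_apply hs]
    have : s * φ (x / s) - x = s * (φ (x / s) - x / s) := by field_simp
    rw [this, abs_mul]
    exact mul_le_mul_of_nonneg_left (hφ _) (abs_nonneg s)

theorem continuous_scaleHom {φ : ℝ ≃o ℝ} {D : ℝ} (hφ : ∀ t, |φ t - t| ≤ D) :
    Continuous fun z : ℝ × ℝ ↦ scaleHom z.1 φ z.2 := by
  rw [continuous_iff_continuousAt]
  rintro ⟨s, x⟩
  by_cases hs : s = 0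
  · subst hs
    rw [ContinuousAt, scaleHom_zero]
    have h1 : Filter.Tendsto (fun z : ℝ × ℝ ↦ scaleHom z.1 φ z.2 - z.2) (nhds (0, x)) (nhds 0) := by
      refine squeeze_zero_norm (a := fun z : ℝ × ℝ ↦ |z.1| * D)
        (fun z ↦ abs_scaleHom_sub_le hφ _ _) ?_
      have : Continuous fun z : ℝ × ℝ ↦ |z.1| * D := by fun_prop
      simpa using this.tendsto ((0 : ℝ), x)
    simpa using h1.add (continuous_snd.tendsto ((0 : ℝ), x))
  · have h1 : ∀ᶠ z : ℝ × ℝ in nhds (s, x), z.1 * φ (z.2 / z.1) = scaleHom z.1 φ z.2 := by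
      have : ∀ᶠ z : ℝ × ℝ in nhds (s, x), z.1 ≠ 0 :=
        continuous_fst.continuousAt.eventually_ne hs
      filter_upwards [this] with z hz
      rw [scaleHom_apply hz]
    refine ContinuousAt.congr ?_ h1
    refine continuousAt_fst.mul (ContinuousAt.comp (g := φ) φ.continuous.continuousAt ?_)
    exact continuousAt_snd.div continuousAt_fst hs

theorem exists_mixed_orbit {M : ℕ} (hM : 0 < M) {φ ψ : ℤ → ℝ ≃o ℝ} {D : ℝ}
    (hφ : ∀ q t, |φ q t - t| ≤ D) (hψ : ∀ q t, |ψ q t - t| ≤ D)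
    (hφM : Function.Periodic φ (M : ℤ)) (hψM : Function.Periodic ψ (M : ℤ)) (b : ℤ)
    (hnet : moverOrbit (fun q ↦ φ q) b M = 0 ∨ moverOrbit (fun q ↦ ψ q) b M ≠ 0) :
    ∃ s₁ s₂ : ℝ, 0 < s₁ ∧ ∃ p : ℤ → ℝ, Function.Periodic p (M : ℤ) ∧ p b = 0 ∧
      ∀ q, p q = scaleHom s₁ (φ q) (scaleHom s₂ (ψ q) (p (q - 1))) := by
  let m : ℝ → ℝ → ℤ → ℝ → ℝ := fun s₁ s₂ q x ↦ scaleHom s₁ (φ q) (scaleHom s₂ (ψ q) x)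
  have hper : ∀ s₁ s₂, Function.Periodic (m s₁ s₂) (M : ℤ) := fun s₁ s₂ q ↦ by
    funext x; simp only [m, hφM q, hψM q]
  have hcont : ∀ t, Continuous fun z : ℝ × ℝ ↦ moverOrbit (m z.1 z.2) b t := by
    intro t
    induction t with
    | zero => exact continuous_const
    | succ t ih =>
      have h1 := (continuous_scaleHom (hψ (b + t + 1))).comp (continuous_snd.prodMk ih)
      exact (continuous_scaleHom (hφ (b + t + 1))).comp (continuous_fst.prodMk h1)
  have h10 : ∀ t, moverOrbit (m 1 0) b t = moverOrbit (fun q ↦ φ q) b t := by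
    intro t
    induction t with
    | zero => rfl
    | succ t ih =>
      change m 1 0 _ (moverOrbit (m 1 0) b t) = φ _ (moverOrbit (fun q ↦ φ q) b t)
      rw [ih]
      simp only [m, scaleHom_zero, scaleHom_one_left]
  have h01 : ∀ s t, moverOrbit (m 0 s) b t = s * moverOrbit (fun q ↦ ψ q) b t := by
    intro s t
    induction t with
    | zero => simp [moverOrbit]
    | succ t ih =>
      change m 0 s _ (moverOrbit (m 0 s) b t) = s * ψ _ (moverOrbit (fun q ↦ ψ q) b t)
      rw [ih]
      simp only [m, scaleHom_zero]
      by_cases hs : s = 0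
      · subst hs; simp [scaleHom_zero]
      · rw [scaleHom_apply hs, mul_div_cancel_left₀ _ hs]
  suffices ∃ s₁ s₂ : ℝ, 0 < s₁ ∧ moverOrbit (m s₁ s₂) b M = 0 by
    obtain ⟨s₁, s₂, hs, h0⟩ := this
    exact ⟨s₁, s₂, hs, exists_periodic_orbit hM (hper s₁ s₂) h0⟩
  by_cases h1 : moverOrbit (fun q ↦ φ q) b M = 0
  · exact ⟨1, 0, one_pos, by rw [h10, h1]⟩
  have h2 := hnet.resolve_left h1
  set N₁ := moverOrbit (fun q ↦ φ q) b M
  set N₂ := moverOrbit (fun q ↦ ψ q) b M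
  let c : ℝ := -(N₁ / N₂)
  let F : ℝ → ℝ := fun t ↦ moverOrbit (m (min 1 (2 - t)) (c * min 1 t)) b M
  have hF : Continuous F := (hcont M).comp (by fun_prop :
    Continuous fun t : ℝ ↦ ((min 1 (2 - t), c * min 1 t) : ℝ × ℝ))
  have hF0 : F 0 = N₁ := by
    simp only [F]
    rw [show min (1 : ℝ) (2 - 0) = 1 by norm_num, show c * min (1 : ℝ) 0 = 0 by norm_num, h10]
  have hF2 : F 2 = -N₁ := by
    simp only [F]
    rw [show min (1 : ℝ) (2 - 2) = 0 by norm_num, show c * min (1 : ℝ) 2 = c by norm_num, h01]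
    simp only [c]; field_simp; rfl
  have hz : (0 : ℝ) ∈ F '' Set.uIcc 0 2 := by
    apply intermediate_value_uIcc hF.continuousOn
    rw [hF0, hF2, Set.mem_uIcc]
    rcases le_total 0 N₁ with h | h
    · right; constructor <;> linarith
    · left; constructor <;> linarith
  obtain ⟨t, ht, h0⟩ := hz
  rw [Set.uIcc_of_le (by norm_num)] at ht
  refine ⟨_, _, ?_, h0⟩
  have : t ≠ 2 := by
    rintro rfl
    rw [hF2] at h0
    exact h1 (by linarith)
  have : t < 2 := lt_of_le_of_ne ht.2 this
  exact lt_min one_pos (by linarith)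

/-- `Reach x f v c c' g`: the class `c` is joined to `c'` by a list of signed corners of parity `v`
with product `g`, consecutive corners being left and entered in the same class of `f`. -/
inductive Reach {L E : Type*} [Group L] (x : ℤ → L) (f : ℤ → E) (v : ℤ) : E → E → L → Prop
  | refl (c : E) : Reach x f v c c 1
  | fwd {c : E} {g : L} (q : ℤ) : Reach x f v c (f (q - 1)) g → 2 ∣ q - v →
      Reach x f v c (f q) (g * x q)
  | bwd {c : E} {g : L} (q : ℤ) : Reach x f v c (f q) g → 2 ∣ q - v →
      Reach x f v c (f (q - 1)) (g * (x q)⁻¹)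

section Movers

variable {L : Type*} [Group L] {x : ℤ → L} {E : Type*} {f : ℤ → E} {v : ℤ}

theorem Reach.trans {a b c : E} {g h : L} (h₁ : Reach x f v a b g) (h₂ : Reach x f v b c h) :
    Reach x f v a c (g * h) := by
  induction h₂ with
  | refl => simpa using h₁
  | fwd q _ hq ih => rw [← mul_assoc]; exact .fwd q ih hq
  | bwd q _ hq ih => rw [← mul_assoc]; exact .bwd q ih hq

theorem Reach.symm {a b : E} {g : L} (h : Reach x f v a b g) : Reach x f v b a g⁻¹ := by
  induction h with
  | refl => simpa using Reach.refl (x := x) _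
  | fwd q _ hq ih =>
    have := (Reach.bwd (x := x) q (.refl (f q)) hq).trans ih
    simpa using this
  | bwd q _ hq ih =>
    have := (Reach.fwd (x := x) q (.refl (f (q - 1))) hq).trans ih
    simpa using this

theorem Reach.step {q : ℤ} (hq : 2 ∣ q - v) : Reach x f v (f (q - 1)) (f q) (x q) := by
  simpa using Reach.fwd (x := x) q (.refl (f (q - 1))) hq

theorem Reach.congr {v' : ℤ} (hv : 2 ∣ v - v') {a b : E} {g : L} (h : Reach x f v a b g) :
    Reach x f v' a b g := by
  induction h with
  | refl => exact .refl _
  | fwd q _ hq ih => exact .fwd q ih (by omega)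
  | bwd q _ hq ih => exact .bwd q ih (by omega)

theorem Reach.mem {S : Subgroup L} (hS : ∀ q, 2 ∣ q - v → x q ∈ S) {a b : E} {g : L}
    (h : Reach x f v a b g) : g ∈ S := by
  induction h with
  | refl => exact S.one_mem
  | fwd q _ hq ih => exact S.mul_mem ih (hS q hq)
  | bwd q _ hq ih => exact S.mul_mem ih (S.inv_mem (hS q hq))

/-- `c` and `c'` lie in the same component for corners of parity `v`. -/
def SameComp (x : ℤ → L) (f : ℤ → E) (v : ℤ) (c c' : E) : Prop := ∃ g, Reach x f v c c' g

theorem sameComp_equivalence : Equivalence (SameComp x f v) :=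
  ⟨fun c ↦ ⟨1, .refl c⟩, fun ⟨_, h⟩ ↦ ⟨_, h.symm⟩, fun ⟨_, h⟩ ⟨_, h'⟩ ↦ ⟨_, h.trans h'⟩⟩

/-- A set of classes saturated for corners of parity `v`. -/
def ClosedFor (f : ℤ → E) (v : ℤ) (C : E → Prop) : Prop :=
  ∀ q, 2 ∣ q - v → (C (f (q - 1)) ↔ C (f q))

theorem closedFor_sameComp (c : E) {u : ℤ} (hu : 2 ∣ u - v) :
    ClosedFor f u (SameComp x f v c) := fun q hq ↦
  ⟨fun h ↦ sameComp_equivalence.trans h ⟨_, .step (by omega)⟩,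
    fun h ↦ sameComp_equivalence.trans h (sameComp_equivalence.symm ⟨_, .step (by omega)⟩)⟩

theorem ClosedFor.not {C : E → Prop} (h : ClosedFor f v C) : ClosedFor f v (fun c ↦ ¬ C c) :=
  fun q hq ↦ not_congr (h q hq)

theorem ClosedFor.and {C D : E → Prop} (h : ClosedFor f v C) (h' : ClosedFor f v D) :
    ClosedFor f v (fun c ↦ C c ∧ D c) :=
  fun q hq ↦ and_congr (h q hq) (h' q hq)

/-- The movers `φ` at corners of parity `v` in `C` come, at every scale, from an action of `L`
twisted by a coboundary on the classes. -/
def Controlled (x : ℤ → L) (f : ℤ → E) (φ : ℤ → ℝ ≃o ℝ) (v : ℤ) (C : E → Prop) : Prop :=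
  ClosedFor f v C ∧ ∀ s : ℝ, ∃ (R : L →* (ℝ ≃o ℝ)) (η : E → ℝ ≃o ℝ), ∀ q, 2 ∣ q - v → C (f q) →
    η (f (q - 1)) * R (x q) * (η (f q))⁻¹ * scaleHom s (φ q) = 1

/-- The movers `φ` are trivial at corners of parity `v` in `C`. -/
def Idle (f : ℤ → E) (φ : ℤ → ℝ ≃o ℝ) (v : ℤ) (C : E → Prop) : Prop :=
  ∀ q, 2 ∣ q - v → C (f q) → φ q = 1

theorem Idle.controlled {φ : ℤ → ℝ ≃o ℝ} {C : E → Prop} (h : Idle f φ v C)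
    (hC : ClosedFor f v C) : Controlled x f φ v C :=
  ⟨hC, fun s ↦ ⟨1, fun _ ↦ 1, fun q hq hc ↦ by simp [h q hq hc]⟩⟩

theorem path_le_of_twisted {C : E → Prop} (hC : ClosedFor f v C) {p : ℤ → ℝ}
    {R : L →* (ℝ ≃o ℝ)} {η : E → ℝ ≃o ℝ}
    (hp : ∀ q, 2 ∣ q - v → C (f q) →
      p (q - 1) = (η (f (q - 1)) * R (x q) * (η (f q))⁻¹) (p q)) {i o : ℤ} {g : L}
    (h : CornerPath x (fun j i ↦ f i = f j ∧ p i ≤ p j) v i o g) (hi : C (f i)) :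
    C (f o) ∧ (η (f i) * R g * (η (f o))⁻¹) (p o) ≤ p i := by
  induction h with
  | fwd q hq =>
    have hc := (hC q hq).1 hi
    exact ⟨hc, (hp q hq hc).ge⟩
  | bwd q hq =>
    refine ⟨(hC q hq).2 hi, ?_⟩
    rw [hp q hq hi, ← RelIso.mul_apply]
    simp [mul_assoc]
  | @append i j i' o g h _ hji _ ih₁ ih₂ =>
    obtain ⟨hj, h₁⟩ := ih₁ hi
    obtain ⟨ho, h₂⟩ := ih₂ (hji.1 ▸ hj)
    refine ⟨ho, le_trans ?_ h₁⟩
    have h₃ := (η (f i) * R g * (η (f j))⁻¹).monotone (h₂.trans hji.2)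
    refine le_trans (le_of_eq ?_) h₃
    rw [← RelIso.mul_apply, hji.1]
    simp [mul_assoc]

theorem MaxAdmissible.factors_of_movers {M : ℤ} (hM : 0 < M) {e : ℕ} {f : ℤ → Fin e}
    (hf : MaxAdmissible x M f) {φ ψ : ℤ → ℝ ≃o ℝ}
    (hctrl : ∀ v c, ∃ C : Fin e → Prop, C c ∧
      ((Controlled x f φ v C ∧ Idle f ψ v C) ∨ (Controlled x f ψ v C ∧ Idle f φ v C)))
    {s₁ s₂ : ℝ} {p : ℤ → ℝ} (hper : Function.Periodic p M)
    (hp : ∀ q, p q = scaleHom s₁ (φ q) (scaleHom s₂ (ψ q) (p (q - 1)))) {i j : ℤ}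
    (hij : f i = f j) : p i = p j := by
  refine hf.factors hM hper (fun v i o hpath hio ↦ ?_) hij
  obtain ⟨C, hCi, hC⟩ := hctrl v (f i)
  have key : ∃ (R : L →* (ℝ ≃o ℝ)) (η : Fin e → ℝ ≃o ℝ), ClosedFor f v C ∧
      ∀ q, 2 ∣ q - v → C (f q) →
      p (q - 1) = (η (f (q - 1)) * R (x q) * (η (f q))⁻¹) (p q) := by
    rcases hC with ⟨⟨hcl, hco⟩, hid⟩ | ⟨⟨hcl, hco⟩, hid⟩
    · obtain ⟨R, η, h⟩ := hco s₁
      refine ⟨R, η, hcl, fun q hq hc ↦ ?_⟩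
      rw [hp q, hid q hq hc, map_one, RelIso.one_apply, ← RelIso.mul_apply, h q hq hc]; rfl
    · obtain ⟨R, η, h⟩ := hco s₂
      refine ⟨R, η, hcl, fun q hq hc ↦ ?_⟩
      rw [hp q, hid q hq hc, map_one, RelIso.one_apply, ← RelIso.mul_apply, h q hq hc]; rfl
  obtain ⟨R, η, hcl, h⟩ := key
  have := (path_le_of_twisted hcl h hpath hCi).2
  rw [hio] at this
  simpa using this

open Classical in
/-- The mover attached to an action `ρ` of `L` and the component of `c₀` for parity `v`, in terms
of labels `γ` of the classes in that component. -/
noncomputable def compMover (x : ℤ → L) (f : ℤ → E) (v : ℤ) (ρ : L →* (ℝ ≃o ℝ)) (c₀ : E)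
    (γ : E → L) (q : ℤ) : ℝ ≃o ℝ :=
  if 2 ∣ q - v ∧ SameComp x f v c₀ (f q) then (ρ (γ (f (q - 1)) * x q * (γ (f q))⁻¹))⁻¹ else 1

variable {ρ : L →* (ℝ ≃o ℝ)} {c₀ : E} {γ : E → L}

theorem compMover_of_mem {q : ℤ} (hq : 2 ∣ q - v) (hc : SameComp x f v c₀ (f q)) :
    compMover x f v ρ c₀ γ q = (ρ (γ (f (q - 1)) * x q * (γ (f q))⁻¹))⁻¹ :=
  if_pos ⟨hq, hc⟩

theorem compMover_of_not_mem {q : ℤ} (h : 2 ∣ q - v → ¬ SameComp x f v c₀ (f q)) :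
    compMover x f v ρ c₀ γ q = 1 :=
  if_neg fun h' ↦ h h'.1 h'.2

theorem controlled_compMover {u : ℤ} (hu : 2 ∣ u - v) :
    Controlled x f (compMover x f v ρ c₀ γ) u (SameComp x f v c₀) := by
  refine ⟨closedFor_sameComp c₀ hu, fun s ↦ ⟨(scaleHom s).comp ρ, fun c ↦ scaleHom s (ρ (γ c)),
    fun q hq hc ↦ ?_⟩⟩
  rw [compMover_of_mem (by omega) hc]
  simp [mul_assoc]

theorem compMover_periodic {M : ℤ} (hM : 2 ∣ M) (hx : Function.Periodic x M)
    (hf : Function.Periodic f M) : Function.Periodic (compMover x f v ρ c₀ γ) M := by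
  intro q
  have h1 : q + M - 1 = q - 1 + M := by ring
  have h2 : (2 ∣ q + M - v) ↔ 2 ∣ q - v := by omega
  by_cases h : 2 ∣ q - v ∧ SameComp x f v c₀ (f q)
  · rw [compMover_of_mem (h2.2 h.1) (by rw [hf q]; exact h.2), compMover_of_mem h.1 h.2, h1, hx q,
      hf q, hf (q - 1)]
  · rw [compMover_of_not_mem (fun h' h'' ↦ h ⟨h2.1 h', by rwa [hf q] at h''⟩),
      compMover_of_not_mem (fun h' h'' ↦ h ⟨h', h''⟩)]

theorem abs_compMover_sub_le (hρ : ∀ g t, |ρ g t - t| ≤ 2) (q : ℤ) (t : ℝ) :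
    |compMover x f v ρ c₀ γ q t - t| ≤ 2 := by
  unfold compMover
  split_ifs
  · rw [← map_inv]; exact hρ _ _
  · simp

/-- If positions in the same class have the same value, then the value at `c₀` is fixed by the
elements reached from `c₀` to itself. -/
theorem fixed_of_factors {s : ℝ} {p : ℤ → ℝ}
    (hp : ∀ q, 2 ∣ q - v → SameComp x f v c₀ (f q) →
      p q = scaleHom s (compMover x f v ρ c₀ γ q) (p (q - 1))) {P : E → ℝ}
    (hP : ∀ q, p q = P (f q)) {c : E} {g : L} (h : Reach x f v c₀ c g) :
    scaleHom s (ρ (g * (γ c)⁻¹)) (P c) = scaleHom s (ρ (γ c₀)⁻¹) (P c₀) := by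
  have hstep : ∀ q, 2 ∣ q - v → SameComp x f v c₀ (f q) →
      scaleHom s (ρ (γ (f (q - 1)) * x q * (γ (f q))⁻¹)) (P (f q)) = P (f (q - 1)) := by
    intro q hq hc
    rw [← hP q, hp q hq hc, compMover_of_mem hq hc, ← RelIso.mul_apply, ← map_mul, hP]
    simp
  induction h with
  | refl => simp
  | @fwd g q h hq ih =>
    rw [← ih, ← hstep q hq ⟨_, .fwd q h hq⟩, ← RelIso.mul_apply, ← map_mul, ← map_mul]
    congr 3; group
  | @bwd g q h hq ih =>
    rw [← ih, ← hstep q hq ⟨_, h⟩, ← RelIso.mul_apply, ← map_mul, ← map_mul]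
    congr 3; group

end Movers

/-- A periodic sequence of nontrivial letters, with letters of parity `v` taken from a subgroup
`S v` acting on `ℝ` through `ρ v` with bounded displacement and freely at `0`. -/
structure LetterData {L : Type*} [Group L] (x : ℤ → L) (M : ℕ) (ρ : ℤ → L →* (ℝ ≃o ℝ))
    (S : ℤ → Subgroup L) : Prop where
  pos : 0 < M
  even : (2 : ℤ) ∣ M
  periodic : Function.Periodic x (M : ℤ)
  ne_one : ∀ q, x q ≠ 1
  mem : ∀ v q, 2 ∣ q - v → x q ∈ S v
  disp : ∀ v g t, |ρ v g t - t| ≤ 2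
  free : ∀ v g, g ∈ S v → ρ v g 0 = 0 → g = 1

/-- Some nontrivial element is reached from `c` to itself. -/
def HasLoop {L E : Type*} [Group L] (x : ℤ → L) (f : ℤ → E) (v : ℤ) (c : E) : Prop :=
  ∃ g, Reach x f v c c g ∧ g ≠ 1

section NoLoops

variable {L : Type*} [Group L] {x : ℤ → L} {M : ℕ} {ρ : ℤ → L →* (ℝ ≃o ℝ)} {S : ℤ → Subgroup L}
  {e : ℕ} {f : ℤ → Fin e}

theorem exists_labels (x : ℤ → L) (f : ℤ → Fin e) (v : ℤ) (c₀ : Fin e) :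
    ∃ γ : Fin e → L, ∀ c, SameComp x f v c₀ c → Reach x f v c₀ c (γ c) := by
  have h : ∀ c, ∃ g, SameComp x f v c₀ c → Reach x f v c₀ c g := by
    intro c
    by_cases h : SameComp x f v c₀ c
    · exact ⟨_, fun _ ↦ h.choose_spec⟩
    · exact ⟨1, fun h' ↦ absurd h' h⟩
  choose γ hγ using h
  exact ⟨γ, hγ⟩

theorem LetterData.not_hasLoop_of_fixed (D : LetterData x M ρ S) {v : ℤ} {c₀ : Fin e}
    {γ : Fin e → L} (hγ : ∀ c, SameComp x f v c₀ c → Reach x f v c₀ c (γ c))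
    {s : ℝ} (hs : s ≠ 0) {p : ℤ → ℝ}
    (hp : ∀ q, 2 ∣ q - v → SameComp x f v c₀ (f q) →
      p q = scaleHom s (compMover x f v (ρ v) c₀ γ q) (p (q - 1)))
    (hP : ∀ i j, f i = f j → p i = p j) (hsurj : Function.Surjective f) {b : ℤ} (hb : f b = c₀)
    {h : L} (hh : h ∈ S v) (hpb : p b = scaleHom s (ρ v h) 0) : ¬ HasLoop x f v c₀ := by
  rintro ⟨g, hg, hg1⟩
  let P : Fin e → ℝ := fun c ↦ p (Function.surjInv hsurj c)
  have hpP : ∀ q, p q = P (f q) := fun q ↦ hP _ _ (Function.surjInv_eq hsurj _).symm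
  have hγ₀ := hγ c₀ ⟨1, .refl _⟩
  have h1 := fixed_of_factors hp hpP hγ₀
  have h2 := fixed_of_factors hp hpP (hg.trans hγ₀)
  rw [← h1, mul_assoc, mul_inv_cancel, mul_one, ← hb, ← hpP, hpb] at h2
  have h3 : scaleHom s (ρ v (h⁻¹ * g * h)) 0 = 0 := by
    rw [map_mul, map_mul, map_mul, map_mul, map_inv, map_inv, RelIso.mul_apply, RelIso.mul_apply,
      h2, map_one, map_one, RelIso.one_apply, ← RelIso.mul_apply, inv_mul_cancel, RelIso.one_apply]
  rw [scaleHom_apply hs, zero_div, mul_eq_zero, or_iff_right hs] at h3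
  have hgS : g ∈ S v := hg.mem fun q hq ↦ D.mem v q hq
  have h4 := D.free v _ ((S v).mul_mem ((S v).mul_mem ((S v).inv_mem hh) hgS) hh) h3
  apply hg1
  have : g = h * (h⁻¹ * g * h) * h⁻¹ := by group
  rw [this, h4]; group

/-- A component mover with loops cannot be completed by another mover to a closed system. -/
theorem LetterData.not_hasLoop_of_mixed (D : LetterData x M ρ S) (hf : MaxAdmissible x M f)
    {v : ℤ} {c₀ : Fin e}
    {γ : Fin e → L} (hγ : ∀ c, SameComp x f v c₀ c → Reach x f v c₀ c (γ c))
    {ψ : ℤ → ℝ ≃o ℝ} {D' : ℝ} (hψ : ∀ q t, |ψ q t - t| ≤ D')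
    (hψM : Function.Periodic ψ (M : ℤ)) (hid : Idle f ψ v (SameComp x f v c₀))
    (hctrl : ∀ v' c, ∃ C : Fin e → Prop, C c ∧
      ((Controlled x f (compMover x f v (ρ v) c₀ γ) v' C ∧ Idle f ψ v' C) ∨
        (Controlled x f ψ v' C ∧ Idle f (compMover x f v (ρ v) c₀ γ) v' C)))
    {b : ℤ} (hb : f b = c₀)
    (hnet : moverOrbit (fun q ↦ compMover x f v (ρ v) c₀ γ q) b M = 0 ∨
      moverOrbit (fun q ↦ ψ q) b M ≠ 0) : ¬ HasLoop x f v c₀ := by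
  obtain ⟨s₁, s₂, hs, p, hper, hp0, hp⟩ := exists_mixed_orbit D.pos
    (φ := compMover x f v (ρ v) c₀ γ) (ψ := ψ) (D := max 2 D')
    (fun q t ↦ (abs_compMover_sub_le (D.disp v) q t).trans (le_max_left _ _))
    (fun q t ↦ (hψ q t).trans (le_max_right _ _))
    (compMover_periodic D.even D.periodic hf.periodic) hψM b hnet
  have hP : ∀ i j, f i = f j → p i = p j := fun i j ↦
    hf.factors_of_movers (by exact_mod_cast D.pos) hctrl hper hp
  refine D.not_hasLoop_of_fixed hγ hs.ne' (fun q hq hc ↦ ?_) hP hf.surj hb (S v).one_mem ?_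
  · rw [hp q, hid q hq hc, map_one, RelIso.one_apply]
  · rw [hp0, map_one, map_one, RelIso.one_apply]

theorem idle_compMover_of_not {v u : ℤ} {σ : L →* (ℝ ≃o ℝ)} {c₀ : Fin e} {γ : Fin e → L}
    {C : Fin e → Prop} (h : ∀ c, C c → 2 ∣ u - v → ¬ SameComp x f v c₀ c) :
    Idle f (compMover x f v σ c₀ γ) u C := fun q hq hc ↦
  compMover_of_not_mem fun hq' ↦ h _ hc (by omega)

theorem LetterData.not_hasLoop_of_closes (D : LetterData x M ρ S) (hf : MaxAdmissible x M f)
    {v : ℤ} {c₀ : Fin e}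
    {γ : Fin e → L} (hγ : ∀ c, SameComp x f v c₀ c → Reach x f v c₀ c (γ c)) {b : ℤ}
    (hnet : moverOrbit (fun q ↦ compMover x f v (ρ v) c₀ γ q) b M = 0) :
    ¬ HasLoop x f v c₀ := by
  have hctrl : ∀ v' c, ∃ C : Fin e → Prop, C c ∧
      ((Controlled x f (compMover x f v (ρ v) c₀ γ) v' C ∧ Idle f 1 v' C) ∨
        (Controlled x f 1 v' C ∧ Idle f (compMover x f v (ρ v) c₀ γ) v' C)) := by
    intro u c
    by_cases h : 2 ∣ u - v ∧ SameComp x f v c₀ c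
    · exact ⟨_, h.2, Or.inl ⟨controlled_compMover h.1, fun _ _ _ ↦ rfl⟩⟩
    · have hid : Idle f (compMover x f v (ρ v) c₀ γ) u
          (fun c ↦ 2 ∣ u - v → ¬ SameComp x f v c₀ c) := idle_compMover_of_not fun _ h ↦ h
      refine ⟨_, fun h1 h2 ↦ h ⟨h1, h2⟩, Or.inl ⟨hid.controlled ?_, fun _ _ _ ↦ rfl⟩⟩
      by_cases hu : 2 ∣ u - v
      · simpa only [hu, forall_const] using (closedFor_sameComp c₀ hu).not
      · exact fun q hq ↦ by simp [hu]
  obtain ⟨s₁, s₂, hs, p, hper, hp0, hp⟩ := exists_mixed_orbit D.pos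
    (φ := compMover x f v (ρ v) c₀ γ) (ψ := 1) (D := 2)
    (abs_compMover_sub_le (D.disp v)) (fun q t ↦ by simp)
    (compMover_periodic D.even D.periodic hf.periodic) (fun _ ↦ rfl) b (Or.inl hnet)
  have hP : ∀ i j, f i = f j → p i = p j := fun i j ↦
    hf.factors_of_movers (by exact_mod_cast D.pos) hctrl hper hp
  have hp' : ∀ q, p q = scaleHom s₁ (compMover x f v (ρ v) c₀ γ q) (p (q - 1)) := by
    intro q
    rw [hp q, Pi.one_apply, map_one, RelIso.one_apply]
  have horb : ∀ t : ℕ, ∃ h ∈ S v, p (b + t) = scaleHom s₁ (ρ v h) 0 := by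
    intro t
    induction t with
    | zero => exact ⟨1, (S v).one_mem, by simp [hp0]⟩
    | succ t ih =>
      obtain ⟨h, hh, hpt⟩ := ih
      have h1 := hp' (b + t + 1)
      rw [add_sub_cancel_right, hpt] at h1
      push_cast
      rw [← add_assoc, h1]
      by_cases hm : 2 ∣ (b + t + 1) - v ∧ SameComp x f v c₀ (f (b + t + 1))
      · rw [compMover_of_mem hm.1 hm.2, ← map_inv, ← RelIso.mul_apply, ← map_mul, ← map_mul]
        have hγS : ∀ c, SameComp x f v c₀ c → γ c ∈ S v := fun c hc ↦
          (hγ c hc).mem fun q hq ↦ D.mem v q hq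
        have hm' := (closedFor_sameComp (x := x) (f := f) c₀ (v := v) (u := v) (by simp)
          _ hm.1).2 hm.2
        exact ⟨_, (S v).mul_mem ((S v).inv_mem ((S v).mul_mem ((S v).mul_mem (hγS _ hm')
          (D.mem v _ hm.1)) ((S v).inv_mem (hγS _ hm.2)))) hh, rfl⟩
      · rw [compMover_of_not_mem (fun h1 h2 ↦ hm ⟨h1, h2⟩), map_one, RelIso.one_apply]
        exact ⟨h, hh, rfl⟩
  obtain ⟨q, hq⟩ := hf.surj c₀
  obtain ⟨t, ht⟩ : ∃ t : ℕ, f (b + t) = c₀ := by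
    refine ⟨(q + (|q - b| : ℤ) * M - b).toNat, ?_⟩
    have h0 : (1 : ℤ) ≤ M := by exact_mod_cast D.pos
    have h1 : 0 ≤ q + |q - b| * (M : ℤ) - b := by
      nlinarith [neg_abs_le (q - b), abs_nonneg (q - b)]
    rw [Int.toNat_of_nonneg h1, add_sub_cancel, ← hq]
    exact_mod_cast hf.periodic.int_mul |q - b| q
  obtain ⟨h, hh, hpt⟩ := horb t
  exact D.not_hasLoop_of_fixed hγ hs.ne' (fun q _ _ ↦ hp' q) hP hf.surj ht hh hpt

theorem LetterData.hasLoop_unique (D : LetterData x M ρ S) (hf : MaxAdmissible x M f)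
    {v v' : ℤ} {c c' : Fin e} (hc : HasLoop x f v c) (hc' : HasLoop x f v' c') :
    2 ∣ v - v' ∧ SameComp x f v c c' := by
  by_contra hne
  obtain ⟨γ, hγ⟩ := exists_labels x f v c
  obtain ⟨γ', hγ'⟩ := exists_labels x f v' c'
  obtain ⟨b, hb⟩ := hf.surj c
  have hdisj : ∀ d, 2 ∣ v - v' → SameComp x f v c d → ¬ SameComp x f v' c' d := by
    intro d hv h1 ⟨g, h2⟩
    exact hne ⟨hv, sameComp_equivalence.trans h1
      (sameComp_equivalence.symm ⟨g, h2.congr (by omega)⟩)⟩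
  refine D.not_hasLoop_of_mixed hf hγ (ψ := compMover x f v' (ρ v') c' γ')
    (abs_compMover_sub_le (D.disp v')) (compMover_periodic D.even D.periodic hf.periodic)
    (idle_compMover_of_not fun d hd hv ↦ hdisj d hv hd) (fun u d ↦ ?_) hb
    (Or.inr fun h ↦ D.not_hasLoop_of_closes hf hγ' h hc') hc
  by_cases h : 2 ∣ u - v ∧ SameComp x f v c d
  · exact ⟨_, h.2, Or.inl ⟨controlled_compMover h.1,
      idle_compMover_of_not fun d' hd' hu ↦ hdisj d' (by omega) hd'⟩⟩
  by_cases h' : 2 ∣ u - v' ∧ SameComp x f v' c' d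
  · exact ⟨_, h'.2, Or.inr ⟨controlled_compMover h'.1,
      idle_compMover_of_not fun d' hd' hu h1 ↦ hdisj d' (by omega) h1 hd'⟩⟩
  have hcl : ∀ (w : ℤ) (d : Fin e),
      ClosedFor f u (fun d' ↦ 2 ∣ u - w → ¬ SameComp x f w d d') := by
    intro w d
    by_cases hu : 2 ∣ u - w
    · simpa only [hu, forall_const] using (closedFor_sameComp d hu).not
    · exact fun q hq ↦ by simp [hu]
  have hid : Idle f (compMover x f v (ρ v) c γ) u (fun d' ↦ (2 ∣ u - v → ¬ SameComp x f v c d') ∧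
      (2 ∣ u - v' → ¬ SameComp x f v' c' d')) := idle_compMover_of_not fun _ h ↦ h.1
  exact ⟨_, ⟨fun h1 h2 ↦ h ⟨h1, h2⟩, fun h1 h2 ↦ h' ⟨h1, h2⟩⟩,
    Or.inl ⟨hid.controlled ((hcl v c).and (hcl v' c')), idle_compMover_of_not fun _ h ↦ h.2⟩⟩

end NoLoops

/-- The translations at corners of parity `w` given by the coboundary of `δ`. -/
noncomputable def transMover {e : ℕ} (f : ℤ → Fin e) (w : ℤ) (δ : Fin e → ℝ) (q : ℤ) : ℝ ≃o ℝ :=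
  if 2 ∣ q - w then OrderIso.addRight (δ (f q) - δ (f (q - 1))) else 1

/-- Functions on classes that are constant along corners of parity `v`. -/
def cornerInvariant {e : ℕ} (f : ℤ → Fin e) (v : ℤ) : Submodule ℝ (Fin e → ℝ) where
  carrier := {P | ∀ q, 2 ∣ q - v → P (f q) = P (f (q - 1))}
  add_mem' := fun h h' q hq ↦ by simp [h q hq, h' q hq]
  zero_mem' := fun _ _ ↦ rfl
  smul_mem' := fun r P h q hq ↦ by simp [h q hq]

/-- The total translation over one period. -/
noncomputable def netTranslation {e : ℕ} (f : ℤ → Fin e) (w b : ℤ) (M : ℕ) :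
    (Fin e → ℝ) →ₗ[ℝ] ℝ where
  toFun δ := ∑ t ∈ Finset.range M,
    if 2 ∣ b + t + 1 - w then δ (f (b + t + 1)) - δ (f (b + t)) else 0
  map_add' δ δ' := by
    rw [← Finset.sum_add_distrib]
    refine Finset.sum_congr rfl fun t _ ↦ ?_
    split_ifs <;> simp; ring
  map_smul' r δ := by
    rw [RingHom.id_apply, smul_eq_mul, Finset.mul_sum]
    refine Finset.sum_congr rfl fun t _ ↦ ?_
    split_ifs <;> simp; ring

section Count

variable {L : Type*} [Group L] {x : ℤ → L} {M : ℕ} {ρ : ℤ → L →* (ℝ ≃o ℝ)} {S : ℤ → Subgroup L}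
  {e : ℕ} {f : ℤ → Fin e}

theorem transMover_apply (f : ℤ → Fin e) (w : ℤ) (δ : Fin e → ℝ) (q : ℤ) (t : ℝ) :
    transMover f w δ q t = t + if 2 ∣ q - w then δ (f q) - δ (f (q - 1)) else 0 := by
  unfold transMover
  split_ifs <;> simp

theorem scaleHom_addRight (s a t : ℝ) :
    scaleHom s (OrderIso.addRight a) t = t + s * a := by
  by_cases hs : s = 0
  · subst hs; simp [scaleHom_zero]
  · rw [scaleHom_apply hs, OrderIso.addRight_apply]; field_simp

theorem transMover_periodic (hM : (2 : ℤ) ∣ M) (hf : Function.Periodic f (M : ℤ)) (w : ℤ)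
    (δ : Fin e → ℝ) : Function.Periodic (transMover f w δ) (M : ℤ) := by
  intro q
  have h1 : q + M - 1 = q - 1 + M := by ring
  have h2 : (2 ∣ q + M - w) ↔ 2 ∣ q - w := by omega
  ext t
  simp only [transMover_apply, h1, h2, hf q, hf (q - 1)]

theorem exists_transMover_bound (f : ℤ → Fin e) (w : ℤ) (δ : Fin e → ℝ) :
    ∃ D : ℝ, ∀ q t, |transMover f w δ q t - t| ≤ D := by
  refine ⟨2 * ∑ c, |δ c|, fun q t ↦ ?_⟩
  rw [transMover_apply, add_sub_cancel_left]
  have h : ∀ c, |δ c| ≤ ∑ c, |δ c| := fun c ↦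
    Finset.single_le_sum (f := fun c ↦ |δ c|) (fun _ _ ↦ abs_nonneg _) (Finset.mem_univ c)
  split_ifs
  · exact (abs_sub _ _).trans (by linarith [h (f q), h (f (q - 1))])
  · simpa using Finset.sum_nonneg fun c _ ↦ abs_nonneg (δ c)

theorem controlled_transMover (w : ℤ) (δ : Fin e → ℝ) {u : ℤ} (hu : 2 ∣ u - w) :
    Controlled x f (transMover f w δ) u (fun _ ↦ True) := by
  refine ⟨fun _ _ ↦ Iff.rfl, fun s ↦ ⟨1, fun c ↦ OrderIso.addRight (s * δ c), fun q hq _ ↦ ?_⟩⟩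
  ext t
  rw [transMover, if_pos (by omega)]
  simp only [RelIso.mul_apply, scaleHom_addRight, MonoidHom.one_apply, RelIso.one_apply,
    OrderIso.addRight_apply]
  change t + s * (δ (f q) - δ (f (q - 1))) + -(s * δ (f q)) + s * δ (f (q - 1)) = t
  ring

theorem moverOrbit_transMover (f : ℤ → Fin e) (w b : ℤ) (δ : Fin e → ℝ) (t : ℕ) :
    moverOrbit (fun q ↦ transMover f w δ q) b t = netTranslation f w b t δ := by
  induction t with
  | zero => simp [moverOrbit, netTranslation]
  | succ t ih =>
    change transMover f w δ (b + t + 1) (moverOrbit (fun q ↦ transMover f w δ q) b t) = _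
    rw [ih, transMover_apply]
    simp [netTranslation, Finset.sum_range_succ]

theorem LetterData.netTranslation_eq_zero (D : LetterData x M ρ S) (hf : MaxAdmissible x M f)
    {v w : ℤ} (hvw : ¬ 2 ∣ v - w) {c : Fin e} (hc : HasLoop x f v c) (δ : Fin e → ℝ) {b : ℤ}
    (hb : f b = c) : netTranslation f w b M δ = 0 := by
  by_contra hne
  obtain ⟨γ, hγ⟩ := exists_labels x f v c
  obtain ⟨D', hD'⟩ := exists_transMover_bound f w δ
  refine D.not_hasLoop_of_mixed hf hγ (ψ := transMover f w δ) hD'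
    (transMover_periodic D.even hf.periodic w δ) (fun q hq _ ↦ if_neg (by omega))
    (fun u d ↦ ?_) hb (Or.inr (by rwa [moverOrbit_transMover])) hc
  by_cases hu : 2 ∣ u - w
  · exact ⟨_, trivial, Or.inr ⟨controlled_transMover w δ hu,
      fun q hq _ ↦ compMover_of_not_mem fun h ↦ by omega⟩⟩
  · have hid : ∀ C, Idle f (transMover f w δ) u C := fun C q hq _ ↦ if_neg (by omega)
    by_cases hd : SameComp x f v c d
    · exact ⟨_, hd, Or.inl ⟨controlled_compMover (by omega), hid _⟩⟩
    · exact ⟨_, hd, Or.inr ⟨(hid _).controlled (closedFor_sameComp c (by omega)).not,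
        idle_compMover_of_not fun d h _ ↦ h⟩⟩

theorem LetterData.mem_sup_of_netTranslation_eq_zero (D : LetterData x M ρ S)
    (hf : MaxAdmissible x M f) {v w : ℤ} (hvw : ¬ 2 ∣ v - w) {δ : Fin e → ℝ} {b : ℤ}
    (h0 : netTranslation f w b M δ = 0) :
    δ ∈ cornerInvariant f v ⊔ cornerInvariant f w := by
  obtain ⟨D', hD'⟩ := exists_transMover_bound f w δ
  obtain ⟨s₁, s₂, hs, p, hper, hp0, hp⟩ := exists_mixed_orbit D.pos
    (φ := transMover f w δ) (ψ := 1) (D := max D' 0)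
    (fun q t ↦ (hD' q t).trans (le_max_left _ _)) (fun q t ↦ by simp)
    (transMover_periodic D.even hf.periodic w δ) (fun _ ↦ rfl) b
    (Or.inl (by rwa [moverOrbit_transMover]))
  have hP : ∀ i j, f i = f j → p i = p j := fun i j ↦ by
    refine hf.factors_of_movers (by exact_mod_cast D.pos) (fun u d ↦ ?_) hper hp
    refine ⟨fun _ ↦ True, trivial, Or.inl ⟨?_, fun _ _ _ ↦ rfl⟩⟩
    by_cases hu : 2 ∣ u - w
    · exact controlled_transMover w δ hu
    · have hid : Idle f (transMover f w δ) u (fun _ ↦ True) :=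
        fun q hq _ ↦ if_neg (by omega)
      exact hid.controlled fun _ _ ↦ Iff.rfl
  let P : Fin e → ℝ := fun c ↦ p (Function.surjInv hf.surj c)
  have hpP : ∀ q, P (f q) = p q := fun q ↦ hP _ _ (Function.surjInv_eq hf.surj _)
  have hstep : ∀ q, p q = scaleHom s₁ (transMover f w δ q) (p (q - 1)) := by
    intro q
    rw [hp q, Pi.one_apply, map_one, RelIso.one_apply]
  have hv : ∀ q, ¬ 2 ∣ q - w → p q = p (q - 1) := by
    intro q hq
    rw [hstep q, transMover, if_neg hq, map_one, RelIso.one_apply]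
  have hw : ∀ q, 2 ∣ q - w → p q = p (q - 1) + s₁ * (δ (f q) - δ (f (q - 1))) := by
    intro q hq
    rw [hstep q, transMover, if_pos hq, scaleHom_addRight]
  rw [Submodule.mem_sup]
  refine ⟨s₁⁻¹ • P, ?_, δ - s₁⁻¹ • P, ?_, by simp⟩
  · intro q hq
    simp [hpP, hv q (by omega)]
  · intro q hq
    simp only [Pi.sub_apply, Pi.smul_apply, smul_eq_mul, hpP, hw q hq]
    field_simp
    ring

/-- The equivalence relation whose classes are the components for parity `v`. -/
def compSetoid (x : ℤ → L) (f : ℤ → Fin e) (v : ℤ) : Setoid (Fin e) :=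
  ⟨SameComp x f v, sameComp_equivalence⟩

theorem Reach.apply_eq {v : ℤ} {P : Fin e → ℝ} (hP : P ∈ cornerInvariant f v) {a b : Fin e}
    {g : L} (h : Reach x f v a b g) : P a = P b := by
  induction h with
  | refl => rfl
  | fwd q _ hq ih => rw [ih, hP q hq]
  | bwd q _ hq ih => rw [ih, hP q hq]

open Classical in
theorem finrank_cornerInvariant_le (x : ℤ → L) (f : ℤ → Fin e) (v : ℤ) :
    Module.finrank ℝ (cornerInvariant f v) ≤ Fintype.card (Quotient (compSetoid x f v)) := by
  let F : cornerInvariant f v →ₗ[ℝ] (Quotient (compSetoid x f v) → ℝ) :=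
    { toFun := fun P y ↦ P.1 y.out
      map_add' := fun _ _ ↦ rfl
      map_smul' := fun _ _ ↦ rfl }
  have hF : Function.Injective F := by
    intro P Q h
    ext c
    have h1 := congrFun h ⟦c⟧
    obtain ⟨g, hg⟩ : SameComp x f v (Quotient.mk (compSetoid x f v) c).out c :=
      Quotient.mk_out (s := compSetoid x f v) c
    change P.1 _ = Q.1 _ at h1
    rw [hg.apply_eq P.2, hg.apply_eq Q.2] at h1
    exact h1
  simpa using LinearMap.finrank_le_finrank_of_injective hF

theorem sum_card_fiber_quotient (r : Setoid (Fin e)) [DecidableEq (Quotient r)]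
    [Fintype (Quotient r)] :
    ∑ y : Quotient r, (Finset.univ.filter fun c ↦ (⟦c⟧ : Quotient r) = y).card = e := by
  rw [← Finset.card_eq_sum_card_fiberwise (fun _ _ ↦ Finset.mem_univ _)]
  simp

theorem one_le_card_fiber (r : Setoid (Fin e)) [DecidableEq (Quotient r)] (y : Quotient r) :
    1 ≤ (Finset.univ.filter fun c ↦ (⟦c⟧ : Quotient r) = y).card := by
  rw [Nat.one_le_iff_ne_zero, ← Nat.pos_iff_ne_zero, Finset.card_pos]
  exact ⟨y.out, by simp⟩

theorem LetterData.two_le_card_fiber [DecidableEq (Quotient (compSetoid x f v))]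
    (D : LetterData x M ρ S) (hs : Function.Surjective f)
    {c : Fin e} (hc : ¬ HasLoop x f v c) :
    2 ≤ (Finset.univ.filter fun d ↦
      (⟦d⟧ : Quotient (compSetoid x f v)) = ⟦c⟧).card := by
  obtain ⟨q, rfl⟩ := hs c
  have hne : ∃ d, d ≠ f q ∧ SameComp x f v d (f q) := by
    by_cases hq : 2 ∣ q - v
    · refine ⟨f (q - 1), fun h ↦ hc ⟨x q, ?_, D.ne_one q⟩, _, .step hq⟩
      have := Reach.step (x := x) (f := f) hq
      rwa [h] at this
    · have hq' : 2 ∣ (q + 1) - v := by omega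
      have h1 := Reach.step (x := x) (f := f) hq'
      rw [add_sub_cancel_right] at h1
      refine ⟨f (q + 1), fun h ↦ hc ⟨x (q + 1), ?_, D.ne_one _⟩, _, h1.symm⟩
      rwa [h] at h1
  obtain ⟨d, hd, hdc⟩ := hne
  rw [← Finset.card_pair hd]
  refine Finset.card_le_card fun y hy ↦ ?_
  rw [Finset.mem_insert, Finset.mem_singleton] at hy
  rcases hy with rfl | rfl
  · simpa using Quotient.sound (s := compSetoid x f v) hdc
  · simp

theorem finrank_add_finrank_of_sup (f : ℤ → Fin e) (v w : ℤ) :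
    Module.finrank ℝ ↥(cornerInvariant f v ⊔ cornerInvariant f w) + 1 ≤
      Module.finrank ℝ (cornerInvariant f v) + Module.finrank ℝ (cornerInvariant f w) := by
  rw [← Submodule.finrank_sup_add_finrank_inf_eq]
  have hone : (1 : Fin e → ℝ) ∈ cornerInvariant f v ⊓ cornerInvariant f w :=
    ⟨fun _ _ ↦ rfl, fun _ _ ↦ rfl⟩
  have hne : (1 : Fin e → ℝ) ≠ 0 := fun h ↦ by simpa using congrFun h (f 0)
  have : 0 < Module.finrank ℝ ↥(cornerInvariant f v ⊓ cornerInvariant f w) :=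
    Module.finrank_pos_iff_exists_ne_zero.2 ⟨⟨1, hone⟩, fun h ↦ hne (congrArg Subtype.val h)⟩
  omega

theorem LetterData.not_hasLoop (D : LetterData x M ρ S) (hf : MaxAdmissible x M f)
    (v : ℤ) (c : Fin e) : ¬ HasLoop x f v c := by
  classical
  intro hc
  have hvw : ¬ (2 : ℤ) ∣ v - (v + 1) := by omega
  obtain ⟨b, hb⟩ := hf.surj c
  have htop : cornerInvariant f v ⊔ cornerInvariant f (v + 1) = ⊤ :=
    eq_top_iff.2 fun δ _ ↦
      D.mem_sup_of_netTranslation_eq_zero hf hvw (D.netTranslation_eq_zero hf hvw hc δ hb)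
  have h1 := finrank_add_finrank_of_sup f v (v + 1)
  rw [htop, finrank_top, Module.finrank_fin_fun] at h1
  have h2 := finrank_cornerInvariant_le x f v
  have h3 := finrank_cornerInvariant_le x f (v + 1)
  have h4 : 2 * Fintype.card (Quotient (compSetoid x f (v + 1))) ≤ e := by
    refine le_of_le_of_eq ?_ (sum_card_fiber_quotient (compSetoid x f (v + 1)))
    rw [← Finset.card_univ, mul_comm, ← smul_eq_mul, ← Finset.sum_const]
    refine Finset.sum_le_sum fun y _ ↦ ?_
    induction y using Quotient.inductionOn with
    | h d => exact D.two_le_card_fiber hf.surj fun hd ↦ hvw (D.hasLoop_unique hf hc hd).1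
  have h5 : 2 * Fintype.card (Quotient (compSetoid x f v)) ≤ e + 1 := by
    have : ∑ y : Quotient (compSetoid x f v), (if y = ⟦c⟧ then 1 else 0) = 1 := by simp
    refine le_of_le_of_eq ?_ (congrArg (· + 1) (sum_card_fiber_quotient (compSetoid x f v)))
    rw [← this, ← Finset.sum_add_distrib, ← Finset.card_univ, mul_comm, ← smul_eq_mul,
      ← Finset.sum_const]
    refine Finset.sum_le_sum fun y _ ↦ ?_
    by_cases hy : y = ⟦c⟧
    · rw [if_pos hy]
      exact Nat.add_le_add_right (one_le_card_fiber _ y) 1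
    · rw [if_neg hy]
      induction y using Quotient.inductionOn with
      | h d =>
        exact D.two_le_card_fiber hf.surj fun hd ↦
          hy (Quotient.sound (sameComp_equivalence.symm (D.hasLoop_unique hf hc hd).2))
  omega

theorem LetterData.sameComp_iff (D : LetterData x M ρ S) (hf : MaxAdmissible x M f)
    {v : ℤ} {q : ℤ} (hq : 2 ∣ q - v) {d : Fin e} (hd : SameComp x f v (f q) d) :
    d = f q ∨ d = f (q - 1) := by
  classical
  have hvw : ¬ (2 : ℤ) ∣ v - (v + 1) := by omega
  let N := netTranslation f (v + 1) 0 M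
  have hker : LinearMap.ker N ≤ cornerInvariant f v ⊔ cornerInvariant f (v + 1) := fun δ hδ ↦
    D.mem_sup_of_netTranslation_eq_zero hf hvw (LinearMap.mem_ker.1 hδ)
  have h0 := Submodule.finrank_mono hker
  have h0' := LinearMap.finrank_range_add_finrank_ker N
  have h0'' := Submodule.finrank_le (LinearMap.range N)
  rw [Module.finrank_fin_fun] at h0'
  rw [Module.finrank_self] at h0''
  have h1 := finrank_add_finrank_of_sup f v (v + 1)
  have h2 := finrank_cornerInvariant_le x f v
  have h3 := finrank_cornerInvariant_le x f (v + 1)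
  have hle : ∀ u, ∀ y : Quotient (compSetoid x f u), 2 ≤ (Finset.univ.filter fun d ↦
      (⟦d⟧ : Quotient (compSetoid x f u)) = y).card := fun u y ↦ by
    induction y using Quotient.inductionOn with
    | h d => exact D.two_le_card_fiber hf.surj (D.not_hasLoop hf u d)
  have h4 : 2 * Fintype.card (Quotient (compSetoid x f (v + 1))) ≤ e := by
    refine le_of_le_of_eq ?_ (sum_card_fiber_quotient (compSetoid x f (v + 1)))
    rw [← Finset.card_univ, mul_comm, ← smul_eq_mul, ← Finset.sum_const]
    exact Finset.sum_le_sum fun y _ ↦ hle _ y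
  by_contra hcon
  push Not at hcon
  have hne : f (q - 1) ≠ f q := by
    intro h
    have := Reach.step (x := x) (f := f) hq
    rw [h] at this
    exact D.not_hasLoop hf v (f q) ⟨_, this, D.ne_one q⟩
  have h3' : 3 ≤ (Finset.univ.filter fun d ↦
      (⟦d⟧ : Quotient (compSetoid x f v)) = ⟦f q⟧).card := by
    rw [← Finset.card_eq_three.2 ⟨d, f q, f (q - 1), hcon.1, hcon.2, hne.symm, rfl⟩]
    refine Finset.card_le_card fun y hy ↦ ?_
    rw [Finset.mem_insert, Finset.mem_insert, Finset.mem_singleton] at hy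
    rw [Finset.mem_filter]
    refine ⟨Finset.mem_univ _, ?_⟩
    rcases hy with rfl | rfl | rfl
    · exact Quotient.sound (s := compSetoid x f v) (sameComp_equivalence.symm hd)
    · rfl
    · exact Quotient.sound (s := compSetoid x f v) ⟨_, .step hq⟩
  have h5 : 2 * Fintype.card (Quotient (compSetoid x f v)) < e := by
    refine lt_of_lt_of_eq ?_ (sum_card_fiber_quotient (compSetoid x f v))
    rw [← Finset.card_univ, mul_comm, ← smul_eq_mul, ← Finset.sum_const]
    exact Finset.sum_lt_sum (fun y _ ↦ hle _ y) ⟨⟦f q⟧, Finset.mem_univ _, h3'⟩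
  omega

/-- A primitive alternating word admits a strict admissible order of its positions. -/
theorem LetterData.exists_injective_admissible (D : LetterData x M ρ S)
    (hprim : ∀ d : ℤ, 2 ∣ d → Function.Periodic x d → (M : ℤ) ∣ d) :
    ∃ (e : ℕ) (f : ℤ → Fin e), Function.Periodic f (M : ℤ) ∧ Admissible x f ∧
      ∀ q q', f q = f q' → (M : ℤ) ∣ q' - q := by
  obtain ⟨e, f, hf⟩ := exists_maxAdmissible x (M := M) (by exact_mod_cast D.pos)
  refine ⟨e, f, hf.periodic, hf.admissible, fun q q' hqq ↦ ?_⟩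
  have hne : ∀ q, f q ≠ f (q - 1) := by
    intro q h
    have := Reach.step (x := x) (f := f) (v := q) (q := q) (by simp)
    rw [← h] at this
    exact D.not_hasLoop hf q (f q) ⟨_, this, D.ne_one q⟩
  have hnb : ∀ q r, 2 ∣ q - r → f q = f r → f (q - 1) = f (r - 1) := by
    intro q r hqr h
    have h1 : SameComp x f r (f q) (f (r - 1)) := by
      rw [h]; exact sameComp_equivalence.symm ⟨_, .step (by simp)⟩
    rcases D.sameComp_iff hf hqr h1 with h2 | h2
    · exact absurd (h.symm.trans h2.symm) (hne r)
    · exact h2.symm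
  have hnf : ∀ q r, 2 ∣ q - r → f (q - 1) = f (r - 1) → f q = f r := by
    intro q r hqr h
    have h1 : SameComp x f r (f q) (f r) := by
      refine sameComp_equivalence.trans (sameComp_equivalence.symm ⟨_, .step hqr⟩) ?_
      rw [h]; exact ⟨_, .step (by simp)⟩
    rcases D.sameComp_iff hf hqr h1 with h2 | h2
    · exact h2.symm
    · exact absurd (h2.trans h) (hne r)
  have hrf : ∀ q r, 2 ∣ q - r → f q = f (r - 1) → f (q - 1) = f r := by
    intro q r hqr h
    have h1 : SameComp x f r (f q) (f r) := by
      rw [h]; exact ⟨_, .step (by simp)⟩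
    rcases D.sameComp_iff hf hqr h1 with h2 | h2
    · exact absurd (h2.trans h) (hne r)
    · exact h2.symm
  by_cases hpar : 2 ∣ q - q'
  · refine hprim _ (by omega) ?_
    have hfor : ∀ t : ℕ, f (q + t) = f (q' + t) := by
      intro t
      induction t with
      | zero => simpa using hqq
      | succ t ih =>
        push_cast
        exact hnf _ _ (by omega) (by rw [← add_assoc, ← add_assoc]; simpa using ih)
    have hback : ∀ t : ℕ, f (q - t) = f (q' - t) := by
      intro t
      induction t with
      | zero => simpa using hqq
      | succ t ih =>
        push_cast
        rw [← sub_sub, ← sub_sub]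
        exact hnb _ _ (by omega) ih
    have hall : ∀ r, f (r + (q' - q)) = f r := by
      intro r
      rcases le_total q r with h | h
      · have := hfor (r - q).toNat
        rw [Int.toNat_of_nonneg (by omega)] at this
        rw [show r + (q' - q) = q' + (r - q) by ring, ← this]; congr 1; ring
      · have := hback (q - r).toNat
        rw [Int.toNat_of_nonneg (by omega)] at this
        rw [show r + (q' - q) = q' - (q - r) by ring, ← this]; congr 1; ring
    intro r
    have h1 := Reach.step (x := x) (f := f) (v := r) (q := r) (by simp)
    have h2 := Reach.step (x := x) (f := f) (v := r) (q := r + (q' - q)) (by omega)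
    rw [hall, show r + (q' - q) - 1 = r - 1 + (q' - q) by ring, hall] at h2
    by_contra hx
    exact D.not_hasLoop hf r _ ⟨_, h2.trans h1.symm, fun h ↦ hx (mul_inv_eq_one.1 h)⟩
  · exfalso
    have href : ∀ t : ℕ, f (q - t) = f (q' + t) := by
      intro t
      induction t with
      | zero => simpa using hqq
      | succ t ih =>
        push_cast
        rw [← sub_sub, ← add_assoc]
        exact hrf _ _ (by omega) (by simpa using ih)
    have href' : ∀ t : ℕ, f (q + t) = f (q' - t) := by
      intro t
      induction t with
      | zero => simpa using hqq
      | succ t ih =>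
        push_cast
        rw [← sub_sub, ← add_assoc]
        exact (hrf _ _ (by omega) (by simpa using ih.symm)).symm
    rcases le_total q q' with h | h
    · obtain ⟨k, hk⟩ : ∃ k : ℕ, q' - q = 2 * k + 1 := ⟨((q' - q) / 2).toNat, by omega⟩
      have h1 := href' k
      have h2 := hne (q + k + 1)
      rw [add_sub_cancel_right, h1] at h2
      exact h2 (by congr 1; omega)
    · obtain ⟨k, hk⟩ : ∃ k : ℕ, q - q' = 2 * k + 1 := ⟨((q - q') / 2).toNat, by omega⟩
      have h1 := href k
      have h2 := hne (q' + k + 1)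
      rw [add_sub_cancel_right, ← h1] at h2
      exact h2 (by congr 1; omega)

end Count

/-- A noncrossing matching `α` of the letters of `L` pairing each letter with an inverse letter,
together with the vertices `nd` of the planar tree obtained by gluing the boundary circle
along `α`. -/
structure Matching {X : Type*} (L : List (X × Bool)) (α nd : ℕ → ℕ) : Prop where
  lt : ∀ i < L.length, α i < L.length
  invol : ∀ i < L.length, α (α i) = i
  inverse : ∀ i < L.length, L[α i]? = L[i]?.map fun y ↦ (y.1, !y.2)
  noncross : ∀ i < L.length, ∀ j < L.length, i < j → j < α i → i < α j ∧ α j < α i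
  node_start : ∀ i < L.length, nd i = nd (α i + 1)
  node_lt : ∀ i ≤ L.length, 2 * nd i ≤ L.length
  node_surj : ∀ c, 2 * c ≤ L.length → ∃ i ≤ L.length, nd i = c
  node_closed : nd 0 = nd L.length

theorem Matching.nil {X : Type*} : Matching ([] : List (X × Bool)) id (fun _ ↦ 0) where
  lt := by simp
  invol := by simp
  inverse := by simp
  noncross := by simp
  node_start := by simp
  node_lt := by simp
  node_surj := fun c hc ↦ ⟨0, by simp, by simp at hc; omega⟩
  node_closed := rfl

theorem Matching.insert {X : Type*} {L₁ L₂ : List (X × Bool)} {y : X} {b : Bool} {α nd : ℕ → ℕ}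
    (H : Matching (L₁ ++ L₂) α nd) :
    ∃ α' nd', Matching (L₁ ++ (y, b) :: (y, !b) :: L₂) α' nd' := by
  set n := L₁.length with hn
  set m := (L₁ ++ L₂).length with hm
  have hnm : n ≤ m := by simp [hm, hn]
  have hlen : (L₁ ++ (y, b) :: (y, !b) :: L₂).length = m + 2 := by simp [hm]; omega
  let up : ℕ → ℕ := fun i ↦ if i < n then i else i + 2
  have hup : ∀ i, up i = if i < n then i else i + 2 := fun _ ↦ rfl
  let α' : ℕ → ℕ := fun i ↦ if i < n then up (α i) else if i = n then n + 1 else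
    if i = n + 1 then n else up (α (i - 2))
  let nd' : ℕ → ℕ := fun i ↦ if i ≤ n then nd i else if i = n + 1 then m / 2 + 1 else nd (i - 2)
  have hα' : ∀ i, α' i = if i < n then up (α i) else if i = n then n + 1 else
    if i = n + 1 then n else up (α (i - 2)) := fun _ ↦ rfl
  have hnd' : ∀ i, nd' i = if i ≤ n then nd i else if i = n + 1 then m / 2 + 1 else nd (i - 2) :=
    fun _ ↦ rfl
  have hαup : ∀ i, α' (up i) = up (α i) := by
    intro i
    by_cases h : i < n
    · simp [hup i, hα' i, h]
    · simp only [hup i, h, if_false, hα' (i + 2)]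
      rw [if_neg (by omega), if_neg (by omega), if_neg (by omega)]
      simp
  have hget : ∀ i, (L₁ ++ (y, b) :: (y, !b) :: L₂)[up i]? = (L₁ ++ L₂)[i]? := by
    intro i
    by_cases h : i < n
    · rw [hup, if_pos h, List.getElem?_append_left h, List.getElem?_append_left h]
    · rw [hup, if_neg h, List.getElem?_append_right (by omega),
        List.getElem?_append_right (by omega), ← hn, show i + 2 - n = (i - n) + 1 + 1 by omega]
      simp
  have hgetn : (L₁ ++ (y, b) :: (y, !b) :: L₂)[n]? = some (y, b) := by
    rw [List.getElem?_append_right (by omega)]; simp [hn]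
  have hgetn' : (L₁ ++ (y, b) :: (y, !b) :: L₂)[n + 1]? = some (y, !b) := by
    rw [List.getElem?_append_right (by omega)]; simp [hn]
  have hαn : α' n = n + 1 := by simp [hα']
  have hαn' : α' (n + 1) = n := by simp [hα']
  have hcases : ∀ i < m + 2, i = n ∨ i = n + 1 ∨ ∃ i₀ < m, i = up i₀ := by
    intro i hi
    by_cases h1 : i < n
    · exact Or.inr (Or.inr ⟨i, by omega, by rw [hup, if_pos h1]⟩)
    · by_cases h2 : i = n
      · exact Or.inl h2
      · by_cases h3 : i = n + 1
        · exact Or.inr (Or.inl h3)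
        · exact Or.inr (Or.inr ⟨i - 2, by omega, by rw [hup, if_neg (by omega)]; omega⟩)
  have hndup : ∀ i, nd' (up i) = nd i := by
    intro i
    by_cases h : i < n
    · rw [hup, if_pos h, hnd', if_pos h.le]
    · rw [hup, if_neg h, hnd', if_neg (by omega), if_neg (by omega)]; simp
  have hndup' : ∀ i, nd' (up i + 1) = nd (i + 1) := by
    intro i
    by_cases h : i < n
    · rw [hup, if_pos h, hnd', if_pos (by omega)]
    · rw [hup, if_neg h, hnd', if_neg (by omega), if_neg (by omega)]; rfl
  refine ⟨α', nd', ⟨?_, ?_, ?_, ?_, ?_, ?_, ?_, ?_⟩⟩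
  · intro i hi
    rw [hlen] at hi ⊢
    rcases hcases i hi with rfl | rfl | ⟨i, hi', rfl⟩
    · omega
    · omega
    · rw [hαup, hup]
      have := H.lt i hi'
      split_ifs <;> omega
  · intro i hi
    rw [hlen] at hi
    rcases hcases i hi with rfl | rfl | ⟨i, hi', rfl⟩
    · rw [hαn, hαn']
    · rw [hαn', hαn]
    · rw [hαup, hαup, H.invol i hi']
  · intro i hi
    rw [hlen] at hi
    rcases hcases i hi with rfl | rfl | ⟨i, hi', rfl⟩
    · rw [hαn, hgetn, hgetn']; rfl
    · rw [hαn', hgetn, hgetn']; simp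
    · rw [hαup, hget, hget, H.inverse i hi']
  · intro i hi j hj hij hji
    rw [hlen] at hi hj
    rcases hcases i hi with rfl | rfl | ⟨i, hi', rfl⟩
    · omega
    · omega
    · rw [hαup] at hji ⊢
      have hiα := H.lt i hi'
      rcases hcases j hj with rfl | rfl | ⟨j, hj', rfl⟩
      · rw [hαn]
        simp only [hup] at hij hji ⊢
        split_ifs at * <;> omega
      · rw [hαn']
        simp only [hup] at hij hji ⊢
        split_ifs at * <;> omega
      · rw [hαup]
        have hmono : ∀ s t, up s < up t ↔ s < t := by
          intro s t
          rw [hup, hup]; split_ifs <;> omega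
        rw [hmono] at hij hji
        rw [hmono, hmono]
        exact H.noncross i hi' j hj' hij hji
  · intro i hi
    rw [hlen] at hi
    rcases hcases i hi with rfl | rfl | ⟨i, hi', rfl⟩
    · rw [hαn, hnd', hnd', if_pos le_rfl, if_neg (by omega), if_neg (by omega)]
      congr 1
    · rw [hαn']
    · rw [hαup, hndup, hndup', H.node_start i hi']
  · intro i hi
    rw [hlen] at hi ⊢
    rw [hnd']
    split_ifs with h1 h2
    · have := H.node_lt i (by omega); omega
    · omega
    · have := H.node_lt (i - 2) (by omega); omega
  · intro c hc
    rw [hlen] at hc ⊢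
    by_cases h : 2 * c ≤ m
    · obtain ⟨i, hi, rfl⟩ := H.node_surj c h
      refine ⟨up i, ?_, hndup i⟩
      rw [hup]; split_ifs <;> omega
    · exact ⟨n + 1, by omega, by rw [hnd', if_neg (by omega), if_pos rfl]; omega⟩
  · rw [hlen, hnd', hnd', if_pos (by omega), if_neg (by omega)]
    have := H.node_closed
    by_cases h : m + 2 = n + 1
    · omega
    · rw [if_neg h, this]; congr 1

theorem exists_matching {X : Type*} {L : List (X × Bool)} (h : FreeGroup.mk L = 1) :
    ∃ α nd, Matching L α nd := by
  have hred : FreeGroup.Red L [] := by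
    rw [FreeGroup.one_eq_mk] at h
    obtain ⟨c, h1, h2⟩ := FreeGroup.Red.exact.1 h
    rwa [FreeGroup.Red.nil_iff.1 h2] at h1
  induction hred using Relation.ReflTransGen.head_induction_on with
  | refl => exact ⟨_, _, .nil⟩
  | head hs hr ih =>
    obtain ⟨α, nd, H⟩ := ih (by rw [← h]; exact (FreeGroup.Red.exact.2 ⟨_, .refl, .single hs⟩))
    cases hs with
    | not => exact H.insert

/-- Gluing points of a finite set along labelled identifications: every identification destroys at
most one component admitting a compatible potential. -/
theorem exists_gluing {G ι : Type*} [Group G] [DecidableEq ι] (good₀ : Finset ι)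
    (l : List (ι × ι × G)) :
    ∃ (r : ι → ι) (good : Finset ι) (τ : ι → G), good₀.card ≤ good.card + l.length ∧
      (∀ c ∈ good, r c = c) ∧ (∀ c, r c ∈ good → c ∈ good₀) ∧
      ∀ z ∈ l, r z.1 = r z.2.1 ∧ (r z.1 ∈ good → τ z.2.1 = τ z.1 * z.2.2) := by
  induction l with
  | nil => exact ⟨id, good₀, 1, by simp, by simp, by simp, by simp⟩
  | cons y l ih =>
    obtain ⟨r, good, τ, hcard, hfix, hgood, hl⟩ := ih
    obtain ⟨u, v, t⟩ := y
    by_cases huv : r u = r v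
    · refine ⟨r, good.erase (r u), τ, ?_, fun c hc ↦ hfix c (Finset.mem_of_mem_erase hc),
        fun c hc ↦ hgood c (Finset.mem_of_mem_erase hc), ?_⟩
      · have := Finset.pred_card_le_card_erase (s := good) (a := r u)
        simp only [List.length_cons]; omega
      · intro z hz
        rcases List.mem_cons.1 hz with rfl | hz
        · exact ⟨huv, fun h ↦ absurd rfl (Finset.ne_of_mem_erase h)⟩
        · exact ⟨(hl z hz).1, fun h ↦ (hl z hz).2 (Finset.mem_of_mem_erase h)⟩
    · let r' : ι → ι := fun c ↦ if r c = r v then r u else r c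
      let τ' : ι → G := fun c ↦ if r c = r v then τ u * t * (τ v)⁻¹ * τ c else τ c
      have hrr : ∀ c, r' c = if r c = r v then r u else r c := fun _ ↦ rfl
      have hττ : ∀ c, τ' c = if r c = r v then τ u * t * (τ v)⁻¹ * τ c else τ c := fun _ ↦ rfl
      have key : ∀ g : Finset ι, g ⊆ good.erase (r v) → (r u ∈ g → r v ∈ good) →
          (∀ c ∈ g, r' c = c) ∧ (∀ c, r' c ∈ g → c ∈ good₀) ∧
          ∀ z ∈ (u, v, t) :: l, r' z.1 = r' z.2.1 ∧
            (r' z.1 ∈ g → τ' z.2.1 = τ' z.1 * z.2.2) := by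
        intro g hg hgv
        refine ⟨fun c hc ↦ ?_, fun c hc ↦ ?_, fun z hz ↦ ?_⟩
        · have h1 := Finset.mem_erase.1 (hg hc)
          rw [hrr, hfix c h1.2, if_neg h1.1]
        · rw [hrr] at hc
          split_ifs at hc with h
          · exact hgood c (h ▸ hgv hc)
          · exact hgood c (Finset.mem_of_mem_erase (hg hc))
        · rcases List.mem_cons.1 hz with rfl | hz
          · simp only [hrr, hττ, huv, if_true, if_false, true_and]
            intro _; group
          · obtain ⟨h1, h2⟩ := hl z hz
            refine ⟨by rw [hrr, hrr, h1], fun h ↦ ?_⟩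
            rw [hrr] at h
            rw [hττ, hττ, ← h1]
            split_ifs at h ⊢ with h3
            · rw [h2 (h3 ▸ hgv h)]; group
            · exact h2 (Finset.mem_of_mem_erase (hg h))
      by_cases hv : r v ∈ good
      · refine ⟨r', good.erase (r v), τ', ?_, key _ subset_rfl fun _ ↦ hv⟩
        rw [List.length_cons, Finset.card_erase_of_mem hv]; omega
      · refine ⟨r', (good.erase (r v)).erase (r u), τ', ?_, key _ (Finset.erase_subset _ _)
          fun h ↦ absurd rfl (Finset.ne_of_mem_erase h)⟩
        rw [Finset.erase_eq_of_notMem hv]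
        have := Finset.pred_card_le_card_erase (s := good) (a := r u)
        simp only [List.length_cons]; omega

/-- `ConjProd w k g`: the element `g` is a product of `k` conjugates of `w` and `w⁻¹`. -/
inductive ConjProd {G : Type*} [Group G] (w : G) : ℕ → G → Prop
  | one : ConjProd w 0 1
  | cons {k : ℕ} {c g : G} :
      (IsConj w c ∨ IsConj w⁻¹ c) → ConjProd w k g → ConjProd w (k + 1) (c * g)

section ConjProd

variable {G : Type*} [Group G] {w : G}

theorem ConjProd.mul {k l : ℕ} {g h : G} (hg : ConjProd w k g) (hh : ConjProd w l h) :
    ConjProd w (k + l) (g * h) := by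
  induction hg with
  | one => simpa using hh
  | cons hc _ ih => rw [mul_assoc, add_right_comm]; exact .cons hc ih

theorem ConjProd.single {c : G} (hc : IsConj w c ∨ IsConj w⁻¹ c) : ConjProd w 1 c := by
  simpa using ConjProd.cons hc .one

theorem ConjProd.conj {k : ℕ} {g : G} (hg : ConjProd w k g) (y : G) :
    ConjProd w k (y * g * y⁻¹) := by
  induction hg with
  | one => simpa using ConjProd.one
  | @cons k c g hc _ ih =>
    have : y * (c * g) * y⁻¹ = (y * c * y⁻¹) * (y * g * y⁻¹) := by group
    rw [this]
    exact .cons (hc.imp (fun h ↦ h.trans (isConj_iff.2 ⟨y, rfl⟩))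
      (fun h ↦ h.trans (isConj_iff.2 ⟨y, rfl⟩))) ih

theorem ConjProd.exists_of_mem_normalClosure {g : G} (hg : g ∈ Subgroup.normalClosure {w}) :
    ∃ k, ConjProd w k g := by
  have hinv : ∀ c, (IsConj w c ∨ IsConj w⁻¹ c) → (IsConj w c⁻¹ ∨ IsConj w⁻¹ c⁻¹) := by
    intro c hc
    rcases hc with hc | hc <;> obtain ⟨y, rfl⟩ := isConj_iff.1 hc
    · exact Or.inr (isConj_iff.2 ⟨y, by group⟩)
    · exact Or.inl (isConj_iff.2 ⟨y, by group⟩)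
  induction hg using Subgroup.closure_induction with
  | mem c hc =>
    obtain ⟨y, hy, hc⟩ := Group.mem_conjugatesOfSet_iff.1 hc
    rw [Set.mem_singleton_iff.1 hy] at hc
    exact ⟨1, .single (Or.inl hc)⟩
  | one => exact ⟨0, .one⟩
  | mul g h _ _ ihg ihh =>
    obtain ⟨k, hk⟩ := ihg
    obtain ⟨l, hl⟩ := ihh
    exact ⟨_, hk.mul hl⟩
  | inv g _ ih =>
    obtain ⟨k, hk⟩ := ih
    refine ⟨k, ?_⟩
    clear * - hk hinv
    induction hk with
    | one => simpa using ConjProd.one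
    | cons hc _ ih => rw [mul_inv_rev]; exact ih.mul (.single (hinv _ hc))

end ConjProd

/-- A tiling of a polygon over the Bass–Serre tree: the boundary consists of `k` sides, the `j`-th
of which follows a tail of length `h j`, then one period of the line `W`, and then the translate of
the tail backwards.  The map `α` is the matching of the boundary edges which folds the polygon to
a planar tree with vertices `nd`. -/
structure TreePolygon {G : Type*} [Group G] (x W : ℤ → G) (w a : G) (M k : ℕ) where
  (h o α nd : ℕ → ℕ)
  (p v E : ℕ → G)
  (q ε : ℕ → ℤ)
  M_pos : 0 < M
  M_even : 2 ∣ M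
  W_succ : ∀ i, W (i + 1) = W i * x (i + 1)
  W_add : ∀ i, W (i + M) = w * W i
  minimal : ∀ n < k, ¬ ConjProd w n a
  o_zero : o 0 = 0
  o_succ : ∀ j, o (j + 1) = o j + (2 * h j + M)
  α_lt : ∀ i < o k, α i < o k
  α_α : ∀ i < o k, α (α i) = i
  α_odd : ∀ i < o k, (i + α i) % 2 = 1
  noncross : ∀ i < o k, ∀ j < o k, i < j → j < α i → i < α j ∧ α j < α i
  E_α : ∀ i < o k, E (α i) = E i
  nd_start : ∀ i < o k, nd i = nd (α i + 1)
  nd_lt : ∀ i ≤ o k, 2 * nd i ≤ o k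
  nd_surj : ∀ c, 2 * c ≤ o k → ∃ i ≤ o k, nd i = c
  nd_closed : nd 0 = nd (o k)
  p_zero : p 0 = 1
  p_add : ∀ t, p (t + k) = p t * a
  ε_eq : ∀ j, ε j = 1 ∨ ε j = -1
  p_succ : ∀ j < k, p (j + 1) = v j * w ^ ε j * (v j)⁻¹ * p j
  E_ret : ∀ j < k, ∀ s < h j, ∀ y, y + 1 + s = o (j + 1) →
    E y = p (j + 1) * (p j)⁻¹ * E (o j + s)
  E_dart : ∀ j < k, ∀ u < M, E (o j + h j + u) = v j * W (q j + ε j * u)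
  parity : ∀ j < k, (4 : ℤ) ∣ 2 * (o j + h j : ℕ) + 2 * q j + ε j + 1
  α_ret : ∀ j < k, ∀ s < h j, ∀ y, y + 1 + s = o (j + 1) →
    (∃ i < k, o i + h i ≤ α y ∧ α y < o i + h i + M) ∨ ∃ i < k, s < h i ∧ α y = o i + s
  α_out : ∀ j < k, ∀ s < h j,
    (∃ i < k, o i + h i ≤ α (o j + s) ∧ α (o j + s) < o i + h i + M) ∨
      ∃ i < k, s < h i ∧ α (o j + s) + 1 + s = o (i + 1)
  α_dart : ∀ j < k, ∀ u < M, ∀ i < k, ∀ s < h i,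
    α (o j + h j + u) = o i + s ∨ α (o j + h j + u) + 1 + s = o (i + 1) → h j ≤ s

namespace TreePolygon

variable {G : Type*} [Group G] {x W : ℤ → G} {w a : G} {M k : ℕ} (P : TreePolygon x W w a M k)

theorem o_mono : Monotone P.o :=
  monotone_nat_of_le_succ fun j ↦ by rw [P.o_succ]; omega

/-- The side containing a boundary edge. -/
def side (y : ℕ) : ℕ := Nat.findGreatest (fun j ↦ P.o j ≤ y) k

theorem o_side_le (y : ℕ) : P.o (P.side y) ≤ y :=
  Nat.findGreatest_spec (P := fun j ↦ P.o j ≤ y) (Nat.zero_le k) (by simp [P.o_zero])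

theorem side_lt {y : ℕ} (hy : y < P.o k) : P.side y < k := by
  refine lt_of_le_of_ne (Nat.findGreatest_le k) fun h ↦ ?_
  have := P.o_side_le y
  rw [h] at this; omega

theorem lt_o_side_succ {y : ℕ} (hy : y < P.o k) : y < P.o (P.side y + 1) := by
  by_contra hc
  have h1 := P.side_lt hy
  have h2 := Nat.le_findGreatest (P := fun j ↦ P.o j ≤ y) (show P.side y + 1 ≤ k by omega)
    (by omega)
  change P.side y + 1 ≤ P.side y at h2
  omega

theorem side_eq {y j : ℕ} (hj : j < k) (h1 : P.o j ≤ y) (h2 : y < P.o (j + 1)) :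
    P.side y = j := by
  refine le_antisymm ?_ (Nat.le_findGreatest hj.le h1)
  by_contra hc
  have h3 := P.o_mono (show j + 1 ≤ P.side y by omega)
  have h4 := P.o_side_le y
  omega

theorem o_le {j : ℕ} (hj : j < k) : P.o (j + 1) ≤ P.o k := P.o_mono hj

/-- The edges on the line `W`. -/
def IsDart (y : ℕ) : Prop :=
  P.o (P.side y) + P.h (P.side y) ≤ y ∧ y < P.o (P.side y) + P.h (P.side y) + M

theorem isDart_of {y j : ℕ} (hj : j < k) (h1 : P.o j + P.h j ≤ y)
    (h2 : y < P.o j + P.h j + M) : P.IsDart y ∧ P.side y = j := by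
  have h3 := P.o_succ j
  have h4 : P.side y = j := P.side_eq hj (by omega) (by omega)
  exact ⟨by rw [IsDart, h4]; exact ⟨h1, h2⟩, h4⟩

theorem side_out {j s : ℕ} (hj : j < k) (hs : s < P.h j) : P.side (P.o j + s) = j :=
  P.side_eq hj (by omega) (by rw [P.o_succ]; omega)

theorem not_isDart_out {j s : ℕ} (hj : j < k) (hs : s < P.h j) : ¬ P.IsDart (P.o j + s) := by
  rw [IsDart, P.side_out hj hs]; omega

theorem side_ret {j s y : ℕ} (hj : j < k) (hs : s < P.h j) (hy : y + 1 + s = P.o (j + 1)) :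
    P.side y = j := by
  have := P.o_succ j
  exact P.side_eq hj (by omega) (by omega)

theorem not_isDart_ret {j s y : ℕ} (hj : j < k) (hs : s < P.h j) (hy : y + 1 + s = P.o (j + 1)) :
    ¬ P.IsDart y := by
  have := P.o_succ j
  rw [IsDart, P.side_ret hj hs hy]; omega

theorem cases {y : ℕ} (hy : y < P.o k) : P.IsDart y ∨
    (∃ j < k, ∃ s < P.h j, y = P.o j + s) ∨ ∃ j < k, ∃ s < P.h j, y + 1 + s = P.o (j + 1) := by
  have h1 := P.o_side_le y
  have h2 := P.lt_o_side_succ hy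
  have h3 := P.o_succ (P.side y)
  have h4 := P.side_lt hy
  by_cases ha : y < P.o (P.side y) + P.h (P.side y)
  · exact Or.inr (Or.inl ⟨_, h4, y - P.o (P.side y), by omega, by omega⟩)
  · by_cases hb : y < P.o (P.side y) + P.h (P.side y) + M
    · exact Or.inl ⟨by omega, hb⟩
    · exact Or.inr (Or.inr ⟨_, h4, P.o (P.side y + 1) - 1 - y, by omega, by omega⟩)

/-- The position on the line `W` of an edge of the polygon. -/
def pos (y : ℕ) : ℤ := P.q (P.side y) + P.ε (P.side y) * (y - (P.o (P.side y) + P.h (P.side y)))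

theorem E_of_isDart {y : ℕ} (hy : y < P.o k) (hd : P.IsDart y) :
    P.E y = P.v (P.side y) * W (P.pos y) := by
  obtain ⟨h1, h2⟩ := hd
  have := P.E_dart _ (P.side_lt hy) (y - (P.o (P.side y) + P.h (P.side y))) (by omega)
  rw [Nat.add_sub_cancel' h1, Nat.cast_sub h1] at this
  rw [this, pos]; push_cast; rfl

theorem parity_of_isDart {y : ℕ} (hy : y < P.o k) :
    (4 : ℤ) ∣ 2 * y + 2 * P.pos y + P.ε (P.side y) + 1 := by
  have h1 := P.parity _ (P.side_lt hy)
  rw [pos]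
  push_cast at h1
  rcases P.ε_eq (P.side y) with h | h <;> rw [h] at h1 ⊢ <;> omega

/-- The involution exchanging the two copies of each tail. -/
noncomputable def β (y : ℕ) : ℕ :=
  open Classical in
  if P.IsDart y then y else P.o (P.side y) + P.o (P.side y + 1) - 1 - y

theorem β_out {j s y : ℕ} (hj : j < k) (hs : s < P.h j) (hy : y + 1 + s = P.o (j + 1)) :
    P.β (P.o j + s) = y := by
  rw [β, if_neg (P.not_isDart_out hj hs), P.side_out hj hs]; omega

theorem β_ret {j s y : ℕ} (hj : j < k) (hs : s < P.h j) (hy : y + 1 + s = P.o (j + 1)) :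
    P.β y = P.o j + s := by
  rw [β, if_neg (P.not_isDart_ret hj hs hy), P.side_ret hj hs hy]; omega

theorem β_dart {y : ℕ} (hd : P.IsDart y) : P.β y = y := by rw [β, if_pos hd]

theorem β_spec {y : ℕ} (hy : y < P.o k) (hd : ¬ P.IsDart y) :
    P.β y < P.o k ∧ ¬ P.IsDart (P.β y) ∧ P.β (P.β y) = y ∧ (y + P.β y) % 2 = 1 ∧
      P.side (P.β y) = P.side y := by
  have hM := P.M_even
  rcases P.cases hy with hd' | ⟨j, hj, s, hs, rfl⟩ | ⟨j, hj, s, hs, hy'⟩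
  · exact absurd hd' hd
  · have h1 := P.o_succ j
    have h0 : (P.o (j + 1) - 1 - s) + 1 + s = P.o (j + 1) := by omega
    have h2 := P.o_le hj
    rw [P.β_out hj hs h0]
    refine ⟨by omega, P.not_isDart_ret hj hs h0, P.β_ret hj hs h0, by omega, ?_⟩
    rw [P.side_ret hj hs h0, P.side_out hj hs]
  · have h1 := P.o_succ j
    have h2 := P.o_le hj
    rw [P.β_ret hj hs hy']
    refine ⟨by omega, P.not_isDart_out hj hs, P.β_out hj hs hy', by omega, ?_⟩
    rw [P.side_ret hj hs hy', P.side_out hj hs]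

/-- Following the identifications of tails from an edge to an edge on the line. -/
inductive Reaches : ℕ → ℕ → Prop
  | dart {y : ℕ} : P.IsDart (P.α y) → Reaches y (P.α y)
  | tail {y z : ℕ} : ¬ P.IsDart (P.α y) → Reaches (P.β (P.α y)) z → Reaches y z

variable {P}

theorem Reaches.isDart {y z : ℕ} (hr : P.Reaches y z) : P.IsDart z := by
  induction hr with
  | dart h => exact h
  | tail _ _ ih => exact ih

theorem Reaches.lt {y z : ℕ} (hr : P.Reaches y z) (hy : y < P.o k) : z < P.o k := by
  induction hr with
  | dart h => exact P.α_lt _ hy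
  | tail hd _ ih => exact ih (P.β_spec (P.α_lt _ hy) hd).1

theorem Reaches.unique {y z z' : ℕ} (hr : P.Reaches y z) (hr' : P.Reaches y z') : z = z' := by
  induction hr with
  | dart h =>
    cases hr' with
    | dart => rfl
    | tail h' => exact absurd h h'
  | tail h _ ih =>
    cases hr' with
    | dart h' => exact absurd h' h
    | tail _ h' => exact ih h'

theorem Reaches.odd {y z : ℕ} (hr : P.Reaches y z) (hy : y < P.o k) : (y + z) % 2 = 1 := by
  induction hr with
  | dart h => exact P.α_odd _ hy
  | tail hd _ ih =>
    have h1 := P.β_spec (P.α_lt _ hy) hd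
    have h2 := P.α_odd _ hy
    have h3 := ih h1.1
    omega

theorem Reaches.reverse {y z u : ℕ} (hr : P.Reaches y z) (hy : y < P.o k)
    (hu : (P.IsDart y ∧ u = y) ∨ (¬ P.IsDart y ∧ P.Reaches (P.β y) u)) : P.Reaches z u := by
  induction hr with
  | @dart y h =>
    have h1 := P.α_α y hy
    rcases hu with ⟨hd, rfl⟩ | ⟨hd, hu⟩
    · conv => arg 3; rw [← h1]
      exact .dart (by rwa [h1])
    · exact .tail (by rwa [h1]) (by rwa [h1])
  | @tail y z hd _ ih =>
    have h1 := P.α_α y hy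
    have h2 := P.β_spec (P.α_lt _ hy) hd
    refine ih h2.1 (Or.inr ⟨h2.2.1, ?_⟩)
    rw [h2.2.2.1]
    rcases hu with ⟨hd, rfl⟩ | ⟨hd, hu⟩
    · conv => arg 3; rw [← h1]
      exact .dart (by rwa [h1])
    · exact .tail (by rwa [h1]) (by rwa [h1])

theorem Reaches.symm {y z : ℕ} (hr : P.Reaches y z) (hy : y < P.o k) (hd : P.IsDart y) :
    P.Reaches z y :=
  hr.reverse hy (Or.inl ⟨hd, rfl⟩)

theorem exists_reaches {y : ℕ} (hy : y < P.o k) (hd : P.IsDart y) : ∃ z, P.Reaches y z := by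
  by_contra hc
  have hβ : ∀ z < P.o k, P.β z < P.o k ∧ P.β (P.β z) = z := by
    intro z hz
    by_cases hd : P.IsDart z
    · rw [P.β_dart hd]; exact ⟨hz, P.β_dart hd⟩
    · exact ⟨(P.β_spec hz hd).1, (P.β_spec hz hd).2.2.1⟩
  let f : Fin (P.o k) → Fin (P.o k) := fun z ↦ ⟨P.β (P.α z), (hβ _ (P.α_lt _ z.2)).1⟩
  have hf : Function.Injective f := by
    intro z z' hz
    have h1 : P.β (P.α z) = P.β (P.α z') := congrArg Fin.val hz
    have h2 : P.α z = P.α z' := by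
      rw [← (hβ _ (P.α_lt _ z.2)).2, h1, (hβ _ (P.α_lt _ z'.2)).2]
    exact Fin.ext (by rw [← P.α_α _ z.2, h2, P.α_α _ z'.2])
  obtain ⟨n, hn, hper⟩ := hf.mem_periodicPts ⟨y, hy⟩
  have key : ∀ n, (¬ ∃ z, P.Reaches (f^[n] ⟨y, hy⟩).1 z) ∧
      (0 < n → ¬ P.IsDart (f^[n] ⟨y, hy⟩).1) := by
    intro n
    induction n with
    | zero => exact ⟨hc, by simp⟩
    | succ n ih =>
      rw [Function.iterate_succ_apply']
      set t := f^[n] ⟨y, hy⟩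
      have h1 : ¬ P.IsDart (P.α t) := fun h ↦ ih.1 ⟨_, .dart h⟩
      refine ⟨fun ⟨z, hz⟩ ↦ ih.1 ⟨z, .tail h1 hz⟩, fun _ ↦ ?_⟩
      exact (P.β_spec (P.α_lt _ t.2) h1).2.1
  have := (key n).2 hn
  rw [hper.eq] at this
  exact this hd

end TreePolygon

namespace TreePolygon

variable {G : Type*} [Group G] {x W : ℤ → G} {w a : G} {M k : ℕ} (P : TreePolygon x W w a M k)

theorem p_succ_add (t : ℕ) : P.p (t + k + 1) * (P.p (t + k))⁻¹ = P.p (t + 1) * (P.p t)⁻¹ := by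
  rw [show t + k + 1 = t + 1 + k by omega, P.p_add, P.p_add]; group

theorem isConj_p_succ (hk : 0 < k) (t : ℕ) :
    IsConj w (P.p (t + 1) * (P.p t)⁻¹) ∨ IsConj w⁻¹ (P.p (t + 1) * (P.p t)⁻¹) := by
  induction t using Nat.strong_induction_on with
  | _ t ih =>
    by_cases ht : t < k
    · rw [P.p_succ t ht, mul_inv_cancel_right]
      rcases P.ε_eq t with h | h <;> rw [h]
      · exact Or.inl (isConj_iff.2 ⟨P.v t, by simp⟩)
      · exact Or.inr (isConj_iff.2 ⟨P.v t, by simp⟩)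
    · have := ih (t - k) (by omega)
      rwa [← P.p_succ_add (t - k), Nat.sub_add_cancel (by omega)] at this

theorem conjProd_p (hk : 0 < k) (s n : ℕ) : ConjProd w n (P.p (s + n) * (P.p s)⁻¹) := by
  induction n with
  | zero => simpa using ConjProd.one
  | succ n ih =>
    have : P.p (s + (n + 1)) * (P.p s)⁻¹ =
        P.p (s + n + 1) * (P.p (s + n))⁻¹ * (P.p (s + n) * (P.p s)⁻¹) := by
      rw [← add_assoc]; group
    rw [this]
    exact .cons (P.isConj_p_succ hk _) ih

theorem side_mono {y z : ℕ} (h : y ≤ z) : P.side y ≤ P.side z :=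
  Nat.findGreatest_mono_left (fun _ hj ↦ le_trans hj h) k

/-- The boundary edges in cyclic order, starting from `b`. -/
def cyc (b z : ℕ) : ℕ := if b ≤ z then z else z + P.o k

/-- The sides in cyclic order, starting from the side of `b`. -/
def ext (b z : ℕ) : ℕ := if b ≤ z then P.side z else P.side z + k

theorem ext_mono (b : ℕ) {y z : ℕ} (hy : y < P.o k) (hz : z < P.o k)
    (h : P.cyc b y ≤ P.cyc b z) : P.ext b y ≤ P.ext b z := by
  have h1 := P.side_lt hy
  simp only [cyc] at h
  simp only [ext]
  split_ifs at h ⊢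
  · exact P.side_mono h
  · omega
  · omega
  · exact Nat.add_le_add_right (P.side_mono (by omega)) k

theorem cyc_noncross (b : ℕ) {y z : ℕ} (hy : y < P.o k) (hz : z < P.o k)
    (h1 : P.cyc b y < P.cyc b z) (h2 : P.cyc b z < P.cyc b (P.α y)) :
    P.cyc b y < P.cyc b (P.α z) ∧ P.cyc b (P.α z) < P.cyc b (P.α y) := by
  have a1 := P.α_lt y hy
  have a2 := P.α_lt z hz
  have a3 := P.α_α y hy
  have a4 := P.α_α z hz
  have b1 := P.noncross y hy z hz
  have b2 := P.noncross z hz y hy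
  have b3 := P.noncross _ a1 z hz
  have b4 := P.noncross z hz _ a1
  have b5 := P.noncross y hy _ a2
  have b6 := P.noncross _ a2 y hy
  have b7 := P.noncross _ a1 _ a2
  have b8 := P.noncross _ a2 _ a1
  have b9 : P.α z = P.α y → z = y := fun h ↦ by rw [← a4, h, a3]
  have b10 : P.α z = y → z = P.α y := fun h ↦ by rw [← a4, h]
  rw [a3] at b3 b4 b7 b8
  rw [a4] at b5 b6 b7 b8
  simp only [cyc] at *
  split_ifs at * <;> omega

theorem p_succ_ext (b : ℕ) {z : ℕ} :
    P.p (P.ext b z + 1) * (P.p (P.ext b z))⁻¹ = P.p (P.side z + 1) * (P.p (P.side z))⁻¹ := by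
  rw [ext]
  split_ifs
  · rfl
  · exact P.p_succ_add _

theorem E_dart_side {z : ℕ} (hz : z < P.o k) :
    P.p (P.side z + 1) * (P.p (P.side z))⁻¹ =
      P.v (P.side z) * w ^ P.ε (P.side z) * (P.v (P.side z))⁻¹ := by
  rw [P.p_succ _ (P.side_lt hz), mul_inv_cancel_right]

/-- Lying strictly between the two tail edges of height `s` of a side. -/
def Inner (s z : ℕ) : Prop :=
  ∃ j < k, s < P.h j ∧ P.o j + s < z ∧ z + 1 + s < P.o (j + 1)

theorem Inner.lt_h {s z : ℕ} (hz : P.Inner s z) : s < P.h (P.side z) := by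
  obtain ⟨j, hj, hs, h1, h2⟩ := hz
  rwa [P.side_eq hj (by omega) (by omega)]

/-- A chain of tail edges of height `s`, begun at the edge `b`, has arrived at `R`. -/
structure Chain (b s σ R : ℕ) (g : G) : Prop where
  lt : R < P.o k
  E_eq : P.E R = g * P.E b
  prod : ∃ n t X, P.p (P.ext b R + 1) * (P.p σ)⁻¹ = X * g ∧ ConjProd w n X ∧ ConjProd w t g ∧
    n + t + σ = P.ext b R + 1 ∧ n + P.side b ≤ P.ext b R
  zone : ∀ z < P.o k, P.cyc b z < P.cyc b R →
    P.cyc b (P.α z) < P.cyc b R ∨ z = b ∨ P.Inner s z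
  height : R + 1 + s = P.o (P.side R + 1) ∨ P.h (P.side R) ≤ s

variable {P}

theorem Chain.cyc_lt {b s σ R : ℕ} {g : G} (H : P.Chain b s σ R g) (hb : P.α R ≠ b)
    (hi : ¬ P.Inner s (P.α R)) : P.cyc b R < P.cyc b (P.α R) := by
  have h1 := P.α_lt R H.lt
  have h2 := P.α_odd R H.lt
  by_contra hc
  have h3 : P.cyc b (P.α R) ≠ P.cyc b R := by
    have := H.lt
    simp only [cyc]
    split_ifs <;> omega
  have h4 := H.zone _ h1 (by omega)
  rw [P.α_α R H.lt] at h4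
  rcases h4 with h4 | h4 | h4
  · omega
  · exact hb h4
  · exact hi h4

theorem Chain.step {b s σ R j R' : ℕ} {g : G} (H : P.Chain b s σ R g) (hj : j < k)
    (hs : s < P.h j) (hα : P.α R = P.o j + s) (hR' : R' + 1 + s = P.o (j + 1))
    (hb : ¬ (P.o j + s ≤ b ∧ b ≤ R')) :
    P.cyc b R < P.cyc b R' ∧ P.Chain b s σ R' (P.p (j + 1) * (P.p j)⁻¹ * g) := by
  have hM := P.M_pos
  have ho := P.o_succ j
  have hle := P.o_le hj
  have hRlt := H.lt
  have hz := P.α_lt R hRlt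
  have hside := P.side_out hj hs
  have hside' := P.side_ret hj hs hR'
  have hR'lt : R' < P.o k := by omega
  have hni : ¬ P.Inner s (P.α R) := by
    rintro ⟨i, hi, hsi, h1, h2⟩
    rw [hα] at h1 h2
    have := P.side_eq hi (by omega : P.o i ≤ P.o j + s) (by omega)
    rw [hside] at this
    subst this
    omega
  have hlt := H.cyc_lt (by omega) hni
  have hlt' : P.cyc b (P.α R) < P.cyc b R' := by
    rw [hα, cyc, cyc]; split_ifs <;> omega
  have hext : P.ext b R' = P.ext b (P.α R) := by
    rw [hα, ext, ext, hside, hside']; split_ifs <;> omega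
  have hext' : P.ext b R < P.ext b R' := by
    rw [hext]
    refine lt_of_le_of_ne (P.ext_mono b hRlt hz hlt.le) fun h ↦ ?_
    have hsR := P.side_lt hRlt
    have hss : P.side R = j := by
      rw [hα, ext, ext, hside] at h
      split_ifs at h <;> omega
    have hh := H.height
    rw [hss] at hh
    have : R = R' := by omega
    subst this
    omega
  refine ⟨by omega, ⟨hR'lt, ?_, ?_, ?_, ?_⟩⟩
  · rw [P.E_ret j hj s hs R' hR', ← hα, P.E_α R hRlt, H.E_eq, mul_assoc _ g]
  · obtain ⟨n, t, X, h1, h2, h3, h4, h5⟩ := H.prod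
    have hk : 0 < k := by omega
    set d := P.p (j + 1) * (P.p j)⁻¹ with hd
    have hd' : P.p (P.ext b R' + 1) * (P.p (P.ext b R'))⁻¹ = d := by
      rw [P.p_succ_ext, hside']
    have h6 := P.conjProd_p hk (P.ext b R + 1) (P.ext b R' - P.ext b R - 1)
    rw [show P.ext b R + 1 + (P.ext b R' - P.ext b R - 1) = P.ext b R' by omega] at h6
    refine ⟨_, t + 1, _, ?_, (h6.mul h2).conj d, ?_, by omega, by omega⟩
    · have h7 : P.p (P.ext b R' + 1) = d * P.p (P.ext b R') := by rw [← hd']; group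
      have h8 : P.p (P.ext b R + 1) = X * g * P.p σ := by rw [← h1]; group
      rw [h7, h8]; group
    · have : ConjProd w 1 d := by
        rw [← hd']
        exact .single (P.isConj_p_succ hk _)
      rw [add_comm]
      exact this.mul h3
  · intro z hz' hlt2
    rcases lt_trichotomy (P.cyc b z) (P.cyc b R) with h1 | h1 | h1
    · rcases H.zone z hz' h1 with h2 | h2
      · exact Or.inl (by omega)
      · exact Or.inr h2
    · have : z = R := by
        simp only [cyc] at h1
        split_ifs at h1 <;> omega
      subst this
      exact Or.inl (by omega)
    · rcases lt_trichotomy (P.cyc b z) (P.cyc b (P.α R)) with h2 | h2 | h2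
      · exact Or.inl (by have := P.cyc_noncross b hRlt hz' h1 h2; omega)
      · have : z = P.α R := by
          simp only [cyc] at h2
          split_ifs at h2 <;> omega
        subst this
        rw [P.α_α R hRlt]
        exact Or.inl (by omega)
      · refine Or.inr (Or.inr ⟨j, hj, hs, ?_⟩)
        simp only [cyc, hα] at h2 hlt2
        split_ifs at h2 hlt2 <;> omega
  · rw [hside']; exact Or.inl hR'

theorem Chain.α_ne_base {j s R : ℕ} {g : G} (hj : j < k) (hs : s < P.h j)
    (H : P.Chain (P.o j + s) s j R g) (hR : R + 1 + s = P.o (P.side R + 1)) :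
    P.α R ≠ P.o j + s := by
  intro hα
  have hk : 0 < k := by omega
  obtain ⟨n, t, X, h1, h2, h3, h4, h5⟩ := H.prod
  have hg : g = 1 := by
    have := H.E_eq
    rw [← hα, P.E_α R H.lt] at this
    exact mul_eq_right.1 this.symm
  rw [P.side_out hj hs] at h5
  have hext : P.ext (P.o j + s) R < j + k := by
    have h6 := P.side_lt H.lt
    rw [ext]
    split_ifs with h
    · omega
    · have h7 := P.side_mono (show R ≤ P.o j + s by omega)
      rw [P.side_out hj hs] at h7
      have h8 : P.side R ≠ j := by
        intro h8
        rw [h8, P.o_succ] at hR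
        omega
      omega
  have h6 := P.conjProd_p hk (P.ext (P.o j + s) R + 1) (j + k - P.ext (P.o j + s) R - 1)
  rw [show P.ext (P.o j + s) R + 1 + (j + k - P.ext (P.o j + s) R - 1) = j + k by omega] at h6
  have h7 := (h6.mul h2).conj (P.p j)⁻¹
  have h8 : (P.p j)⁻¹ * (P.p (j + k) * (P.p (P.ext (P.o j + s) R + 1))⁻¹ * X) *
      (P.p j)⁻¹⁻¹ = a := by
    rw [hg, mul_one] at h1
    rw [← h1, P.p_add]; group
  rw [h8] at h7
  exact P.minimal _ (by omega) h7

variable (P) in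
theorem exists_reaches_ret {j s R : ℕ} (hj : j < k) (hs : s < P.h j)
    (hR : R + 1 + s = P.o (j + 1)) : ∃ z, P.Reaches R z := by
  by_contra hc
  have ho := P.o_succ j
  have hle := P.o_le hj
  have hM := P.M_pos
  have key : ∀ n R g, 2 * P.o k - P.cyc (P.o j + s) R = n → P.Chain (P.o j + s) s j R g →
      R + 1 + s = P.o (P.side R + 1) → s < P.h (P.side R) → (¬ ∃ z, P.Reaches R z) → False := by
    intro n
    induction n using Nat.strong_induction_on with
    | _ n ih =>
      intro R g hn H hR hsR hc
      have hne := H.α_ne_base hj hs hR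
      have hd : ¬ P.IsDart (P.α R) := fun h ↦ hc ⟨_, .dart h⟩
      have hsk := P.side_lt H.lt
      rcases P.α_ret _ hsk s hsR R hR with ⟨i, hi, h1, h2⟩ | ⟨i, hi, hsi, h1⟩
      · exact hd (P.isDart_of hi h1 h2).1
      · have ho' := P.o_succ i
        have hle' := P.o_le hi
        obtain ⟨R', hR'⟩ : ∃ R', R' + 1 + s = P.o (i + 1) := ⟨P.o (i + 1) - 1 - s, by omega⟩
        have hb : ¬ (P.o i + s ≤ P.o j + s ∧ P.o j + s ≤ R') := by
          rintro ⟨h3, h4⟩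
          have := P.side_eq hi (by omega : P.o i ≤ P.o j + s) (by omega)
          rw [P.side_out hj hs] at this
          subst this
          exact hne h1
        obtain ⟨h3, h4⟩ := H.step hi hsi h1 hR' hb
        have hside := P.side_ret hi hsi hR'
        have hbd : P.cyc (P.o j + s) R' < 2 * P.o k := by
          rw [cyc]; split_ifs <;> omega
        refine ih _ (by omega) R' _ rfl h4 (by rw [hside, hR']) (by rwa [hside]) ?_
        rintro ⟨z, hz⟩
        refine hc ⟨z, .tail hd ?_⟩
        rwa [h1, P.β_out hi hsi hR']
  have hside := P.side_ret hj hs hR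
  have hcyc : P.cyc (P.o j + s) R = R := by rw [cyc, if_pos (by omega)]
  have hext : P.ext (P.o j + s) R = j := by rw [ext, if_pos (by omega), hside]
  refine key _ R (P.p (j + 1) * (P.p j)⁻¹) rfl ⟨by omega, P.E_ret j hj s hs R hR, ?_, ?_, ?_⟩
    (by rw [hside, hR]) (by rwa [hside]) hc
  · refine ⟨0, 1, 1, by rw [hext, one_mul], .one, ?_, by omega, ?_⟩
    · exact .single (P.isConj_p_succ (by omega) j)
    · rw [hext, P.side_out hj hs]; omega
  · intro z hz hlt
    rw [hcyc, cyc] at hlt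
    by_cases hzb : z = P.o j + s
    · exact Or.inr (Or.inl hzb)
    · refine Or.inr (Or.inr ⟨j, hj, hs, ?_⟩)
      split_ifs at hlt <;> omega
  · rw [hside, hR]; exact Or.inl rfl

theorem Chain.not_dvd {e s R : ℕ} {g : G} (H : P.Chain e s (P.side e + 1) R g)
    (he : e < P.o k) (hd : P.IsDart e) (hd' : P.IsDart (P.α R)) (hodd : (e + P.α R) % 2 = 1)
    (hext : P.side (P.α R) ≠ P.side e → P.ext e R < P.ext e (P.α R)) :
    ¬ (M : ℤ) ∣ P.pos (P.α R) - P.pos e := by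
  rintro ⟨n, hn⟩
  have hM := P.M_even
  have hlt := P.α_lt R H.lt
  have hk : 0 < k := by have := P.side_lt he; omega
  have hpar := P.parity_of_isDart he
  have hpar' := P.parity_of_isDart hlt
  have hε : P.ε (P.side (P.α R)) = - P.ε (P.side e) := by
    obtain ⟨m, hm⟩ := hM
    have h2 : P.pos (P.α R) - P.pos e = 2 * (m * n) := by rw [hn, hm]; push_cast; ring
    generalize (m : ℤ) * n = u at h2
    rcases P.ε_eq (P.side e) with h | h <;> rcases P.ε_eq (P.side (P.α R)) with h' | h' <;>
      rw [h] at hpar ⊢ <;> rw [h'] at hpar' ⊢ <;> omega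
  have hne : P.side (P.α R) ≠ P.side e := by
    intro h
    rw [h] at hε
    rcases P.ε_eq (P.side e) with h | h <;> omega
  specialize hext hne
  have hW : ∀ (i n : ℤ), W (i + M * n) = w ^ n * W i := by
    intro i n
    induction n with
    | zero => simp
    | succ n ih =>
      rw [show i + M * ((n : ℤ) + 1) = i + M * n + M by ring, P.W_add, ih, zpow_add_one,
        ← mul_assoc]
      congr 1
      exact (Commute.self_zpow w n).eq
    | pred n ih =>
      have := P.W_add (i + M * (-(n : ℤ) - 1))
      rw [show i + M * (-(n : ℤ) - 1) + M = i + M * -n by ring, ih] at this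
      rw [zpow_sub_one, ← (Commute.self_zpow w (-(n : ℤ))).inv_left.eq, mul_assoc, this]
      group
  set i := P.side e with hi
  set l := P.side (P.α R) with hl
  have hE := P.E_of_isDart hlt hd'
  rw [P.E_α R H.lt, H.E_eq, P.E_of_isDart he hd, ← hi, ← hl,
    show P.pos (P.α R) = P.pos e + M * n by omega, hW, ← mul_assoc, ← mul_assoc,
    mul_left_inj] at hE
  have hDi : P.p (i + 1) * (P.p i)⁻¹ = P.v i * w ^ P.ε i * (P.v i)⁻¹ := P.E_dart_side he
  have hDl : P.p (P.ext e (P.α R) + 1) * (P.p (P.ext e (P.α R)))⁻¹ =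
      P.v l * w ^ P.ε l * (P.v l)⁻¹ := by
    rw [P.p_succ_ext, P.E_dart_side hlt]
  have hconj : P.p (P.ext e (P.α R) + 1) * (P.p (P.ext e (P.α R)))⁻¹ =
      g * (P.p (i + 1) * (P.p i)⁻¹)⁻¹ * g⁻¹ := by
    have hvl : P.v l = g * P.v i * (w ^ n)⁻¹ := by rw [hE]; group
    rw [hDl, hDi, hε, hvl]; group
  have hlk : P.ext e (P.α R) < i + k := by
    have h6 := P.side_lt hlt
    rw [ext]
    split_ifs with h
    · omega
    · have h7 := P.side_mono (show P.α R ≤ e by omega)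
      omega
  obtain ⟨n', t, X, h1, h2, h3, h4, h5⟩ := H.prod
  have hA := P.conjProd_p hk (P.ext e (P.α R) + 1) (i + k - P.ext e (P.α R) - 1)
  rw [show P.ext e (P.α R) + 1 + (i + k - P.ext e (P.α R) - 1) = i + k by omega] at hA
  have hB := P.conjProd_p hk (P.ext e R + 1) (P.ext e (P.α R) - P.ext e R - 1)
  rw [show P.ext e R + 1 + (P.ext e (P.α R) - P.ext e R - 1) = P.ext e (P.α R) by omega] at hB
  set D := P.p (i + 1) * (P.p i)⁻¹ with hD
  have hfin := ((hA.mul ((hB.mul h2).conj (g * D⁻¹ * g⁻¹))).mul h3).conj (P.p i)⁻¹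
  have hfa : (P.p i)⁻¹ * (P.p (i + k) * (P.p (P.ext e (P.α R) + 1))⁻¹ * (g * D⁻¹ * g⁻¹ *
      (P.p (P.ext e (P.α R)) * (P.p (P.ext e R + 1))⁻¹ * X) * (g * D⁻¹ * g⁻¹)⁻¹) * g) *
      (P.p i)⁻¹⁻¹ = a := by
    have e1 : P.p (P.ext e (P.α R) + 1) = g * D⁻¹ * g⁻¹ * P.p (P.ext e (P.α R)) := by
      rw [← hconj]; group
    have e2 : P.p (P.ext e R + 1) = X * g * P.p (i + 1) := by rw [← h1]; group
    have e3 : P.p (i + 1) = D * P.p i := by rw [hD]; group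
    rw [e1, e2, e3, P.p_add]; group
  rw [hfa] at hfin
  exact P.minimal _ (by omega) hfin

theorem Reaches.not_dvd_aux {e s R z : ℕ} (hr : P.Reaches R z) {g : G}
    (H : P.Chain e s (P.side e + 1) R g) (he : e < P.o k) (hd : P.IsDart e)
    (hes : P.h (P.side e) ≤ s) (hodd : (e + z) % 2 = 1)
    (hR : s < P.h (P.side R) ∧ R + 1 + s = P.o (P.side R + 1)) :
    ¬ (M : ℤ) ∣ P.pos z - P.pos e := by
  induction hr generalizing g with
  | @dart R hdR =>
    refine H.not_dvd he hd hdR hodd fun hne ↦ ?_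
    have hlt := P.α_lt R H.lt
    have h1 : P.h (P.side (P.α R)) ≤ s := by
      have := P.α_dart _ (P.side_lt hlt)
        (P.α R - (P.o (P.side (P.α R)) + P.h (P.side (P.α R))))
        (by have := hdR.1; have := hdR.2; omega) _ (P.side_lt H.lt) s hR.1
      rw [Nat.add_sub_cancel' hdR.1, P.α_α R H.lt] at this
      exact this (Or.inr hR.2)
    have h2 := H.cyc_lt (by rintro rfl; exact hne rfl)
      (fun h ↦ by have := Inner.lt_h P h; omega)
    refine lt_of_le_of_ne (P.ext_mono e H.lt hlt h2.le) fun h ↦ ?_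
    have hsR := P.side_lt H.lt
    have hsl := P.side_lt hlt
    have hss : P.side R = P.side (P.α R) := by
      simp only [ext] at h
      split_ifs at h <;> omega
    rw [hss] at hR
    omega
  | @tail R z hdR _ ih =>
    rcases P.α_ret _ (P.side_lt H.lt) s hR.1 R hR.2 with ⟨i, hi, h1, h2⟩ | ⟨i, hi, hsi, h1⟩
    · exact absurd (P.isDart_of hi h1 h2).1 hdR
    · have ho' := P.o_succ i
      obtain ⟨R', hR'⟩ : ∃ R', R' + 1 + s = P.o (i + 1) := ⟨P.o (i + 1) - 1 - s, by omega⟩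
      have hb : ¬ (P.o i + s ≤ e ∧ e ≤ R') := by
        rintro ⟨h3, h4⟩
        have := P.side_eq hi (by omega : P.o i ≤ e) (by omega)
        rw [this] at hes
        omega
      have h4 := (H.step hi hsi h1 hR' hb).2
      have hside := P.side_ret hi hsi hR'
      rw [h1, P.β_out hi hsi hR'] at ih
      exact ih h4 hodd (by rw [hside]; exact ⟨hsi, hR'⟩)

theorem chain_self {e : ℕ} (he : e < P.o k) {s : ℕ} (hs : P.h (P.side e) ≤ s) :
    P.Chain e s (P.side e + 1) e 1 := by
  have hext : P.ext e e = P.side e := by rw [ext, if_pos le_rfl]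
  refine ⟨he, (one_mul _).symm, ⟨0, 0, 1, by rw [hext]; group, .one, .one, by omega, by omega⟩,
    fun z hz hlt ↦ ?_, Or.inr hs⟩
  simp only [cyc] at hlt
  split_ifs at hlt <;> omega

theorem Reaches.not_dvd_of_out {e z : ℕ} (hr : P.Reaches e z) (he : e < P.o k) (hd : P.IsDart e)
    (hα : P.IsDart (P.α e) ∨ ∃ j < k, ∃ s < P.h j, P.α e = P.o j + s) :
    ¬ (M : ℤ) ∣ P.pos z - P.pos e := by
  have hodd := hr.odd he
  cases hr with
  | dart hdα =>
    refine (chain_self he le_rfl).not_dvd he hd hdα hodd fun hne ↦ ?_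
    have h1 := P.side_lt he
    have h2 : P.ext e e = P.side e := by rw [ext, if_pos le_rfl]
    rw [h2, ext]
    split_ifs with h
    · have := P.side_mono h
      omega
    · omega
  | tail hdα hr =>
    rcases hα with hα | ⟨j, hj, s, hs, hα⟩
    · exact absurd hα hdα
    · have hes : P.h (P.side e) ≤ s := by
        have := P.α_dart _ (P.side_lt he) (e - (P.o (P.side e) + P.h (P.side e)))
          (by have := hd.1; have := hd.2; omega) _ hj s hs
        rw [Nat.add_sub_cancel' hd.1] at this
        exact this (Or.inl hα)
      have ho' := P.o_succ j
      obtain ⟨R', hR'⟩ : ∃ R', R' + 1 + s = P.o (j + 1) := ⟨P.o (j + 1) - 1 - s, by omega⟩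
      have hb : ¬ (P.o j + s ≤ e ∧ e ≤ R') := by
        rintro ⟨h3, h4⟩
        have := P.side_eq hj (by omega : P.o j ≤ e) (by omega)
        rw [this] at hes
        omega
      have h4 := ((chain_self he hes).step hj hs hα hR' hb).2
      have hside := P.side_ret hj hs hR'
      rw [hα, P.β_out hj hs hR'] at hr
      exact hr.not_dvd_aux h4 he hd hes hodd (by rw [hside]; exact ⟨hs, hR'⟩)

theorem Reaches.α_out_of_out {y z j s : ℕ} (hr : P.Reaches y z) (hj : j < k) (hs : s < P.h j)
    (hy : y = P.o j + s) : ∃ i < k, ∃ s < P.h i, P.α z = P.o i + s := by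
  induction hr generalizing j with
  | @dart y hd =>
    have hlt : y < P.o k := by have := P.o_le hj; have := P.o_succ j; omega
    exact ⟨j, hj, s, hs, by rw [P.α_α y hlt, hy]⟩
  | @tail y z hd _ ih =>
    subst hy
    rcases P.α_out j hj s hs with ⟨i, hi, h1, h2⟩ | ⟨i, hi, hsi, h1⟩
    · exact absurd (P.isDart_of hi h1 h2).1 hd
    · exact ih hi hsi (P.β_ret hi hsi h1)

/-- There are no dipoles: matched edges of faces lie at different positions of `w`. -/
theorem Reaches.not_dvd {e z : ℕ} (hr : P.Reaches e z) (he : e < P.o k) (hd : P.IsDart e) :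
    ¬ (M : ℤ) ∣ P.pos z - P.pos e := by
  rcases P.cases (P.α_lt e he) with hα | ⟨j, hj, s, hs, hα⟩ | ⟨j, hj, s, hs, hα⟩
  · exact hr.not_dvd_of_out he hd (Or.inl hα)
  · exact hr.not_dvd_of_out he hd (Or.inr ⟨j, hj, s, hs, hα⟩)
  · have h1 : ∃ i < k, ∃ s < P.h i, P.α z = P.o i + s := by
      cases id hr with
      | dart hdα => exact absurd hdα (P.not_isDart_ret hj hs hα)
      | tail hdα hr' => exact hr'.α_out_of_out hj hs (P.β_ret hj hs hα)
    have h2 := (hr.symm he hd).not_dvd_of_out (hr.lt he) hr.isDart (Or.inr h1)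
    rwa [← dvd_neg, neg_sub] at h2

end TreePolygon

namespace TreePolygon

variable {G : Type*} [Group G] {x W : ℤ → G} {w a : G} {M k : ℕ} (P : TreePolygon x W w a M k)

/-- The vertices of the surface obtained from the tree by gluing the two copies of each tail;
only the vertices in `good` carry the potential `τ`. -/
structure Gluing where
  r : ℕ → ℕ
  good : Finset ℕ
  τ : ℕ → G
  card_good : k * M + 2 ≤ 2 * good.card + 2 * k
  exists_start : ∀ c ∈ good, ∃ y < P.o k, r (P.nd y) = c
  joint : ∀ j ≤ k, r (P.nd (P.o j)) ∉ good
  glue : ∀ j < k, ∀ s < P.h j, ∀ y, y + 1 + s = P.o (j + 1) →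
    r (P.nd (P.o j + s + 1)) = r (P.nd y) ∧
      (r (P.nd (P.o j + s + 1)) ∈ good →
        τ (P.nd y) = τ (P.nd (P.o j + s + 1)) * (P.p (j + 1) * (P.p j)⁻¹)⁻¹)

theorem exists_gluing (hk : 0 < k) : Nonempty P.Gluing := by
  classical
  let l : ℕ → List (ℕ × ℕ × G) := fun n ↦ (List.range n).flatMap fun j ↦
    (List.range (P.h j)).map fun s ↦
      (P.nd (P.o j + s + 1), P.nd (P.o (j + 1) - 1 - s), (P.p (j + 1) * (P.p j)⁻¹)⁻¹)
  have hl : ∀ n, 2 * (l n).length + n * M = P.o n := by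
    intro n
    induction n with
    | zero => simp [l, P.o_zero]
    | succ n ih =>
      have : l (n + 1) = l n ++ (List.range (P.h n)).map fun s ↦
          (P.nd (P.o n + s + 1), P.nd (P.o (n + 1) - 1 - s), (P.p (n + 1) * (P.p n)⁻¹)⁻¹) := by
        simp [l, List.range_succ]
      rw [this, List.length_append, List.length_map, List.length_range, P.o_succ, ← ih]
      ring
  let joints := (Finset.range k).image fun j ↦ P.nd (P.o j)
  obtain ⟨r, good, τ, hcard, hfix, hgood, hglue⟩ :=
    _root_.exists_gluing (G := G) (Finset.range (P.o k / 2 + 1) \ joints) (l k)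
  have hjoint : ∀ j ≤ k, P.nd (P.o j) ∈ joints := by
    intro j hj
    rcases hj.lt_or_eq with hj | rfl
    · exact Finset.mem_image.2 ⟨j, Finset.mem_range.2 hj, rfl⟩
    · exact Finset.mem_image.2 ⟨0, Finset.mem_range.2 hk, by rw [P.o_zero, P.nd_closed]⟩
  refine ⟨⟨r, good, τ, ?_, ?_, ?_, ?_⟩⟩
  · have h1 := hl k
    have h2 := Finset.le_card_sdiff joints (Finset.range (P.o k / 2 + 1))
    have h3 : joints.card ≤ k := Finset.card_image_le.trans (Finset.card_range k).le
    rw [Finset.card_range] at h2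
    have h4 : 2 ∣ k * M := P.M_even.mul_left k
    omega
  · intro c hc
    have h1 := hgood c (by rwa [hfix c hc])
    obtain ⟨h2, h3⟩ := Finset.mem_sdiff.1 h1
    rw [Finset.mem_range] at h2
    obtain ⟨y, hy, rfl⟩ := P.nd_surj c (by omega)
    refine ⟨y, lt_of_le_of_ne hy ?_, hfix _ hc⟩
    rintro rfl
    exact h3 (hjoint k le_rfl)
  · intro j hj hc
    exact (Finset.mem_sdiff.1 (hgood _ hc)).2 (hjoint j hj)
  · intro j hj s hs y hy
    have hy' : y = P.o (j + 1) - 1 - s := by omega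
    subst hy'
    exact hglue _ (List.mem_flatMap.2 ⟨j, List.mem_range.2 hj,
      List.mem_map.2 ⟨s, List.mem_range.2 hs, rfl⟩⟩)

/-- The letter read at the corner following a line edge. -/
def letter (y : ℕ) : G := (W (P.pos y))⁻¹ * W (P.pos y + P.ε (P.side y))

/-- The next edge on the same face. -/
def next (y : ℕ) : ℕ :=
  if y + 1 < P.o (P.side y) + P.h (P.side y) + M then y + 1 else P.o (P.side y) + P.h (P.side y)

theorem next_spec {y : ℕ} (hy : y < P.o k) (hd : P.IsDart y) :
    P.next y < P.o k ∧ P.IsDart (P.next y) ∧ P.side (P.next y) = P.side y ∧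
      (y + P.next y) % 2 = 1 := by
  have hM := P.M_pos
  have hM' := P.M_even
  have hk := P.side_lt hy
  have h1 : P.o (P.side y) + P.h (P.side y) ≤ P.next y ∧
      P.next y < P.o (P.side y) + P.h (P.side y) + M := by
    have h1 := hd.1
    rw [next]; split_ifs <;> omega
  have h2 := P.isDart_of hk h1.1 h1.2
  have h3 := P.o_le hk
  have h4 := P.o_succ (P.side y)
  refine ⟨by omega, h2.1, h2.2, ?_⟩
  have h5 := hd.1
  have h6 := hd.2
  rw [next]; split_ifs <;> omega

theorem pos_next {y : ℕ} (hd : P.IsDart y) (hn : P.side (P.next y) = P.side y) :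
    P.pos (P.next y) = P.pos y + P.ε (P.side y) -
      if y + 1 < P.o (P.side y) + P.h (P.side y) + M then 0 else P.ε (P.side y) * M := by
  have h1 := hd.1
  have h2 := hd.2
  rw [pos, pos, hn, next]
  split_ifs with h
  · push_cast; ring
  · have : (y : ℤ) = P.o (P.side y) + P.h (P.side y) + M - 1 := by omega
    rw [this]; push_cast; ring

theorem letter_eq {y : ℕ} : (P.ε (P.side y) = 1 → P.letter y = x (P.pos y + 1)) ∧
    (P.ε (P.side y) = -1 → P.letter y = (x (P.pos y))⁻¹) := by
  constructor
  · intro h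
    rw [letter, h, P.W_succ]; group
  · intro h
    have := P.W_succ (P.pos y - 1)
    rw [sub_add_cancel] at this
    rw [letter, h, this, ← sub_eq_add_neg]; group

theorem cornerPath_letter {R : ℤ → ℤ → Prop} {v y : ℕ} (hy : y < P.o k)
    (hv : (y + v) % 2 = 0) :
    CornerPath x R v (P.pos y) (P.pos y + P.ε (P.side y)) (P.letter y) ∧
      CornerPath x R v (P.pos y + P.ε (P.side y)) (P.pos y) (P.letter y)⁻¹ := by
  have h1 := P.parity_of_isDart hy
  rcases P.ε_eq (P.side y) with h | h
  · rw [(P.letter_eq).1 h, h]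
    rw [h] at h1
    have h2 := CornerPath.fwd (x := x) (R := R) (v := v) (P.pos y + 1) (by omega)
    have h3 := CornerPath.bwd (x := x) (R := R) (v := v) (P.pos y + 1) (by omega)
    rw [add_sub_cancel_right] at h2 h3
    exact ⟨h2, h3⟩
  · rw [(P.letter_eq).2 h, h, inv_inv, ← sub_eq_add_neg]
    rw [h] at h1
    exact ⟨.bwd _ (by omega), .fwd _ (by omega)⟩

namespace Gluing

variable {P} (Q : P.Gluing)

/-- The vertex at the start of an edge. -/
def start (y : ℕ) : ℕ := Q.r (P.nd y)

/-- The vertex at the end of an edge. -/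
def finish (y : ℕ) : ℕ := Q.r (P.nd (y + 1))

/-- The edge label seen from its start. -/
def label (y : ℕ) : G := Q.τ (P.nd y) * P.E y

/-- The edge label seen from its end. -/
def label' (y : ℕ) : G := Q.τ (P.nd (y + 1)) * P.E y

theorem finish_α {y : ℕ} (hy : y < P.o k) :
    Q.finish (P.α y) = Q.start y ∧ Q.label' (P.α y) = Q.label y := by
  rw [finish, start, label', label, ← P.nd_start y hy, P.E_α y hy]
  exact ⟨rfl, rfl⟩

theorem start_β {y : ℕ} (hy : y < P.o k) (hd : ¬ P.IsDart y) (hg : Q.finish y ∈ Q.good) :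
    Q.start (P.β y) = Q.finish y ∧ Q.label (P.β y) = Q.label' y := by
  rcases P.cases hy with hd' | ⟨j, hj, s, hs, rfl⟩ | ⟨j, hj, s, hs, hy'⟩
  · exact absurd hd' hd
  · obtain ⟨z, hz⟩ : ∃ z, z + 1 + s = P.o (j + 1) :=
      ⟨P.o (j + 1) - 1 - s, by rw [P.o_succ]; omega⟩
    rw [P.β_out hj hs hz]
    obtain ⟨h1, h2⟩ := Q.glue j hj s hs z hz
    refine ⟨h1.symm, ?_⟩
    rw [label, label', h2 hg, P.E_ret j hj s hs z hz]; group
  · rw [P.β_ret hj hs hy']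
    rcases s with _ | s
    · refine absurd hg ?_
      have := Q.joint (j + 1) hj
      rwa [← hy'] at this
    · obtain ⟨h1, h2⟩ := Q.glue j hj s (by omega) (y + 1) (by omega)
      refine ⟨h1, ?_⟩
      rw [label, label', h2 (by rw [h1]; exact hg), P.E_ret j hj _ hs y hy',
        show P.o j + s + 1 = P.o j + (s + 1) by omega]
      group

theorem _root_.TreePolygon.Reaches.finish_eq {y z : ℕ} (hr : P.Reaches y z) (hy : y < P.o k)
    (hg : Q.start y ∈ Q.good) : Q.finish z = Q.start y ∧ Q.label' z = Q.label y := by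
  induction hr with
  | dart _ => exact Q.finish_α hy
  | @tail y z hd _ ih =>
    obtain ⟨h1, h2⟩ := Q.finish_α hy
    have hlt := P.α_lt y hy
    obtain ⟨h3, h4⟩ := Q.start_β hlt hd (by rwa [h1])
    obtain ⟨h5, h6⟩ := ih (P.β_spec hlt hd).1 (by rwa [h3, h1])
    exact ⟨by rw [h5, h3, h1], by rw [h6, h4, h2]⟩

theorem start_next {y : ℕ} (hy : y < P.o k) (hd : P.IsDart y) (hg : Q.finish y ∈ Q.good) :
    Q.start (P.next y) = Q.finish y ∧ Q.label (P.next y) = Q.label' y * P.letter y := by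
  obtain ⟨h1, h2, h3, -⟩ := P.next_spec hy hd
  have h4 := P.pos_next hd h3
  have h5 := P.E_of_isDart h1 h2
  rw [h3, h4] at h5
  have hj := P.side_lt hy
  have ho := P.o_succ (P.side y)
  have hd1 := hd.1
  have hd2 := hd.2
  rw [start, finish, label, label', h5, P.E_of_isDart hy hd, letter, next]
  split_ifs with h
  · exact ⟨rfl, by rw [sub_zero]; group⟩
  · by_cases h0 : P.h (P.side y) = 0
    · refine absurd hg ?_
      have := Q.joint (P.side y + 1) hj
      rwa [show P.o (P.side y + 1) = y + 1 by omega] at this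
    · obtain ⟨h6, h7⟩ := Q.glue (P.side y) hj (P.h (P.side y) - 1) (by omega) (y + 1) (by omega)
      rw [show P.o (P.side y) + (P.h (P.side y) - 1) + 1 = P.o (P.side y) + P.h (P.side y)
        by omega] at h6 h7
      refine ⟨h6, ?_⟩
      rw [h7 (by rw [h6]; exact hg), P.E_dart_side hy]
      have hW : W (P.pos y + P.ε (P.side y)) =
          w ^ P.ε (P.side y) * W (P.pos y + P.ε (P.side y) - P.ε (P.side y) * M) := by
        rcases P.ε_eq (P.side y) with h | h <;> rw [h]
        · have := P.W_add (P.pos y + 1 - 1 * M)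
          rw [one_mul, sub_add_cancel] at this
          rw [one_mul, zpow_one, this]
        · rw [show P.pos y + -1 - -1 * (M : ℤ) = P.pos y + -1 + M by ring, P.W_add]; group
      rw [hW]; group

theorem exists_dart {c : ℕ} (hc : c ∈ Q.good) :
    ∃ y < P.o k, P.IsDart y ∧ Q.start y = c := by
  have hret : ∀ j < k, ∀ s < P.h j, ∀ y, y + 1 + s = P.o (j + 1) → Q.start y = c →
      ∃ y < P.o k, P.IsDart y ∧ Q.start y = c := by
    intro j hj s hs y hy h1
    have hylt : y < P.o k := by have := P.o_le hj; omega
    obtain ⟨z, hz⟩ := P.exists_reaches_ret hj hs hy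
    obtain ⟨h2, -⟩ := hz.finish_eq Q hylt (by rwa [h1])
    have hzlt := hz.lt hylt
    obtain ⟨h3, h4, -⟩ := P.next_spec hzlt hz.isDart
    exact ⟨_, h3, h4, by rw [(Q.start_next hzlt hz.isDart (by rwa [h2, h1])).1, h2, h1]⟩
  obtain ⟨y, hy, h1⟩ := Q.exists_start c hc
  rcases P.cases hy with hd | ⟨j, hj, s, hs, rfl⟩ | ⟨j, hj, s, hs, hy'⟩
  · exact ⟨y, hy, hd, h1⟩
  · rcases s with _ | s
    · exact absurd (h1 ▸ hc) (Q.joint j hj.le)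
    · obtain ⟨z, hz⟩ : ∃ z, z + 1 + s = P.o (j + 1) :=
        ⟨P.o (j + 1) - 1 - s, by rw [P.o_succ]; omega⟩
      have h2 := (Q.glue j hj s (by omega) z hz).1
      exact hret j hj s (by omega) z hz (by rw [start, ← h2]; exact h1)
  · exact hret j hj s hs y hy' h1

end Gluing

end TreePolygon

namespace TreePolygon

variable {G : Type*} [Group G] {x W : ℤ → G} {w a : G} {M k : ℕ} {P : TreePolygon x W w a M k}

/-- The partner of a line edge. -/
noncomputable def partner (P : TreePolygon x W w a M k) (y : ℕ) : ℕ :=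
  open Classical in if h : ∃ z, P.Reaches y z then h.choose else y

theorem reaches_partner {y : ℕ} (hy : y < P.o k) (hd : P.IsDart y) :
    P.Reaches y (P.partner y) := by
  have h := exists_reaches hy hd
  rw [partner, dif_pos h]
  exact h.choose_spec

theorem partner_partner {y : ℕ} (hy : y < P.o k) (hd : P.IsDart y) :
    P.partner (P.partner y) = y := by
  have h1 := reaches_partner hy hd
  exact (reaches_partner (h1.lt hy) h1.isDart).unique (h1.symm hy hd)

/-- The next line edge around a vertex. -/
noncomputable def turn (P : TreePolygon x W w a M k) (y : ℕ) : ℕ := P.next (P.partner y)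

theorem turn_spec {y : ℕ} (hy : y < P.o k) (hd : P.IsDart y) :
    P.turn y < P.o k ∧ P.IsDart (P.turn y) ∧ (y + P.turn y) % 2 = 0 := by
  have h1 := reaches_partner hy hd
  have h2 := P.next_spec (h1.lt hy) h1.isDart
  have h3 := h1.odd hy
  rw [turn]
  exact ⟨h2.1, h2.2.1, by omega⟩

theorem iterate_turn_spec {y : ℕ} (hy : y < P.o k) (hd : P.IsDart y) (n : ℕ) :
    P.turn^[n] y < P.o k ∧ P.IsDart (P.turn^[n] y) ∧ (y + P.turn^[n] y) % 2 = 0 := by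
  induction n with
  | zero => exact ⟨hy, hd, by rw [Function.iterate_zero_apply]; omega⟩
  | succ n ih =>
    rw [Function.iterate_succ_apply']
    have := turn_spec ih.1 ih.2.1
    exact ⟨this.1, this.2.1, by omega⟩

theorem Gluing.start_turn (Q : P.Gluing) {y : ℕ} (hy : y < P.o k) (hd : P.IsDart y)
    (hg : Q.start y ∈ Q.good) :
    Q.start (P.turn y) = Q.start y ∧
      Q.label (P.turn y) = Q.label y * P.letter (P.partner y) := by
  have h1 := reaches_partner hy hd
  obtain ⟨h2, h3⟩ := h1.finish_eq Q hy hg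
  obtain ⟨h4, h5⟩ := Q.start_next (h1.lt hy) h1.isDart (by rwa [h2])
  rw [turn]
  exact ⟨by rw [h4, h2], by rw [h5, h3]⟩

theorem Gluing.start_iterate_turn (Q : P.Gluing) {y : ℕ} (hy : y < P.o k) (hd : P.IsDart y)
    (hg : Q.start y ∈ Q.good) (n : ℕ) : Q.start (P.turn^[n] y) = Q.start y := by
  induction n with
  | zero => rfl
  | succ n ih =>
    rw [Function.iterate_succ_apply']
    have := iterate_turn_spec hy hd n
    rw [(Q.start_turn this.1 this.2.1 (by rwa [ih])).1, ih]

section Order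

variable {e : ℕ} {f : ℤ → Fin e}

/-- The corners around a vertex, read from `y`, give a corner path in both directions, provided all
comparisons around the vertex go the same way. -/
theorem Gluing.exists_cornerPath (Q : P.Gluing) (hper : Function.Periodic f (M : ℤ)) {y : ℕ}
    (hy : y < P.o k) (hd : P.IsDart y) (hg : Q.start y ∈ Q.good) (n : ℕ) :
    ∃ i g, f i = f (P.pos (P.turn^[n + 1] y)) ∧
      Q.label (P.turn^[n + 1] y) = Q.label y * g ∧
      ((∀ m, f (P.pos (P.partner (P.turn^[m] y))) ≤ f (P.pos (P.turn^[m] y))) →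
        CornerPath x (fun j i ↦ f i ≤ f j) (y + 1) (P.pos (P.partner y)) i g) ∧
      ((∀ m, f (P.pos (P.turn^[m] y)) ≤ f (P.pos (P.partner (P.turn^[m] y)))) →
        CornerPath x (fun j i ↦ f i ≤ f j) (y + 1) i (P.pos (P.partner y)) g⁻¹) := by
  have key : ∀ n, f (P.pos (P.partner (P.turn^[n] y)) + P.ε (P.side (P.partner (P.turn^[n] y)))) =
      f (P.pos (P.turn^[n + 1] y)) ∧
      Q.label (P.turn^[n + 1] y) = Q.label (P.turn^[n] y) *
        P.letter (P.partner (P.turn^[n] y)) ∧ ∀ R : ℤ → ℤ → Prop,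
      CornerPath x R (y + 1) (P.pos (P.partner (P.turn^[n] y)))
        (P.pos (P.partner (P.turn^[n] y)) + P.ε (P.side (P.partner (P.turn^[n] y))))
        (P.letter (P.partner (P.turn^[n] y))) ∧
      CornerPath x R (y + 1)
        (P.pos (P.partner (P.turn^[n] y)) + P.ε (P.side (P.partner (P.turn^[n] y))))
        (P.pos (P.partner (P.turn^[n] y))) (P.letter (P.partner (P.turn^[n] y)))⁻¹ := by
    intro n
    obtain ⟨h1, h2, h3⟩ := iterate_turn_spec hy hd n
    have h4 := reaches_partner h1 h2
    have h5 := h4.odd h1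
    have h6 := P.next_spec (h4.lt h1) h4.isDart
    rw [Function.iterate_succ_apply']
    refine ⟨?_, (Q.start_turn h1 h2 (by rwa [Q.start_iterate_turn hy hd hg])).2, fun R ↦ ?_⟩
    · rw [turn, P.pos_next h4.isDart h6.2.2.1]
      split_ifs
      · rw [sub_zero]
      · rcases P.ε_eq (P.side (P.partner (P.turn^[n] y))) with h | h <;> rw [h]
        · rw [one_mul, hper.sub_eq]
        · rw [neg_one_mul, sub_neg_eq_add, hper]
    · have := P.cornerPath_letter (R := R) (v := y + 1) (h4.lt h1) (by omega)
      push_cast at this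
      exact this
  induction n with
  | zero =>
    obtain ⟨h1, h2, h3⟩ := key 0
    exact ⟨_, _, h1, h2, fun _ ↦ (h3 _).1, fun _ ↦ (h3 _).2⟩
  | succ n ih =>
    obtain ⟨i, g, h1, h2, h3, h4⟩ := ih
    obtain ⟨h5, h6, h7⟩ := key (n + 1)
    refine ⟨_, g * P.letter (P.partner (P.turn^[n + 1] y)), h5, by rw [h6, h2, mul_assoc],
      fun h ↦ (h3 h).append ?_ (h7 _).1, fun h ↦ ?_⟩
    · rw [h1]; exact h (n + 1)
    · rw [mul_inv_rev]
      refine (h7 _).2.append ?_ (h4 h)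
      rw [h1]; exact h (n + 1)

/-- The edge `y` lies above its partner in the order `f`. -/
def Above (P : TreePolygon x W w a M k) (f : ℤ → Fin e) (y : ℕ) : Prop :=
  f (P.pos (P.partner y)) < f (P.pos y)

theorem above_partner (hinj : ∀ q q', f q = f q' → (M : ℤ) ∣ q' - q) {y : ℕ} (hy : y < P.o k)
    (hd : P.IsDart y) : P.Above f (P.partner y) ↔ ¬ P.Above f y := by
  have h1 := (reaches_partner hy hd).not_dvd hy hd
  rw [Above, Above, partner_partner hy hd, not_lt]
  refine ⟨le_of_lt, fun h ↦ lt_of_le_of_ne h fun h' ↦ h1 (hinj _ _ h')⟩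

theorem Gluing.exists_iterate (Q : P.Gluing) (hper : Function.Periodic f (M : ℤ))
    (hf : Admissible x f) (hinj : ∀ q q', f q = f q' → (M : ℤ) ∣ q' - q) {y : ℕ}
    (hy : y < P.o k) (hd : P.IsDart y) (hg : Q.start y ∈ Q.good) :
    (∃ n, P.Above f (P.turn^[n] y)) ∧ ∃ n, ¬ P.Above f (P.turn^[n] y) := by
  obtain ⟨n₁, n₂, hne, heq⟩ := Finite.exists_ne_map_eq_of_infinite
    fun n : ℕ ↦ (⟨P.turn^[n] y, (iterate_turn_spec hy hd n).1⟩ : Fin (P.o k))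
  replace heq : P.turn^[n₁] y = P.turn^[n₂] y := congrArg Fin.val heq
  wlog hlt : n₁ < n₂ generalizing n₁ n₂
  · exact this n₂ n₁ hne.symm heq.symm (by omega)
  obtain ⟨n, rfl⟩ : ∃ n, n₂ = n + 1 + n₁ := ⟨n₂ - n₁ - 1, by omega⟩
  rw [Function.iterate_add_apply] at heq
  obtain ⟨hz, hdz, -⟩ := iterate_turn_spec hy hd n₁
  have hgz : Q.start (P.turn^[n₁] y) ∈ Q.good := by rwa [Q.start_iterate_turn hy hd hg]
  obtain ⟨i, g, h1, h2, h3, h4⟩ := Q.exists_cornerPath hper hz hdz hgz n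
  rw [← heq] at h1 h2
  have hg1 : g = 1 := mul_eq_left.1 h2.symm
  subst hg1
  rw [inv_one] at h4
  simp only [← Function.iterate_add_apply] at h3 h4
  by_contra hc
  have hiff := above_partner hinj hz hdz
  rw [not_and_or, not_exists, not_exists] at hc
  simp only [not_not] at hc
  rcases hc with hc | hc
  · have h5 := hf _ _ _ (h4 fun m ↦ not_lt.1 (hc _))
    have h6 := hiff.2 (hc n₁)
    rw [Above, partner_partner hz hdz] at h6
    rw [h1] at h5
    exact absurd h6 (not_lt.2 h5)
  · have h5 := hf _ _ _ (h3 fun m ↦ (hc _).le)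
    rw [h1] at h5
    exact absurd (hc n₁) (not_lt.2 h5)

theorem exists_change {p : ℕ → Prop} {m n : ℕ} (hmn : m ≤ n) (hm : p m) (hn : ¬ p n) :
    ∃ i, p i ∧ ¬ p (i + 1) := by
  by_contra hc
  push Not at hc
  exact hn (Nat.le_induction hm (fun i _ ↦ hc i) n hmn)

theorem Gluing.exists_corners (Q : P.Gluing) (hper : Function.Periodic f (M : ℤ))
    (hf : Admissible x f) (hinj : ∀ q q', f q = f q' → (M : ℤ) ∣ q' - q) {c : ℕ}
    (hc : c ∈ Q.good) :
    (∃ y < P.o k, P.IsDart y ∧ Q.finish y = c ∧ P.Above f y ∧ P.Above f (P.next y)) ∧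
      ∃ y < P.o k, P.IsDart y ∧ Q.finish y = c ∧ ¬ P.Above f y ∧ ¬ P.Above f (P.next y) := by
  obtain ⟨y, hy, hd, rfl⟩ := Q.exists_dart hc
  have hex : ∀ n m, (∃ i, P.Above f (P.turn^[i + n] y)) ∧ ∃ i, ¬ P.Above f (P.turn^[i + m] y) := by
    intro n m
    have h := fun n ↦ iterate_turn_spec hy hd n
    have h' := fun n ↦ Q.start_iterate_turn hy hd hc n
    simp only [Function.iterate_add_apply]
    exact ⟨(Q.exists_iterate hper hf hinj (h n).1 (h n).2.1 (by rwa [h'])).1,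
      (Q.exists_iterate hper hf hinj (h m).1 (h m).2.1 (by rwa [h'])).2⟩
  have hcor : ∀ n, P.partner (P.turn^[n] y) < P.o k ∧ P.IsDart (P.partner (P.turn^[n] y)) ∧
      Q.finish (P.partner (P.turn^[n] y)) = Q.start y ∧
      (P.Above f (P.partner (P.turn^[n] y)) ↔ ¬ P.Above f (P.turn^[n] y)) ∧
      (P.Above f (P.next (P.partner (P.turn^[n] y))) ↔ P.Above f (P.turn^[n + 1] y)) := by
    intro n
    obtain ⟨h1, h2, -⟩ := iterate_turn_spec hy hd n
    have h3 := reaches_partner h1 h2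
    have h4 := Q.start_iterate_turn hy hd hc n
    refine ⟨h3.lt h1, h3.isDart, ?_, above_partner hinj h1 h2, ?_⟩
    · rw [(h3.finish_eq Q h1 (by rwa [h4])).1, h4]
    · rw [Function.iterate_succ_apply', turn]
  constructor
  · obtain ⟨i, hi⟩ := (hex 0 0).2
    obtain ⟨i', hi'⟩ := (hex (i + 0) 0).1
    obtain ⟨n, h1, h2⟩ := exists_change (p := fun n ↦ ¬ P.Above f (P.turn^[n] y))
      (Nat.le_add_left _ _) hi (not_not.2 hi')
    obtain ⟨h3, h4, h5, h6, h7⟩ := hcor n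
    exact ⟨_, h3, h4, h5, h6.2 h1, h7.2 (not_not.1 h2)⟩
  · obtain ⟨i, hi⟩ := (hex 0 0).1
    obtain ⟨i', hi'⟩ := (hex 0 (i + 0)).2
    obtain ⟨n, h1, h2⟩ := exists_change (p := fun n ↦ P.Above f (P.turn^[n] y))
      (Nat.le_add_left _ _) hi hi'
    obtain ⟨h3, h4, h5, h6, h7⟩ := hcor n
    exact ⟨_, h3, h4, h5, fun h ↦ h6.1 h h1, fun h ↦ h2 (h7.1 h)⟩

theorem exists_pos_face (P : TreePolygon x W w a M k) {j : ℕ} (hj : j < k) (i : ℤ) :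
    ∃ u < M, P.IsDart (P.o j + P.h j + u) ∧ P.side (P.o j + P.h j + u) = j ∧
      (M : ℤ) ∣ P.pos (P.o j + P.h j + u) - i := by
  have hM := P.M_pos
  have hM' : (M : ℤ) ≠ 0 := by omega
  have h1 := Int.emod_nonneg (P.ε j * (i - P.q j)) hM'
  have h2 := Int.emod_lt_of_pos (P.ε j * (i - P.q j)) (by omega : (0 : ℤ) < M)
  obtain ⟨u, hu⟩ := Int.eq_ofNat_of_zero_le h1
  have h3 := P.isDart_of hj (Nat.le_add_right _ u) (by omega)
  refine ⟨u, by omega, h3.1, h3.2, ?_⟩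
  have h4 := Int.mul_ediv_add_emod (P.ε j * (i - P.q j)) M
  rw [hu] at h4
  rw [pos, h3.2]
  push_cast
  have h5 : (u : ℤ) = P.ε j * (i - P.q j) - M * (P.ε j * (i - P.q j) / M) := by linarith [h4]
  have h6 : P.ε j * P.ε j = 1 := by rcases P.ε_eq j with h | h <;> rw [h] <;> rfl
  refine ⟨-(P.ε j * (P.ε j * (i - P.q j) / M)), ?_⟩
  generalize P.ε j * (i - P.q j) / M = d at h5 ⊢
  rw [add_sub_cancel_left, h5]
  linear_combination (i - P.q j) * h6

theorem exists_mem_face_change (P : TreePolygon x W w a M k) {p : ℕ → Prop} {j u v : ℕ}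
    (hj : j < k) (hu : u < M) (hv : v < M) (h1 : p (P.o j + P.h j + u))
    (h2 : ¬ p (P.o j + P.h j + v)) :
    ∃ y < P.o k, P.IsDart y ∧ P.side y = j ∧ p y ∧ ¬ p (P.next y) := by
  have hM := P.M_pos
  obtain ⟨n, h3, h4⟩ := exists_change (p := fun n ↦ p (P.o j + P.h j + n % M))
    (show u ≤ v + M by omega) (by rwa [Nat.mod_eq_of_lt hu])
    (by rwa [Nat.add_mod_right, Nat.mod_eq_of_lt hv])
  have h5 := Nat.mod_lt n hM
  obtain ⟨h6, h7⟩ := P.isDart_of hj (Nat.le_add_right _ (n % M)) (by omega)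
  have h8 := P.o_le hj
  have h9 := P.o_succ j
  refine ⟨_, by omega, h6, h7, h3, ?_⟩
  convert h4 using 2
  rw [next, h7, ← Nat.mod_add_mod n M 1]
  split_ifs with h
  · rw [Nat.mod_eq_of_lt (a := n % M + 1) (by omega), add_assoc]
  · rw [show n % M + 1 = M by omega, Nat.mod_self, add_zero]

theorem exists_face_corners (P : TreePolygon x W w a M k) (hper : Function.Periodic f (M : ℤ))
    (hinj : ∀ q q', f q = f q' → (M : ℤ) ∣ q' - q) {j : ℕ} (hj : j < k) :
    (∃ y < P.o k, P.IsDart y ∧ P.side y = j ∧ P.Above f y ∧ ¬ P.Above f (P.next y)) ∧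
      ∃ y < P.o k, P.IsDart y ∧ P.side y = j ∧ ¬ P.Above f y ∧ P.Above f (P.next y) := by
  have hlt : ∀ u < M, P.o j + P.h j + u < P.o k := fun u hu ↦ by
    have := P.o_le hj
    have := P.o_succ j
    omega
  have hpos : ∀ i y, (M : ℤ) ∣ P.pos y - i → f (P.pos y) = f i := by
    rintro i y ⟨c, hc⟩
    rw [sub_eq_iff_eq_add.1 hc, mul_comm, add_comm,
      (by simpa using hper.int_mul c i : f (i + c * M) = f i)]
  obtain ⟨i, hi⟩ : ∃ i, ∀ i', f i' ≤ f i := by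
    obtain ⟨_, ⟨i, rfl⟩, h⟩ := (Set.toFinite (Set.range f)).exists_maximalFor id _
      (Set.range_nonempty f)
    exact ⟨i, fun i' ↦ (le_total (f i') (f i)).elim id (h ⟨i', rfl⟩)⟩
  obtain ⟨i', hi'⟩ : ∃ i, ∀ i', f i ≤ f i' := by
    obtain ⟨_, ⟨i, rfl⟩, h⟩ := (Set.toFinite (Set.range f)).exists_minimalFor id _
      (Set.range_nonempty f)
    exact ⟨i, fun i' ↦ (le_total (f i) (f i')).elim id (h ⟨i', rfl⟩)⟩
  obtain ⟨u, hu, hd, -, h1⟩ := P.exists_pos_face hj i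
  obtain ⟨u', hu', hd', -, h1'⟩ := P.exists_pos_face hj i'
  have h2 : P.Above f (P.o j + P.h j + u) :=
    lt_of_le_of_ne (by rw [hpos _ _ h1]; exact hi _) fun h ↦
      (reaches_partner (hlt u hu) hd).not_dvd (hlt u hu) hd (hinj _ _ h.symm)
  have h3 : ¬ P.Above f (P.o j + P.h j + u') := by
    rw [Above, not_lt, hpos _ _ h1']; exact hi' _
  refine ⟨exists_mem_face_change P hj hu hu' h2 h3, ?_⟩
  obtain ⟨y, h4, h5, h6, h7, h8⟩ :=
    exists_mem_face_change P (p := fun y ↦ ¬ P.Above f y) hj hu' hu h3 (not_not.2 h2)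
  exact ⟨y, h4, h5, h6, h7, not_not.1 h8⟩

theorem false_of_admissible (P : TreePolygon x W w a M k) (hk : 0 < k)
    (hper : Function.Periodic f (M : ℤ)) (hf : Admissible x f)
    (hinj : ∀ q q', f q = f q' → (M : ℤ) ∣ q' - q) : False := by
  classical
  obtain ⟨Q⟩ := P.exists_gluing hk
  let D := (Finset.range (P.o k)).filter P.IsDart
  have hD : ∀ {y}, y ∈ D ↔ y < P.o k ∧ P.IsDart y := by simp [D]
  have hDcard : D.card ≤ k * M := by
    have : D ⊆ (Finset.range k ×ˢ Finset.range M).image fun c ↦ P.o c.1 + P.h c.1 + c.2 := by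
      intro y hy
      obtain ⟨h1, h2, h3⟩ := hD.1 hy
      exact Finset.mem_image.2 ⟨(P.side y, y - (P.o (P.side y) + P.h (P.side y))),
        Finset.mem_product.2 ⟨Finset.mem_range.2 (P.side_lt h1), Finset.mem_range.2 (by omega)⟩,
        by simp only; omega⟩
    refine (Finset.card_le_card this).trans (Finset.card_image_le.trans ?_)
    rw [Finset.card_product, Finset.card_range, Finset.card_range]
  have h1 : Q.good.card ≤ ((D.filter (P.Above f)).filter fun y ↦ P.Above f (P.next y)).card :=
    Finset.card_le_card_of_surjOn Q.finish fun c hc ↦ by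
      obtain ⟨y, hy, hd, h, h', h''⟩ := (Q.exists_corners hper hf hinj hc).1
      exact ⟨y, by simp [D, *], h⟩
  have h2 : Q.good.card ≤
      ((D.filter fun y ↦ ¬ P.Above f y).filter fun y ↦ ¬ P.Above f (P.next y)).card :=
    Finset.card_le_card_of_surjOn Q.finish fun c hc ↦ by
      obtain ⟨y, hy, hd, h, h', h''⟩ := (Q.exists_corners hper hf hinj hc).2
      exact ⟨y, by simp [D, *], h⟩
  have h3 : (Finset.range k).card ≤
      ((D.filter (P.Above f)).filter fun y ↦ ¬ P.Above f (P.next y)).card :=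
    Finset.card_le_card_of_surjOn P.side fun j hj ↦ by
      obtain ⟨y, hy, hd, h, h', h''⟩ := (P.exists_face_corners hper hinj (by simpa using hj)).1
      exact ⟨y, by simp [D, *], h⟩
  have h4 : (Finset.range k).card ≤
      ((D.filter fun y ↦ ¬ P.Above f y).filter fun y ↦ P.Above f (P.next y)).card :=
    Finset.card_le_card_of_surjOn P.side fun j hj ↦ by
      obtain ⟨y, hy, hd, h, h', h''⟩ := (P.exists_face_corners hper hinj (by simpa using hj)).2
      exact ⟨y, by simp [D, *], h⟩
  have h5 := D.card_filter_add_card_filter_not (P.Above f)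
  have h6 := (D.filter (P.Above f)).card_filter_add_card_filter_not fun y ↦ P.Above f (P.next y)
  have h7 := (D.filter fun y ↦ ¬ P.Above f y).card_filter_add_card_filter_not
    fun y ↦ P.Above f (P.next y)
  have h8 := Q.card_good
  rw [Finset.card_range] at h3 h4
  omega

end Order

end TreePolygon

section Rays

variable {G : Type*} [Group G]

/-- A periodic line `W` in the tree of a free product with factors `S 0` and `S 1`: its edges are
labelled by `W q`, and the letter `x q` is read at the vertex between two consecutive edges.  The
map `φ` records the edges crossed by a path between two vertices. -/
structure PeriodicLine (S : ℤ → Subgroup G) (x W : ℤ → G) (w : G) (M : ℕ) : Prop where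
  M_pos : 0 < M
  M_even : 2 ∣ M
  S_add_two : ∀ v, S (v + 2) = S v
  sup_eq_top : S 0 ⊔ S 1 = ⊤
  x_mem : ∀ q, x q ∈ S q
  W_zero : W 0 = 1
  W_succ : ∀ q, W (q + 1) = W q * x (q + 1)
  W_add : ∀ q, W (q + M) = w * W q
  exists_cocycle : ∃ φ : G → FreeGroup G, φ 1 = 1 ∧ (∀ g, ∀ a ∈ S 1, φ (g * a) = φ g) ∧
    ∀ g, ∀ b ∈ S 0, φ (g * b) = φ g * .of g * (.of (g * b))⁻¹

variable {S : ℤ → Subgroup G} {x W : ℤ → G} {w : G} {M : ℕ}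

/-- The path `T` starts at `p` and follows a tail of length `h`, then the line `v * W`, whose
stabilizer is generated by `d`. -/
structure Ray (S : ℤ → Subgroup G) (W : ℤ → G) (w p d : G) (h : ℕ) (T : ℕ → G) (v : G)
    (q ε : ℤ) : Prop where
  zero : T 0 = p
  step : ∀ s : ℕ, (T s)⁻¹ * T (s + 1) ∈ S (s + 1)
  line : ∀ i : ℕ, T (h + 1 + i) = v * W (q + ε * i)
  eq_conj : d = v * w ^ ε * v⁻¹
  ε_eq : ε = 1 ∨ ε = -1
  parity : (4 : ℤ) ∣ 2 * h + 2 * q + ε + 1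

/-- There is a path which starts at `p` and follows a tail of length `h`, then a line with
stabilizer generated by `d`. -/
def HasRay (S : ℤ → Subgroup G) (W : ℤ → G) (w p d : G) (h : ℕ) : Prop :=
  ∃ T v q ε, Ray S W w p d h T v q ε

theorem HasRay.translate {p d : G} {h : ℕ} (hr : HasRay S W w p d h) (g : G) :
    HasRay S W w (g * p) (g * d * g⁻¹) h := by
  obtain ⟨T, v, q, ε, hr⟩ := hr
  refine ⟨fun s ↦ g * T s, g * v, q, ε, by rw [hr.zero], fun s ↦ ?_, fun i ↦ ?_, ?_, hr.ε_eq,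
    hr.parity⟩
  · have := hr.step s
    convert this using 1
    group
  · rw [hr.line, mul_assoc]
  · rw [hr.eq_conj]; group

namespace PeriodicLine

theorem S_congr (hL : PeriodicLine S x W w M) {u v : ℤ} (h : 2 ∣ v - u) : S v = S u := by
  obtain ⟨n, hn⟩ := h
  have hper : Function.Periodic S 2 := hL.S_add_two
  rw [show v = u + n * 2 by omega]
  simpa using hper.int_mul n u

theorem step_mem (hL : PeriodicLine S x W w M) {n q ε : ℤ} (hε : ε = 1 ∨ ε = -1)
    (h : (4 : ℤ) ∣ 2 * n + 2 * q + ε + 1) :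
    (W q)⁻¹ * W (q + ε) ∈ S n := by
  rcases hε with rfl | rfl
  · rw [hL.W_succ, inv_mul_cancel_left, hL.S_congr (u := q + 1) (by omega)]
    exact hL.x_mem _
  · have := hL.W_succ (q - 1)
    rw [sub_add_cancel] at this
    rw [this, ← sub_eq_add_neg, hL.S_congr (u := q) (by omega), mul_inv_rev, inv_mul_cancel_right]
    exact inv_mem (hL.x_mem q)

theorem hasRay_of_path (hL : PeriodicLine S x W w M) {T : ℕ → G} {n : ℕ}
    (hT : ∀ s : ℕ, s < n → (T s)⁻¹ * T (s + 1) ∈ S (s + 1))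
    {v : G} {q ε : ℤ} (hε : ε = 1 ∨ ε = -1) (h : (4 : ℤ) ∣ 2 * n + 2 * q + ε + 1)
    (hn : (T n)⁻¹ * (v * W q) ∈ S (n + 1)) : HasRay S W w (T 0) (v * w ^ ε * v⁻¹) n := by
  refine ⟨fun s ↦ if s ≤ n then T s else v * W (q + ε * (s - n - 1 : ℕ)), v, q, ε, by simp, ?_, ?_,
    rfl, hε, h⟩
  · intro s
    rcases lt_trichotomy s n with hs | rfl | hs
    · rw [if_pos hs.le, if_pos (by omega)]
      exact hT s hs
    · rw [if_pos le_rfl, if_neg (by omega)]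
      simpa using hn
    · rw [if_neg (by omega), if_neg (by omega)]
      obtain ⟨t, rfl⟩ : ∃ t, s = n + 1 + t := ⟨s - n - 1, by omega⟩
      rw [show n + 1 + t - n - 1 = t by omega, show n + 1 + t + 1 - n - 1 = t + 1 by omega]
      push_cast
      have := hL.step_mem (n := n + 1 + t + 1) (q := q + ε * t) hε
        (by rcases hε with rfl | rfl <;> omega)
      convert this using 1
      rw [mul_add, mul_one, ← add_assoc]; group
  · intro i
    rw [if_neg (by omega), show n + 1 + i - n - 1 = i by omega]

theorem hasRay_splice (hL : PeriodicLine S x W w M) {T T' : ℕ → G} {p d v : G} {n m h : ℕ} {q ε : ℤ}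
    (hT : ∀ s : ℕ, s < n → (T s)⁻¹ * T (s + 1) ∈ S (s + 1)) (hT' : Ray S W w p d h T' v q ε)
    (hm : m ≤ h) (hnm : n % 2 = m % 2) (hn : (T n)⁻¹ * T' (m + 1) ∈ S (n + 1)) :
    HasRay S W w (T 0) d (h - m + n) := by
  refine ⟨fun s ↦ if s ≤ n then T s else T' (s - n + m), v, q, ε, by simp, ?_, ?_, hT'.eq_conj,
    hT'.ε_eq, ?_⟩
  · intro s
    rcases lt_trichotomy s n with hs | rfl | hs
    · rw [if_pos hs.le, if_pos (by omega)]
      exact hT s hs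
    · rw [if_pos le_rfl, if_neg (by omega), show s + 1 - s + m = m + 1 by omega]
      exact hn
    · rw [if_neg (by omega), if_neg (by omega)]
      have := hT'.step (s - n + m)
      rw [show s + 1 - n + m = s - n + m + 1 by omega,
        hL.S_congr (u := ((s - n + m : ℕ) : ℤ) + 1) (by omega)]
      exact this
  · intro i
    rw [if_neg (by omega), show h - m + n + 1 + i - n + m = h + 1 + i by omega, hT'.line]
  · have := hT'.parity
    have h2 : (2 : ℤ) ∣ ((h - m + n : ℕ) : ℤ) - h := by omega
    omega

theorem hasRay_inv (hL : PeriodicLine S x W w M) {p d : G} {h : ℕ} (hr : HasRay S W w p d h) :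
    HasRay S W w p d⁻¹ h := by
  obtain ⟨T, v, q, ε, hr⟩ := hr
  have h1 : (4 : ℤ) ∣ 2 * h + 2 * (q - ε) + -ε + 1 := by
    have := hr.parity
    rcases hr.ε_eq with h | h <;> rw [h] at this ⊢ <;> omega
  have h2 : -ε = 1 ∨ -ε = -1 := by rcases hr.ε_eq with h | h <;> rw [h] <;> simp
  have h3 := hL.hasRay_of_path (T := T) (n := h) (fun s _ ↦ hr.step s) h2 h1 (v := v) ?_
  · rw [hr.zero] at h3
    convert h3 using 1
    rw [hr.eq_conj]; group
  · have h4 := mul_mem (hr.step h) (hL.step_mem (n := h + 1) (q := q) h2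
      (by rcases hr.ε_eq with h | h <;> rw [h] at h1 ⊢ <;> omega))
    convert h4 using 1
    have := hr.line 0
    rw [add_zero, Nat.cast_zero, mul_zero, add_zero] at this
    rw [this, ← sub_eq_add_neg]; group

theorem hasRay_prepend (hL : PeriodicLine S x W w M) {p p' d : G} {h : ℕ}
    (hr : HasRay S W w p d h) (hp : p'⁻¹ * p ∈ S 0 ∨ p'⁻¹ * p ∈ S 1) :
    HasRay S W w p' d (h + 2) := by
  obtain ⟨T, v, q, ε, hr⟩ := hr
  obtain ⟨e, he, he'⟩ : ∃ e, p'⁻¹ * e ∈ S 1 ∧ e⁻¹ * p ∈ S 0 := by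
    rcases hp with hp | hp
    · exact ⟨p', by simp, hp⟩
    · exact ⟨p, hp, by simp⟩
  refine ⟨fun s ↦ match s with
    | 0 => p'
    | 1 => e
    | s + 2 => T s, v, q, ε, rfl, fun s ↦ ?_, fun i ↦ ?_, hr.eq_conj, hr.ε_eq, ?_⟩
  · match s with
    | 0 => simpa using he
    | 1 =>
      rw [hL.S_congr (u := 0) (by norm_num)]
      simpa [hr.zero] using he'
    | s + 2 =>
      have := hr.step s
      rw [hL.S_congr (u := s + 1) (by push_cast; omega)]
      exact this
  · rw [show h + 2 + 1 + i = (h + 1 + i) + 2 by omega]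
    exact hr.line i
  · have := hr.parity
    push_cast; omega

theorem exists_hasRay (hL : PeriodicLine S x W w M) (p v : G) {ε : ℤ} (hε : ε = 1 ∨ ε = -1) :
    ∃ h, HasRay S W w p (v * w ^ ε * v⁻¹) h := by
  have key : ∀ u : G, (∀ p d, (∃ h, HasRay S W w p d h) → ∃ h, HasRay S W w (p * u) d h) ∧
      ∀ p d, (∃ h, HasRay S W w p d h) → ∃ h, HasRay S W w (p * u⁻¹) d h := by
    intro u
    have hu : u ∈ Subgroup.closure ((S 0 : Set G) ∪ S 1) := by
      rw [← Subgroup.sup_eq_closure, hL.sup_eq_top]; trivial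
    induction hu using Subgroup.closure_induction with
    | mem u hu =>
      constructor
      · rintro p d ⟨h, hr⟩
        refine ⟨_, hL.hasRay_prepend hr ?_⟩
        rw [mul_inv_rev, inv_mul_cancel_right]
        exact hu.imp inv_mem inv_mem
      · rintro p d ⟨h, hr⟩
        refine ⟨_, hL.hasRay_prepend hr ?_⟩
        rw [mul_inv_rev, inv_mul_cancel_right, inv_inv]
        exact hu
    | one => simp
    | mul u u' _ _ ih ih' =>
      refine ⟨fun p d h ↦ ?_, fun p d h ↦ ?_⟩
      · rw [← mul_assoc]; exact ih'.1 _ _ (ih.1 _ _ h)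
      · rw [mul_inv_rev, ← mul_assoc]; exact ih.2 _ _ (ih'.2 _ _ h)
    | inv u _ ih => exact ⟨ih.2, by simpa using ih.1⟩
  obtain ⟨n, hn⟩ : ∃ n : ℕ, (4 : ℤ) ∣ 2 * n + 2 * 0 + ε + 1 := by
    rcases hε with rfl | rfl
    · exact ⟨1, by norm_num⟩
    · exact ⟨0, by norm_num⟩
  have h := hL.hasRay_of_path (T := fun _ ↦ v) (n := n) (by simp) hε hn (v := v)
    (by simp [hL.W_zero])
  simpa using (key (v⁻¹ * p)).1 v _ ⟨n, h⟩

end PeriodicLine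

/-- There is a path from `p` to `p'` around `k` lines, with tails of total length `N`. -/
inductive RayPath (S : ℤ → Subgroup G) (W : ℤ → G) (w p : G) : ℕ → ℕ → G → Prop
  | refl : RayPath S W w p 0 0 p
  | snoc {k N h : ℕ} {p' d : G} : RayPath S W w p k N p' → HasRay S W w p' d h →
      RayPath S W w p (k + 1) (N + h) (d * p')

theorem RayPath.trans {p p' p'' : G} {k N k' N' : ℕ} (h : RayPath S W w p k N p')
    (h' : RayPath S W w p' k' N' p'') : RayPath S W w p (k + k') (N + N') p'' := by
  induction h' with
  | refl => exact h
  | snoc _ hr ih => rw [← add_assoc, ← add_assoc]; exact ih.snoc hr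

theorem RayPath.translate {p p' : G} {k N : ℕ} (h : RayPath S W w p k N p') (g : G) :
    RayPath S W w (g * p) k N (g * p') := by
  induction h with
  | refl => exact .refl
  | @snoc k N h p' d _ hr ih =>
    have := ih.snoc (hr.translate g)
    rwa [show g * d * g⁻¹ * (g * p') = g * (d * p') by group] at this

theorem RayPath.exists_seq {k N : ℕ} {p p' : G} (h : RayPath S W w p k N p') :
    ∃ (r : ℕ → G) (h : ℕ → ℕ), r 0 = p ∧ r k = p' ∧ ∑ j ∈ Finset.range k, h j = N ∧
      ∀ j < k, HasRay S W w (r j) (r (j + 1) * (r j)⁻¹) (h j) := by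
  induction h with
  | refl => exact ⟨fun _ ↦ p, 0, rfl, rfl, rfl, by simp⟩
  | @snoc k N h₀ p' d _ hr ih =>
    obtain ⟨r, h, h1, h2, h3, h4⟩ := ih
    refine ⟨fun j ↦ if j ≤ k then r j else d * p', fun j ↦ if j < k then h j else h₀, by simpa,
      by simp, ?_, fun j hj ↦ ?_⟩
    · rw [Finset.sum_range_succ, if_neg (lt_irrefl k), ← h3]
      congr 1
      exact Finset.sum_congr rfl fun j hj ↦ if_pos (Finset.mem_range.1 hj)
    · rcases Nat.lt_succ_iff_lt_or_eq.1 hj with hj | rfl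
      · simp only [if_pos hj.le, if_pos (show j + 1 ≤ k from hj), if_pos hj]
        exact h4 j hj
      · simp only [if_pos le_rfl, if_neg (lt_irrefl j), if_neg (show ¬ j + 1 ≤ j by omega)]
        rw [h2, mul_inv_cancel_right]
        exact hr

theorem RayPath.of_seq {r : ℕ → G} {h : ℕ → ℕ} {k : ℕ}
    (hr : ∀ j < k, HasRay S W w (r j) (r (j + 1) * (r j)⁻¹) (h j)) {i j : ℕ} (hij : i ≤ j)
    (hj : j ≤ k) : RayPath S W w (r i) (j - i) (∑ t ∈ Finset.Ico i j, h t) (r j) := by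
  induction j, hij using Nat.le_induction with
  | base => simpa using RayPath.refl
  | succ j hij ih =>
    have := (ih (by omega)).snoc (hr j hj)
    rw [inv_mul_cancel_right] at this
    rwa [Finset.sum_Ico_succ_top hij, Nat.succ_sub hij]

theorem PeriodicLine.exists_rayPath (hL : PeriodicLine S x W w M) {k : ℕ} {a : G}
    (h : ConjProd w k a) (p : G) : ∃ N, RayPath S W w p k N (p * a) := by
  induction h generalizing p with
  | one => exact ⟨0, by simpa using RayPath.refl⟩
  | @cons k c g hc _ ih =>
    have h1 : ∃ h, HasRay S W w p (p * c * p⁻¹) h := by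
      rcases hc with hc | hc <;> obtain ⟨v, rfl⟩ := isConj_iff.1 hc
      · convert hL.exists_hasRay p (p * v) (Or.inl rfl) using 3
        group
      · convert hL.exists_hasRay p (p * v) (Or.inr rfl) using 3
        group
    obtain ⟨h, hr⟩ := h1
    obtain ⟨N, hN⟩ := ih (p * c)
    have h2 := (RayPath.refl.snoc hr)
    rw [inv_mul_cancel_right] at h2
    refine ⟨0 + h + N, ?_⟩
    rw [add_comm k, ← mul_assoc, ← zero_add 1]
    exact h2.trans hN

/-- A sequence of lines with minimal total length of tails. -/
theorem PeriodicLine.exists_minimal_seq (hL : PeriodicLine S x W w M) {k : ℕ} {a : G}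
    (hk : ConjProd w k a) : ∃ (r : ℕ → G) (h : ℕ → ℕ), r 0 = 1 ∧ r k = a ∧
      (∀ j < k, HasRay S W w (r j) (r (j + 1) * (r j)⁻¹) (h j)) ∧
      ∀ j < k, ∀ b ≤ k, ∀ n, HasRay S W w (r b) (r (j + 1) * (r j)⁻¹) n → h j ≤ n := by
  classical
  have hex : ∃ N, RayPath S W w 1 k N a := by simpa using hL.exists_rayPath hk 1
  obtain ⟨r, h, h1, h2, h3, h4⟩ := (Nat.find_spec hex).exists_seq
  refine ⟨r, h, h1, h2, h4, fun j hj b hb n hn ↦ ?_⟩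
  have hseg := fun {i j : ℕ} (hij : i ≤ j) hj ↦ RayPath.of_seq (i := i) (j := j) h4 hij hj
  obtain ⟨N, hN, hsum⟩ : ∃ N, RayPath S W w (r 0) k N (r k) ∧ N + h j = Nat.find hex + n := by
    rw [← h3, Finset.range_eq_Ico]
    rcases le_or_gt b j with hbj | hbj
    · have := (((hseg (Nat.zero_le b) hb).snoc hn).trans
        ((hseg hbj hj.le).translate (r (j + 1) * (r j)⁻¹)))
      rw [inv_mul_cancel_right] at this
      have := this.trans (hseg (i := j + 1) hj le_rfl)
      refine ⟨_, by convert this using 1; omega, ?_⟩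
      rw [← Finset.sum_Ico_consecutive h (Nat.zero_le b) hb,
        ← Finset.sum_Ico_consecutive h hbj hj.le, ← Finset.sum_Ico_consecutive h j.le_succ hj,
        Nat.Ico_succ_singleton, Finset.sum_singleton]
      ring
    · have h5 := (hseg (i := j + 1) hbj hb).translate (r (j + 1) * (r j)⁻¹)⁻¹
      rw [mul_inv_rev, inv_inv, inv_mul_cancel_right] at h5
      have hn' := hn.translate (r (j + 1) * (r j)⁻¹)⁻¹
      rw [inv_mul_cancel, one_mul, inv_inv, mul_inv_rev, inv_inv] at hn'
      have h6 := ((hseg (Nat.zero_le j) hj.le).trans h5).snoc hn'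
      rw [show r (j + 1) * (r j)⁻¹ * (r j * (r (j + 1))⁻¹ * r b) = r b by group] at h6
      have := h6.trans (hseg hb le_rfl)
      refine ⟨_, by convert this using 1; omega, ?_⟩
      rw [← Finset.sum_Ico_consecutive h (Nat.zero_le b) hb,
        ← Finset.sum_Ico_consecutive h (Nat.zero_le j) hbj.le,
        Finset.sum_eq_sum_Ico_succ_bot hbj]
      ring
  rw [h1, h2] at hN
  have := Nat.find_min' hex hN
  omega

end Rays

section Polygon

theorem exists_concat {X : Type*} [Nonempty X] {o l : ℕ → ℕ} (ho : ∀ j, o (j + 1) = o j + l j)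
    (F : ℕ → ℕ → X) (k : ℕ) : ∃ E : ℕ → X, ∀ j < k, ∀ i < l j, E (o j + i) = F j i := by
  have hmono : Monotone o := monotone_nat_of_le_succ fun j ↦ by rw [ho]; omega
  induction k with
  | zero => exact ⟨fun _ ↦ Classical.arbitrary X, by simp⟩
  | succ k ih =>
    obtain ⟨E, hE⟩ := ih
    refine ⟨fun y ↦ if y < o k then E y else F k (y - o k), fun j hj i hi ↦ ?_⟩
    rcases Nat.lt_succ_iff_lt_or_eq.1 hj with hj | rfl
    · have h1 := hmono hj
      rw [Nat.succ_eq_add_one, ho] at h1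
      simp only [if_pos (show o j + i < o k by omega)]
      exact hE j hj i hi
    · simp

theorem exists_eq_concat {o l : ℕ → ℕ} (h0 : o 0 = 0) (ho : ∀ j, o (j + 1) = o j + l j) {k y : ℕ}
    (hy : y < o k) : ∃ j < k, ∃ i < l j, y = o j + i := by
  induction k with
  | zero => omega
  | succ k ih =>
    by_cases h : y < o k
    · obtain ⟨j, hj, h⟩ := ih h
      exact ⟨j, by omega, h⟩
    · rw [ho] at hy
      exact ⟨k, by omega, y - o k, by omega, by omega⟩

variable {G : Type*}

/-- The edges of a path, with the direction in which they are crossed. -/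
def crossings (E : ℕ → G) (m : ℕ) : List (G × Bool) :=
  (List.range m).map fun i ↦ (E i, decide (i % 2 = 0))

theorem crossings_add_two (E : ℕ → G) (n : ℕ) :
    FreeGroup.mk (crossings E (2 * n + 2)) =
      FreeGroup.mk (crossings E (2 * n)) * .of (E (2 * n)) * (.of (E (2 * n + 1)))⁻¹ := by
  rw [crossings, List.range_succ, List.range_succ, List.map_append, List.map_append,
    ← FreeGroup.mul_mk, ← FreeGroup.mul_mk]
  simp [FreeGroup.of, FreeGroup.inv_mk, FreeGroup.invRev, crossings, Nat.add_mod]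

variable [Group G] {S : ℤ → Subgroup G} {x W : ℤ → G} {w : G} {M : ℕ}

theorem PeriodicLine.mk_crossings (hL : PeriodicLine S x W w M) {E : ℕ → G} {n : ℕ}
    (h0 : E 0 ∈ S 1) (hE : ∀ y : ℕ, y + 1 < 2 * n → (E y)⁻¹ * E (y + 1) ∈ S y)
    (hlast : 0 < n → E (2 * n - 1) ∈ S 1) : FreeGroup.mk (crossings E (2 * n)) = 1 := by
  obtain ⟨φ, h1, h2, h3⟩ := hL.exists_cocycle
  have hφ : ∀ g ∈ S 1, φ g = 1 := fun g hg ↦ by rw [← one_mul g, h2 1 g hg, h1]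
  have hsucc : ∀ l < n, FreeGroup.mk (crossings E (2 * l)) = φ (E (2 * l)) →
      FreeGroup.mk (crossings E (2 * l + 2)) = φ (E (2 * l + 1)) := by
    intro l hl h
    have h5 := h3 (E (2 * l)) _ (hL.S_congr (u := (2 * l : ℕ)) (v := 0) (by omega) ▸
      hE (2 * l) (by omega))
    rw [mul_inv_cancel_left] at h5
    rw [crossings_add_two, h, h5]
  have key : ∀ l < n, FreeGroup.mk (crossings E (2 * l)) = φ (E (2 * l)) := by
    intro l hl
    induction l with
    | zero => rw [mul_zero, hφ _ h0]; rfl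
    | succ l ih =>
      have h5 := h2 (E (2 * l + 1)) _ (hL.S_congr (u := (2 * l + 1 : ℕ)) (v := 1) (by omega) ▸
        hE (2 * l + 1) (by omega))
      rw [mul_inv_cancel_left] at h5
      rw [mul_add, mul_one, hsucc l (by omega) (ih (by omega)), ← h5]
  rcases n with _ | n
  · rfl
  · rw [mul_add, mul_one, hsucc n (by omega) (key n (by omega))]
    exact hφ _ (hlast (by omega))

theorem PeriodicLine.exists_matching (hL : PeriodicLine S x W w M) {E : ℕ → G} {n : ℕ}
    (h0 : E 0 ∈ S 1) (hE : ∀ y : ℕ, y + 1 < 2 * n → (E y)⁻¹ * E (y + 1) ∈ S y)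
    (hlast : 0 < n → E (2 * n - 1) ∈ S 1) :
    ∃ α nd, Matching (crossings E (2 * n)) α nd ∧
      ∀ i < 2 * n, E (α i) = E i ∧ (i + α i) % 2 = 1 := by
  obtain ⟨α, nd, h⟩ := _root_.exists_matching (hL.mk_crossings h0 hE hlast)
  refine ⟨α, nd, h, fun i hi ↦ ?_⟩
  have h1 := h.lt i (by simpa [crossings] using hi)
  have h2 := h.inverse i (by simpa [crossings] using hi)
  simp only [crossings, List.length_map, List.length_range] at h1
  simp only [crossings, List.getElem?_map, List.getElem?_range h1, List.getElem?_range hi,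
    Option.map_some, Option.some.injEq, Prod.mk.injEq] at h2
  refine ⟨h2.1, ?_⟩
  have h3 := h2.2
  by_cases h4 : i % 2 = 0 <;> simp [h4] at h3 <;> omega

namespace Ray

variable {p p' d d' v v' : G} {h h' : ℕ} {T T' : ℕ → G} {q q' ε ε' : ℤ}

theorem translate (hr : Ray S W w p d h T v q ε) :
    Ray S W w (d * p) d h (fun s ↦ d * T s) (d * v) q ε where
  zero := by rw [hr.zero]
  step s := by
    have := hr.step s
    convert this using 1
    group
  line i := by rw [hr.line, mul_assoc]
  eq_conj := by
    have := hr.eq_conj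
    calc d = d * d * d⁻¹ := by group
      _ = d * (v * w ^ ε * v⁻¹) * d⁻¹ := by rw [← this]
      _ = d * v * w ^ ε * (d * v)⁻¹ := by group
  ε_eq := hr.ε_eq
  parity := hr.parity

/-- The path which goes along a ray and once around its line, and then follows the translate of
the ray backwards. -/
def loop (h M : ℕ) (T : ℕ → G) (d : G) (i : ℕ) : G :=
  if i < h + M then T (i + 1) else d * T (2 * h + M - i)

theorem apply_period (hL : PeriodicLine S x W w M) (hr : Ray S W w p d h T v q ε) :
    T (h + M + 1) = d * T (h + 1) := by
  have h1 := hr.line M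
  have h2 := hr.line 0
  rw [show h + 1 + M = h + M + 1 by omega] at h1
  rw [Nat.cast_zero, mul_zero, add_zero, add_zero] at h2
  rw [h1, h2, hr.eq_conj]
  have h3 : W (q + ε * M) = w ^ ε * W q := by
    rcases hr.ε_eq with h | h <;> rw [h]
    · rw [one_mul, zpow_one, hL.W_add]
    · have := hL.W_add (q - M)
      rw [sub_add_cancel] at this
      rw [this, zpow_neg_one, inv_mul_cancel_left]; congr 1; ring
  rw [h3]; group

theorem loop_step (hL : PeriodicLine S x W w M) (hr : Ray S W w p d h T v q ε) {i : ℕ}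
    (hi : i < 2 * h + M) : (loop h M T d i)⁻¹ * loop h M T d (i + 1) ∈ S i := by
  have hM := hL.M_pos
  have hM' := hL.M_even
  rcases lt_trichotomy (i + 1) (h + M) with hi' | hi' | hi'
  · rw [loop, loop, if_pos (by omega), if_pos hi',
      hL.S_congr (u := ((i + 1 : ℕ) : ℤ) + 1) (by omega)]
    exact hr.step (i + 1)
  · rw [loop, loop, if_pos (by omega), if_neg (by omega), hi',
      show 2 * h + M - (h + M) = h by omega]
    have h1 := hr.step (h + M)
    have h2 := hr.step h
    rw [hr.apply_period hL] at h1
    rw [hL.S_congr (u := i) (by omega)] at h1 h2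
    convert mul_mem h1 (inv_mem h2) using 1
    group
  · obtain ⟨s, hs⟩ : ∃ s, s + 1 + i = 2 * h + M := ⟨2 * h + M - i - 1, by omega⟩
    rw [loop, loop, if_neg (by omega), if_neg (by omega), show 2 * h + M - i = s + 1 by omega,
      show 2 * h + M - (i + 1) = s by omega, hL.S_congr (u := (s : ℤ) + 1) (by omega)]
    convert inv_mem (hr.step s) using 1
    group

theorem hasRay_of_apply_eq (hL : PeriodicLine S x W w M) (hr : Ray S W w p d h T v q ε)
    (hr' : Ray S W w p' d' h' T' v' q' ε') {s s' : ℕ} (hs' : s' < h')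
    (heq : T (s + 1) = T' (s' + 1)) (hlt : s < s') : ∃ n < h', HasRay S W w p d' n := by
  have h1 := hr.step s
  rw [heq] at h1
  rw [← hr.zero]
  by_cases hpar : s % 2 = s' % 2
  · exact ⟨_, by omega, hL.hasRay_splice (fun s _ ↦ hr.step s) hr' hs'.le hpar h1⟩
  · refine ⟨_, ?_, hL.hasRay_splice (n := s) (m := s' + 1) (fun s _ ↦ hr.step s) hr' hs' (by omega)
      ?_⟩
    · omega
    · have h2 := hr'.step (s' + 1)
      rw [hL.S_congr (u := (s : ℤ) + 1) (by push_cast; omega)] at h2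
      convert mul_mem h1 h2 using 1
      group

theorem hasRay_of_apply_eq_line (hL : PeriodicLine S x W w M) (hr : Ray S W w p d h T v q ε)
    (hr' : Ray S W w p' d' h' T' v' q' ε') {s u : ℕ} (heq : v * W (q + ε * u) = T' (s + 1)) :
    HasRay S W w p' d s := by
  obtain ⟨ε₁, h1, h2⟩ : ∃ ε₁ : ℤ, (ε₁ = 1 ∨ ε₁ = -1) ∧
      (4 : ℤ) ∣ 2 * s + 2 * (q + ε * u) + ε₁ + 1 := by
    rcases Int.even_or_odd' (s + (q + ε * u)) with ⟨n, hn | hn⟩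
    · exact ⟨-1, by simp, n, by linarith⟩
    · exact ⟨1, by simp, n + 1, by linarith⟩
  have h3 := hL.hasRay_of_path (T := T') (n := s) (fun s _ ↦ hr'.step s) h1 h2 (v := v)
    (by rw [heq]; exact hr'.step s)
  rw [hr'.zero] at h3
  have h4 := hr.eq_conj
  rcases h1 with rfl | rfl <;> rcases hr.ε_eq with h | h <;> rw [h] at h4
  · rwa [← h4] at h3
  · have := hL.hasRay_inv h3
    convert this using 1
    rw [h4]; group
  · have := hL.hasRay_inv h3
    convert this using 1
    rw [h4]; group
  · rwa [← h4] at h3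

end Ray

theorem PeriodicLine.exists_treePolygon (hL : PeriodicLine S x W w M) {a : G} (haS : a ∈ S 1)
    (ha : a ≠ 1) (haw : a ∈ Subgroup.normalClosure {w}) :
    ∃ k, 0 < k ∧ Nonempty (TreePolygon x W w a M k) := by
  classical
  have hex := ConjProd.exists_of_mem_normalClosure haw
  obtain ⟨k, hk, hmink⟩ : ∃ k, ConjProd w k a ∧ ∀ n < k, ¬ ConjProd w n a :=
    ⟨Nat.find hex, Nat.find_spec hex, fun n ↦ Nat.find_min hex⟩
  have hk0 : 0 < k := by
    rcases k.eq_zero_or_pos with rfl | h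
    · cases hk; exact absurd rfl ha
    · exact h
  refine ⟨k, hk0, ?_⟩
  obtain ⟨p, h, hp0, hpk, hray, hmin⟩ := hL.exists_minimal_seq hk
  have hray' : ∀ j, ∃ T v q ε, (ε = 1 ∨ ε = -1) ∧
      (j < k → Ray S W w (p j) (p (j + 1) * (p j)⁻¹) (h j) T v q ε) := by
    intro j
    by_cases hj : j < k
    · obtain ⟨T, v, q, ε, hr⟩ := hray j hj
      exact ⟨T, v, q, ε, hr.ε_eq, fun _ ↦ hr⟩
    · exact ⟨1, 1, 0, 1, by simp, fun h ↦ absurd h hj⟩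
  choose T v q ε hε hT using hray'
  set d : ℕ → G := fun j ↦ p (j + 1) * (p j)⁻¹
  have hdp : ∀ j, d j * p j = p (j + 1) := fun j ↦ inv_mul_cancel_right _ _
  have hT' : ∀ j < k, Ray S W w (p (j + 1)) (d j) (h j) (fun s ↦ d j * T j s) (d j * v j) (q j)
      (ε j) := fun j hj ↦ hdp j ▸ (hT j hj).translate
  have hM := hL.M_pos
  have hM' := hL.M_even
  obtain ⟨o, ho0, ho⟩ : ∃ o : ℕ → ℕ, o 0 = 0 ∧ ∀ j, o (j + 1) = o j + (2 * h j + M) :=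
    ⟨fun j ↦ ∑ i ∈ Finset.range j, (2 * h i + M), rfl, fun j ↦ Finset.sum_range_succ _ _⟩
  have ho2 : ∀ j, 2 ∣ o j := by
    intro j
    induction j with
    | zero => simp [ho0]
    | succ j ih => rw [ho]; omega
  have homono : Monotone o := monotone_nat_of_le_succ fun j ↦ by rw [ho]; omega
  obtain ⟨E, hE⟩ := exists_concat ho (fun j ↦ Ray.loop (h j) M (T j) (d j)) k
  have hEout : ∀ j < k, ∀ i < h j + M, E (o j + i) = T j (i + 1) := fun j hj i hi ↦ by
    rw [hE j hj i (by omega), Ray.loop, if_pos hi]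
  have hEdart : ∀ j < k, ∀ u < M, E (o j + h j + u) = v j * W (q j + ε j * u) :=
    fun j hj u hu ↦ by
      rw [add_assoc, hEout j hj _ (by omega), ← (hT j hj).line]; congr 1; omega
  have hEret : ∀ j < k, ∀ s < h j, ∀ y, y + 1 + s = o (j + 1) → E y = d j * T j (s + 1) := by
    intro j hj s hs y hy
    rw [ho] at hy
    have := hE j hj (y - o j) (by omega)
    rw [show o j + (y - o j) = y by omega, Ray.loop, if_neg (by omega),
      show 2 * h j + M - (y - o j) = s + 1 by omega] at this
    exact this
  have hjoint : ∀ j < k, (p j)⁻¹ * E (o j) ∈ S 1 := by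
    intro j hj
    have := (hT j hj).step 0
    rw [(hT j hj).zero, Nat.cast_zero, zero_add, zero_add] at this
    rwa [← hEout j hj 0 (by omega)] at this
  have hjoint' : ∀ j < k, ∀ y, y + 1 = o (j + 1) → (E y)⁻¹ * p (j + 1) ∈ S 1 := by
    intro j hj y hy
    rw [ho] at hy
    have := (hT j hj).loop_step hL (i := y - o j) (by omega)
    rw [← hE j hj _ (by omega), show o j + (y - o j) = y by omega, Ray.loop, if_neg (by omega),
      show 2 * h j + M - (y - o j + 1) = 0 by omega, (hT j hj).zero, hdp,
      hL.S_congr (u := 1) (by have := ho2 j; omega)] at this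
    exact this
  have hstep : ∀ y : ℕ, y + 1 < o k → (E y)⁻¹ * E (y + 1) ∈ S y := by
    intro y hy
    obtain ⟨j, hj, i, hi, rfl⟩ := exists_eq_concat ho0 ho (show y < o k by omega)
    by_cases hi' : i + 1 < 2 * h j + M
    · rw [add_assoc, hE j hj _ hi, hE j hj _ hi', hL.S_congr (u := i) (by have := ho2 j; omega)]
      exact (hT j hj).loop_step hL hi
    · have h1 : o j + i + 1 = o (j + 1) := by rw [ho]; omega
      have h2 : j + 1 < k := by
        by_contra hc
        have := homono (show k ≤ j + 1 by omega)
        omega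
      have h3 := mul_mem (hjoint' j hj _ h1) (hjoint (j + 1) h2)
      rw [hL.S_congr (u := 1) (by have := ho2 (j + 1); omega), h1]
      convert h3 using 1
      group
  obtain ⟨n, hn⟩ := ho2 k
  obtain ⟨α, nd, hα, hαE⟩ := hL.exists_matching (E := E) (n := n)
    (by simpa [ho0, hp0] using hjoint 0 hk0) (by rwa [← hn]) (fun h ↦ by
      obtain ⟨j, rfl⟩ : ∃ j, k = j + 1 := ⟨k - 1, by omega⟩
      have h1 := hjoint' j (by omega) (2 * n - 1) (by omega)
      rw [hpk] at h1
      rw [← inv_mem_iff, ← mul_inv_cancel_right (E _)⁻¹ a]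
      exact mul_mem h1 (inv_mem haS))
  have hlen : (crossings E (2 * n)).length = o k := by simp [crossings, hn]
  rw [← hn] at hαE
  have htail : ∀ i < k, ∀ j < k, ∀ b ≤ k, ∀ c ≤ k, ∀ {T v q ε T' v' q' ε'},
      Ray S W w (p b) (d i) (h i) T v q ε → Ray S W w (p c) (d j) (h j) T' v' q' ε' →
      ∀ s < h i, ∀ s' < h j, T (s + 1) = T' (s' + 1) → s = s' := by
    intro i hi j hj b hb c hc T v q ε T' v' q' ε' hr hr' s hs s' hs' heq
    rcases lt_trichotomy s s' with hlt | hlt | hlt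
    · obtain ⟨n, hn, hn'⟩ := hr.hasRay_of_apply_eq hL hr' hs' heq hlt
      have := hmin j hj b hb n hn'
      omega
    · exact hlt
    · obtain ⟨n, hn, hn'⟩ := hr'.hasRay_of_apply_eq hL hr hs heq.symm hlt
      have := hmin i hi c hc n hn'
      omega
  have hcases : ∀ y < o k, (∃ i < k, o i + h i ≤ y ∧ y < o i + h i + M) ∨
      (∃ i < k, ∃ s < h i, y = o i + s) ∨ ∃ i < k, ∃ s < h i, y + 1 + s = o (i + 1) := by
    intro y hy
    obtain ⟨j, hj, i, hi, rfl⟩ := exists_eq_concat ho0 ho hy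
    rcases lt_or_ge i (h j) with h1 | h1
    · exact Or.inr (Or.inl ⟨j, hj, i, h1, rfl⟩)
    rcases lt_or_ge i (h j + M) with h2 | h2
    · exact Or.inl ⟨j, hj, by omega⟩
    · exact Or.inr (Or.inr ⟨j, hj, 2 * h j + M - 1 - i, by omega, by rw [ho]; omega⟩)
  have hP : ∀ j ≤ k, p (j % k) * a ^ (j / k) = p j := by
    intro j hj
    rcases hj.lt_or_eq with hj | rfl
    · rw [Nat.mod_eq_of_lt hj, Nat.div_eq_of_lt hj, pow_zero, mul_one]
    · rw [Nat.mod_self, Nat.div_self hk0, hp0, hpk, pow_one, one_mul]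
  have hlt : ∀ y < o k, α y < o k := fun y hy ↦ hlen ▸ hα.lt y (hlen ▸ hy)
  have hole : ∀ j < k, o (j + 1) ≤ o k := fun j hj ↦ homono hj
  refine ⟨{
    h := h, o := o, α := α, nd := nd, p := fun t ↦ p (t % k) * a ^ (t / k), v := v, E := E, q := q
    ε := ε
    M_pos := hM
    M_even := hM'
    W_succ := hL.W_succ
    W_add := hL.W_add
    minimal := hmink
    o_zero := ho0
    o_succ := ho
    α_lt := hlt
    α_α := hlen ▸ hα.invol
    α_odd := fun y hy ↦ (hαE y hy).2
    noncross := hlen ▸ hα.noncross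
    E_α := fun y hy ↦ (hαE y hy).1
    nd_start := hlen ▸ hα.node_start
    nd_lt := hlen ▸ hα.node_lt
    nd_surj := hlen ▸ hα.node_surj
    nd_closed := hlen ▸ hα.node_closed
    p_zero := by simp [hp0]
    p_add := fun t ↦ by rw [Nat.add_mod_right, Nat.add_div_right _ hk0, pow_succ, mul_assoc]
    ε_eq := hε
    p_succ := fun j hj ↦ by
      rw [hP j hj.le, hP (j + 1) hj, ← (hT j hj).eq_conj, inv_mul_cancel_right]
    E_ret := fun j hj s hs y hy ↦ by
      rw [hP j hj.le, hP (j + 1) hj, hEret j hj s hs y hy, hEout j hj s (by omega)]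
    E_dart := hEdart
    parity := fun j hj ↦ by
      have h1 := (hT j hj).parity
      have h2 := ho2 j
      push_cast; omega
    α_ret := fun j hj s hs y hy ↦ ?_
    α_out := fun j hj s hs ↦ ?_
    α_dart := fun j hj u hu i hi s hs hα' ↦ ?_ }⟩
  · have hy' := hole j hj
    obtain ⟨h1, h2⟩ := hαE y (by omega)
    rw [hEret j hj s hs y hy] at h1
    rcases hcases (α y) (hlt y (by omega)) with h3 | ⟨i, hi, t, ht, h3⟩ | ⟨i, hi, t, ht, h3⟩
    · exact Or.inl h3
    · rw [h3, hEout i hi t (by omega)] at h1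
      have := htail i hi j hj i hi.le (j + 1) hj (hT i hi) (hT' j hj) t ht s hs h1
      exact Or.inr ⟨i, hi, by omega, by rw [h3, this]⟩
    · rw [hEret i hi t ht _ h3] at h1
      have := htail i hi j hj (i + 1) hi (j + 1) hj (hT' i hi) (hT' j hj) t ht s hs h1
      have := ho2 (i + 1)
      have := ho2 (j + 1)
      omega
  · have hy' := hole j hj
    rw [ho] at hy'
    obtain ⟨h1, h2⟩ := hαE (o j + s) (by omega)
    rw [hEout j hj s (by omega)] at h1
    rcases hcases (α (o j + s)) (hlt _ (by omega)) with h3 | ⟨i, hi, t, ht, h3⟩ | ⟨i, hi, t, ht, h3⟩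
    · exact Or.inl h3
    · rw [h3, hEout i hi t (by omega)] at h1
      have := htail i hi j hj i hi.le j hj.le (hT i hi) (hT j hj) t ht s hs h1
      have := ho2 i
      have := ho2 j
      omega
    · rw [hEret i hi t ht _ h3] at h1
      have := htail i hi j hj (i + 1) hi j hj.le (hT' i hi) (hT j hj) t ht s hs h1
      exact Or.inr ⟨i, hi, this ▸ ht, by subst this; exact h3⟩
  · have hy' := hole j hj
    rw [ho] at hy'
    obtain ⟨h1, h2⟩ := hαE (o j + h j + u) (by omega)
    rw [hEdart j hj u hu] at h1
    rcases hα' with h3 | h3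
    · rw [h3, hEout i hi s (by omega)] at h1
      exact hmin j hj i hi.le s ((hT j hj).hasRay_of_apply_eq_line hL (hT i hi) h1.symm)
    · rw [hEret i hi s hs _ h3] at h1
      exact hmin j hj (i + 1) hi s ((hT j hj).hasRay_of_apply_eq_line hL (hT' i hi) h1.symm)

end Polygon

theorem CornerPath.map {L L' : Type*} [Group L] [Group L'] (θ : L →* L') {x : ℤ → L}
    {R : ℤ → ℤ → Prop} {v i o : ℤ} {g : L} (h : CornerPath x R v i o g) :
    CornerPath (fun q ↦ θ (x q)) R v i o (θ g) := by
  induction h with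
  | fwd q hq => exact .fwd q hq
  | bwd q hq => rw [map_inv]; exact .bwd q hq
  | append _ hR _ ih₁ ih₂ => rw [map_mul]; exact .append ih₁ hR ih₂

theorem CornerPath.exists_lift {L L' : Type*} [Group L] [Group L'] (θ : L →* L') {x : ℤ → L}
    {R : ℤ → ℤ → Prop} {v i o : ℤ} {g : L'} (h : CornerPath (fun q ↦ θ (x q)) R v i o g) :
    ∃ g₀, CornerPath x R v i o g₀ ∧ θ g₀ = g := by
  induction h with
  | fwd q hq => exact ⟨_, .fwd q hq, rfl⟩
  | bwd q hq => exact ⟨_, .bwd q hq, map_inv _ _⟩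
  | append _ hR _ ih₁ ih₂ =>
    obtain ⟨g, hg, rfl⟩ := ih₁
    obtain ⟨h, hh, rfl⟩ := ih₂
    exact ⟨g * h, .append hg hR hh, map_mul _ _ _⟩

theorem Admissible.of_map {L L' E : Type*} [Group L] [Group L'] [LE E] (θ : L →* L') {x : ℤ → L}
    {f : ℤ → E} (hf : Admissible (fun q ↦ θ (x q)) f) : Admissible x f :=
  fun v i o h ↦ hf v i o (by simpa using h.map θ)

theorem Admissible.map {L L' E : Type*} [Group L] [Group L'] [LE E] {θ : L →* L'}
    (hθ : Function.Injective θ) {x : ℤ → L} {f : ℤ → E} (hf : Admissible x f) :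
    Admissible (fun q ↦ θ (x q)) f := by
  intro v i o h
  obtain ⟨g, hg, hg1⟩ := h.exists_lift
  rw [map_eq_one_iff θ hθ] at hg1
  exact hf v i o (hg1 ▸ hg)

theorem IsLeftOrderable.subgroup {H : Type*} [Group H] (hH : IsLeftOrderable H)
    (K : Subgroup H) : IsLeftOrderable K := by
  obtain ⟨lt, hlt, hmul⟩ := hH
  exact ⟨_, (Subrel.relEmbedding lt (· ∈ K)).isStrictTotalOrder, fun f g h ↦ hmul f g h⟩

theorem countable_closure_range {H ι : Type*} [Group H] [Countable ι] (y : ι → H) :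
    Countable (Subgroup.closure (Set.range y)) := by
  rw [← FreeGroup.range_lift_eq_closure]
  have : Countable (FreeGroup ι) := Quotient.countable
  exact (Set.countable_range (FreeGroup.lift y)).to_subtype

theorem exists_int_products {G : Type*} [Group G] (z : ℤ → G) :
    ∃ W : ℤ → G, W 0 = 1 ∧ ∀ q, W (q + 1) = W q * z (q + 1) := by
  let σ : Equiv.Perm (ℤ × G) :=
    { toFun := fun p ↦ (p.1 + 1, p.2 * z (p.1 + 1))
      invFun := fun p ↦ (p.1 - 1, p.2 * (z p.1)⁻¹)
      left_inv := fun p ↦ by simp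
      right_inv := fun p ↦ by simp }
  have hσ : ∀ p, σ p = (p.1 + 1, p.2 * z (p.1 + 1)) := fun _ ↦ rfl
  have hs : ∀ q : ℤ, (σ ^ (q + 1)) (0, 1) = σ ((σ ^ q) (0, 1)) := fun q ↦ by
    rw [add_comm, zpow_add, zpow_one, Equiv.Perm.mul_apply]
  have h1 : ∀ q, ((σ ^ q) (0, 1)).1 = q := by
    intro q
    induction q using Int.induction_on with
    | zero => simp
    | succ n ih => rw [hs, hσ, ih]
    | pred n ih =>
      have := hs (-n - 1)
      rw [sub_add_cancel] at this
      rw [this, hσ] at ih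
      dsimp only at ih
      linarith
  refine ⟨fun q ↦ ((σ ^ q) (0, 1)).2, by simp, fun q ↦ ?_⟩
  simp only [hs, hσ, h1]

theorem int_products_add {G : Type*} [Group G] {z W : ℤ → G} {M : ℤ}
    (hz : Function.Periodic z M) (h0 : W 0 = 1) (hW : ∀ q, W (q + 1) = W q * z (q + 1)) (q : ℤ) :
    W (q + M) = W M * W q := by
  induction q using Int.induction_on with
  | zero => simp [h0]
  | succ n ih =>
    rw [hW, ← mul_assoc, ← ih, show (n : ℤ) + 1 + M = n + M + 1 by ring, hW,
      show (n : ℤ) + M + 1 = n + 1 + M by ring, hz]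
  | pred n ih =>
    obtain ⟨p, hp⟩ : ∃ p, -(n : ℤ) = p + 1 := ⟨-n - 1, by ring⟩
    rw [hp, show p + 1 + M = p + M + 1 by ring, hW, hW, show p + M + 1 = p + 1 + M by ring, hz,
      ← mul_assoc] at ih
    rw [hp, add_sub_cancel_right]
    exact mul_right_cancel ih

open Monoid Coprod

theorem Monoid.Coprod.exists_cocycle (A B : Type*) [Group A] [Group B] :
    ∃ φ : Coprod A B → FreeGroup (Coprod A B), φ 1 = 1 ∧
      (∀ g, ∀ a ∈ (inl : A →* Coprod A B).range, φ (g * a) = φ g) ∧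
      ∀ g, ∀ b ∈ (inr : B →* Coprod A B).range, φ (g * b) = φ g * .of g * (.of (g * b))⁻¹ := by
  let α : Coprod A B →* MulAut (FreeGroup (Coprod A B)) :=
    { toFun := fun g ↦ FreeGroup.freeGroupCongr (Equiv.mulLeft g)
      map_one' := by
        ext t
        induction t using FreeGroup.induction_on <;> simp_all
      map_mul' := fun g h ↦ by
        ext t
        induction t using FreeGroup.induction_on <;> simp_all [mul_assoc] }
  have hα : ∀ g h, α g (.of h) = .of (g * h) := fun g h ↦ by simp [α]
  let θ : Coprod A B →* SemidirectProduct _ _ α := lift (SemidirectProduct.inr.comp inl)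
    ((MulAut.conj (SemidirectProduct.inl (.of 1))).toMonoidHom.comp
      (SemidirectProduct.inr.comp inr))
  have hr : ∀ g, (θ g).right = g := by
    have : (SemidirectProduct.rightHom.comp θ) = .id _ := by
      apply hom_ext
      · ext; simp [θ]
      · ext; simp [θ]
    exact fun g ↦ DFunLike.congr_fun this g
  refine ⟨fun g ↦ (θ g).left, by simp, ?_, ?_⟩
  · rintro g _ ⟨a, rfl⟩
    have : (θ (inl a)).left = 1 := by simp [θ]
    simp [this]
  · rintro g _ ⟨b, rfl⟩
    have : (θ (inr b)).left = .of 1 * (.of (inr b))⁻¹ := by simp [θ, hα]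
    simp [this, hr, hα, mul_assoc]

/-- The interleaving `…, u 0, v 0, u 1, v 1, …` of two sequences, with `u 0` at position `1`. -/
def interleave {L : Type*} (u v : ℤ → L) (q : ℤ) : L :=
  if Even q then v ((q - 1) / 2) else u ((q - 1) / 2)

section Interleave

variable {L L' : Type*} (u v : ℤ → L)

theorem interleave_odd (i : ℤ) : interleave u v (2 * i + 1) = u i := by
  rw [interleave, if_neg (by simp), add_sub_cancel_right, Int.mul_ediv_cancel_left _ two_ne_zero]

theorem interleave_even (i : ℤ) : interleave u v (2 * i + 2) = v i := by
  rw [interleave, if_pos (by simp), show (2 * i + 2 - 1) / 2 = i by omega]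

theorem map_interleave (θ : L → L') (q : ℤ) :
    θ (interleave u v q) = interleave (fun i ↦ θ (u i)) (fun i ↦ θ (v i)) q := by
  unfold interleave
  split_ifs <;> rfl

variable {u v}

theorem interleave_periodic {n : ℤ} (hu : Function.Periodic u n) (hv : Function.Periodic v n) :
    Function.Periodic (interleave u v) (2 * n) := by
  intro q
  have h : (q + 2 * n - 1) / 2 = (q - 1) / 2 + n := by omega
  rw [interleave, interleave, h, hu, hv]
  simp [Int.even_add]

theorem forall_interleave {p : ℤ → L → Prop} (hu : ∀ i, p (2 * i + 1) (u i))
    (hv : ∀ i, p (2 * i + 2) (v i)) (q : ℤ) : p q (interleave u v q) := by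
  rcases Int.even_or_odd' q with ⟨i, rfl | rfl⟩
  · have := hv (i - 1)
    rw [← interleave_even u v, show 2 * (i - 1) + 2 = 2 * i by ring] at this
    exact this
  · rw [interleave_odd]
    exact hu i

end Interleave

section FreeProduct

variable {A B : Type*} [Group A] [Group B]

/-- The element of the free product spelled by a list of pairs of letters. -/
def pairsProd (l : List (A × B)) : Coprod A B :=
  (l.map fun e ↦ inl e.1 * inr e.2).prod

@[simp]
theorem pairsProd_nil : pairsProd ([] : List (A × B)) = 1 := rfl

@[simp]
theorem pairsProd_cons (e : A × B) (l : List (A × B)) :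
    pairsProd (e :: l) = inl e.1 * inr e.2 * pairsProd l := by
  simp [pairsProd]

@[simp]
theorem pairsProd_append (l l' : List (A × B)) :
    pairsProd (l ++ l') = pairsProd l * pairsProd l' := by
  simp [pairsProd]

theorem exists_pairsProd_eq (w : Coprod A B) : ∃ l, pairsProd l = w := by
  induction w using Coprod.induction_on' with
  | one => exact ⟨[], rfl⟩
  | inl_mul a w ih =>
    obtain ⟨l, rfl⟩ := ih
    exact ⟨(a, 1) :: l, by simp⟩
  | inr_mul b w ih =>
    obtain ⟨l, rfl⟩ := ih
    exact ⟨(1, b) :: l, by simp⟩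

/-- Every element of a free product is conjugate into a factor or cyclically reduced of positive
length. -/
theorem exists_cyclically_reduced (w : Coprod A B) :
    (∃ a, IsConj (inl a) w) ∨ (∃ b, IsConj (inr b) w) ∨
      ∃ l : List (A × B), l ≠ [] ∧ (∀ e ∈ l, e.1 ≠ 1 ∧ e.2 ≠ 1) ∧ IsConj (pairsProd l) w := by
  classical
  have hex : ∃ n, ∃ l : List (A × B), l.length = n ∧ IsConj (pairsProd l) w := by
    obtain ⟨l, rfl⟩ := exists_pairsProd_eq w
    exact ⟨_, l, rfl, .refl _⟩
  obtain ⟨l, hl, hlw⟩ := Nat.find_spec hex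
  have hmin : ∀ l', IsConj (pairsProd l') w → l.length ≤ l'.length := fun l' h ↦
    hl.symm ▸ Nat.find_min' hex ⟨l', rfl, h⟩
  by_cases hnil : l = []
  · subst hnil
    exact .inl ⟨1, by simpa using hlw⟩
  by_cases hgood : ∀ e ∈ l, e.1 ≠ 1 ∧ e.2 ≠ 1
  · exact .inr (.inr ⟨l, hnil, hgood, hlw⟩)
  push Not at hgood
  obtain ⟨e, he, hbad⟩ := hgood
  obtain ⟨l₁, l₂, rfl⟩ := List.append_of_mem he
  have hrot : ∀ l l' : List (A × B), IsConj (pairsProd (l ++ l')) (pairsProd (l' ++ l)) :=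
    fun l l' ↦ isConj_iff.2 ⟨pairsProd l', by simp [mul_assoc]⟩
  by_cases h1 : e.1 = 1
  · have hlw' : IsConj (pairsProd (l₂ ++ l₁ ++ [e])) w :=
      .trans (by simpa only [List.append_assoc, List.singleton_append] using hrot l₂ (l₁ ++ [e]))
        hlw
    rcases List.eq_nil_or_concat (l₂ ++ l₁) with h | ⟨l₃, e', h⟩
    · exact .inr (.inl ⟨e.2, by simpa [h, h1] using hlw'⟩)
    · have := hmin (l₃ ++ [(e'.1, e'.2 * e.2)]) (by simpa [h, h1, mul_assoc] using hlw')
      have h' := congrArg List.length h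
      simp at this h'
      omega
  · have h2 := hbad h1
    have hlw' : IsConj (pairsProd (e :: (l₂ ++ l₁))) w :=
      .trans (hrot (e :: l₂) l₁) hlw
    rcases h : l₂ ++ l₁ with _ | ⟨e', l₃⟩
    · exact .inl ⟨e.1, by simpa [h, h2] using hlw'⟩
    · have := hmin ((e.1 * e'.1, e'.2) :: l₃) (by simpa [h, h2, mul_assoc] using hlw')
      have h' := congrArg List.length h
      simp at this h'
      omega

/-- The bi-infinite sequence of letters of the free product spelled by a sequence of pairs. -/
def letters (y : ℤ → A × B) : ℤ → Coprod A B :=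
  interleave (fun i ↦ inl (y i).1) fun i ↦ inr (y i).2

/-- The factor of the free product which contains the letters of a given parity. -/
def factor (A B : Type*) [Group A] [Group B] (v : ℤ) : Subgroup (Coprod A B) :=
  if Even v then inr.range else inl.range

theorem periodicLine_letters {y : ℤ → A × B} {n : ℕ} (hn : 0 < n) (hy : Function.Periodic y n)
    {W : ℤ → Coprod A B} (h0 : W 0 = 1) (hW : ∀ q, W (q + 1) = W q * letters y (q + 1)) :
    PeriodicLine (factor A B) (letters y) W (W (2 * n : ℕ)) (2 * n) where
  M_pos := by omega
  M_even := by simp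
  S_add_two v := by simp [factor]
  sup_eq_top := by simp [factor, sup_comm]
  x_mem := by
    refine forall_interleave (p := fun q g ↦ g ∈ factor A B q) (fun i ↦ ?_) fun i ↦ ?_
    · simp [factor, show ¬ Odd (2 * i) by simp]
    · simp [factor]
  W_zero := h0
  W_succ := hW
  W_add := by
    refine int_products_add ?_ h0 hW
    push_cast
    exact interleave_periodic (hy.comp fun e ↦ inl e.1) (hy.comp fun e ↦ inr e.2)
  exists_cocycle := by simpa [factor] using Coprod.exists_cocycle A B

theorem exists_injective_admissible_letters (hA : IsLeftOrderable A) (hB : IsLeftOrderable B)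
    {y : ℤ → A × B} {n : ℕ} (hn : 0 < n) (hy : Function.Periodic y n)
    (hmin : ∀ d : ℤ, Function.Periodic y d → (n : ℤ) ∣ d)
    (h1 : ∀ i, (y i).1 ≠ 1) (h2 : ∀ i, (y i).2 ≠ 1) :
    ∃ (e : ℕ) (f : ℤ → Fin e), Function.Periodic f ((2 * n : ℕ) : ℤ) ∧
      Admissible (letters y) f ∧ ∀ q q', f q = f q' → ((2 * n : ℕ) : ℤ) ∣ q' - q := by
  let A₀ := Subgroup.closure (Set.range fun i ↦ (y i).1)
  let B₀ := Subgroup.closure (Set.range fun i ↦ (y i).2)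
  have : Countable A₀ := countable_closure_range _
  have : Countable B₀ := countable_closure_range _
  obtain ⟨α, hα, hα1⟩ := (hA.subgroup A₀).exists_real_action
  obtain ⟨β, hβ, hβ1⟩ := (hB.subgroup B₀).exists_real_action
  let a : ℤ → A₀ := fun i ↦ ⟨(y i).1, Subgroup.subset_closure ⟨i, rfl⟩⟩
  let b : ℤ → B₀ := fun i ↦ ⟨(y i).2, Subgroup.subset_closure ⟨i, rfl⟩⟩
  let x : ℤ → A₀ × B₀ := interleave (fun i ↦ (a i, 1)) fun i ↦ (1, b i)
  have hper : ∀ d, Function.Periodic y d → Function.Periodic x (2 * d) := fun d hd ↦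
    interleave_periodic (fun i ↦ by simp [a, hd i]) fun i ↦ by simp [b, hd i]
  have hD : LetterData x (2 * n)
      (fun v ↦ if Even v then β.comp (.snd A₀ B₀) else α.comp (.fst A₀ B₀))
      (fun v ↦ if Even v then Subgroup.prod ⊥ ⊤ else Subgroup.prod ⊤ ⊥) :=
    { pos := by omega
      even := by simp
      periodic := by push_cast; exact hper n hy
      ne_one := by
        refine forall_interleave (p := fun _ g ↦ g ≠ 1) (fun i ↦ ?_) fun i ↦ ?_
        · simpa [a] using h1 i
        · simpa [b] using h2 i
      mem := by
        intro v q hqv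
        have : Even q ↔ Even v := by rw [← Int.even_sub, even_iff_two_dvd]; exact hqv
        simp only [← this]
        refine forall_interleave (p := fun q g ↦ g ∈ if Even q then Subgroup.prod ⊥ ⊤ else
          Subgroup.prod ⊤ ⊥) (fun i ↦ ?_) (fun i ↦ ?_) q
        · simp [show ¬ Odd (2 * i) by simp, Subgroup.mem_prod]
        · simp [Subgroup.mem_prod]
      disp := fun v g t ↦ by
        split_ifs
        exacts [hβ _ _, hα _ _]
      free := fun v g ↦ by
        split_ifs <;> simp only [Subgroup.mem_prod, Subgroup.mem_bot]
        · exact fun h h0 ↦ Prod.ext h.1 (hβ1 _ h0)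
        · exact fun h h0 ↦ Prod.ext (hα1 _ h0) h.2 }
  obtain ⟨e, f, hf, hadm, hinj⟩ := hD.exists_injective_admissible (by
    rintro _ ⟨d, rfl⟩ hx
    push_cast
    refine mul_dvd_mul_left 2 (hmin d fun i ↦ Prod.ext ?_ ?_)
    · have := hx (2 * i + 1)
      rw [show 2 * i + 1 + 2 * d = 2 * (i + d) + 1 by ring] at this
      simp only [x, interleave_odd, Prod.mk.injEq, and_true] at this
      exact congrArg Subtype.val this
    · have := hx (2 * i + 2)
      rw [show 2 * i + 2 + 2 * d = 2 * (i + d) + 2 by ring] at this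
      simp only [x, interleave_even, Prod.mk.injEq, true_and] at this
      exact congrArg Subtype.val this)
  refine ⟨e, f, hf, .of_map toProd ?_, hinj⟩
  convert hadm.map (θ := A₀.subtype.prodMap B₀.subtype)
    (Prod.map_injective.2 ⟨Subtype.val_injective, Subtype.val_injective⟩) using 1
  funext q
  rw [letters, map_interleave _ _ toProd, map_interleave _ _ (A₀.subtype.prodMap B₀.subtype)]
  simp [a, b]

theorem normalClosure_ne_top_of_isConj_inl [Nontrivial B] {w : Coprod A B} {a : A}
    (h : IsConj (inl a) w) : Subgroup.normalClosure {w} ≠ ⊤ := by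
  intro htop
  obtain ⟨b, hb⟩ := exists_ne (1 : B)
  have hw : snd w = 1 := by
    simpa using ((snd : Coprod A B →* B).map_isConj h).symm
  have hle : Subgroup.normalClosure {w} ≤ (snd : Coprod A B →* B).ker :=
    Subgroup.normalClosure_le_normal (by simpa [MonoidHom.mem_ker] using hw)
  have : inr b ∈ (snd : Coprod A B →* B).ker := hle (htop ▸ Subgroup.mem_top _)
  exact hb (by simpa [MonoidHom.mem_ker] using this)

theorem normalClosure_ne_top_of_isConj_inr [Nontrivial A] {w : Coprod A B} {b : B}
    (h : IsConj (inr b) w) : Subgroup.normalClosure {w} ≠ ⊤ := by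
  intro htop
  obtain ⟨a, ha⟩ := exists_ne (1 : A)
  have hw : fst w = 1 := by
    simpa using ((fst : Coprod A B →* A).map_isConj h).symm
  have hle : Subgroup.normalClosure {w} ≤ (fst : Coprod A B →* A).ker :=
    Subgroup.normalClosure_le_normal (by simpa [MonoidHom.mem_ker] using hw)
  have : inl a ∈ (fst : Coprod A B →* A).ker := hle (htop ▸ Subgroup.mem_top _)
  exact ha (by simpa [MonoidHom.mem_ker] using this)

theorem normalClosure_ne_top_of_primitive [Nontrivial A] (hA : IsLeftOrderable A)
    (hB : IsLeftOrderable B) {y : ℤ → A × B} {n : ℕ} (hn : 0 < n) (hy : Function.Periodic y n)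
    (hmin : ∀ d : ℤ, Function.Periodic y d → (n : ℤ) ∣ d)
    (h1 : ∀ i, (y i).1 ≠ 1) (h2 : ∀ i, (y i).2 ≠ 1) {W : ℤ → Coprod A B} (h0 : W 0 = 1)
    (hW : ∀ q, W (q + 1) = W q * letters y (q + 1)) :
    Subgroup.normalClosure {W (2 * n : ℕ)} ≠ ⊤ := by
  intro htop
  obtain ⟨a, ha⟩ := exists_ne (1 : A)
  obtain ⟨e, f, hf, hadm, hinj⟩ := exists_injective_admissible_letters hA hB hn hy hmin h1 h2
  obtain ⟨k, hk, ⟨P⟩⟩ := (periodicLine_letters hn hy h0 hW).exists_treePolygon (a := inl a)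
    (by simp [factor]) (by rwa [Ne, map_eq_one_iff _ inl_injective]) (htop ▸ Subgroup.mem_top _)
  exact P.false_of_admissible hk hf hadm hinj

theorem exists_minimal_period {X : Type*} {y : ℤ → X} {m : ℕ} (hm : 0 < m)
    (hy : Function.Periodic y m) : ∃ n : ℕ, 0 < n ∧ Function.Periodic y n ∧
      ∀ d : ℤ, Function.Periodic y d → (n : ℤ) ∣ d := by
  classical
  have hex : ∃ n : ℕ, 0 < n ∧ Function.Periodic y n := ⟨m, hm, hy⟩
  obtain ⟨hpos, hper⟩ := Nat.find_spec hex
  refine ⟨Nat.find hex, hpos, hper, fun d hd ↦ ?_⟩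
  set n := Nat.find hex
  have hr : Function.Periodic y (d - d / n * n) := hd.sub_period (hper.int_mul _)
  have hr' : d - d / n * n = d % n := by linarith [Int.ediv_mul_add_emod d n]
  rw [hr'] at hr
  have hnn := Int.emod_nonneg d (by omega : (n : ℤ) ≠ 0)
  have hlt := Int.emod_lt_of_pos d (by omega : 0 < (n : ℤ))
  lift d % n to ℕ using hnn with r hr0
  by_contra hdvd
  have hr1 : r ≠ 0 := fun h ↦ hdvd (Int.dvd_of_emod_eq_zero (by rw [← hr0, h]; rfl))
  exact Nat.find_min hex (by omega : r < n) ⟨by omega, hr⟩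

/-- The free product of two nontrivial left-orderable groups has normal rank greater than one. -/
theorem normalClosure_ne_top_of_isLeftOrderable [Nontrivial A] [Nontrivial B]
    (hA : IsLeftOrderable A) (hB : IsLeftOrderable B) (w : Coprod A B) :
    Subgroup.normalClosure {w} ≠ ⊤ := by
  rcases exists_cyclically_reduced w with ⟨a, h⟩ | ⟨b, h⟩ | ⟨l, hl, hgood, h⟩
  · exact normalClosure_ne_top_of_isConj_inl h
  · exact normalClosure_ne_top_of_isConj_inr h
  have hm : 0 < l.length := List.length_pos_iff.2 hl
  set m := l.length with hm_def
  let y : ℤ → A × B := fun i ↦ l.getD (i % m).toNat 1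
  have hymem : ∀ i, y i ∈ l := fun i ↦ by
    have := Int.emod_lt_of_pos i (by omega : 0 < (m : ℤ))
    simp only [y]
    rw [List.getD_eq_getElem _ _ (by omega)]
    exact List.getElem_mem _
  have hy : Function.Periodic y m := fun i ↦ by simp [y]
  obtain ⟨n, hn, hyn, hmin⟩ := exists_minimal_period hm hy
  obtain ⟨W, h0, hW⟩ := exists_int_products (letters y)
  have hne := normalClosure_ne_top_of_primitive hA hB hn hyn hmin (fun i ↦ (hgood _ (hymem i)).1)
    (fun i ↦ (hgood _ (hymem i)).2) h0 hW
  have hword : ∀ i : ℕ, i ≤ m → W (2 * i) = pairsProd (l.take i) := by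
    intro i hi
    induction i with
    | zero => simp [h0]
    | succ i ih =>
      have hi' : y i = l[i] := by
        simp only [y]
        rw [Int.emod_eq_of_lt (by omega) (by omega), Int.toNat_natCast, List.getD_eq_getElem]
      rw [List.take_succ_eq_append_getElem (by omega), pairsProd_append, ← ih (by omega),
        show 2 * ((i + 1 : ℕ) : ℤ) = 2 * i + 1 + 1 by push_cast; ring, hW, hW,
        show 2 * (i : ℤ) + 1 + 1 = 2 * i + 2 by ring, letters, interleave_odd, interleave_even, hi']
      simp [mul_assoc]
  have hpow : ∀ i : ℕ, W (2 * (n * i)) = W (2 * n : ℕ) ^ i := by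
    intro i
    induction i with
    | zero => simp [h0]
    | succ i ih =>
      rw [pow_succ', ← ih, ← (periodicLine_letters hn hyn h0 hW).W_add]
      congr 1
      push_cast
      ring
  obtain ⟨k, hk⟩ := Int.natCast_dvd_natCast.1 (hmin m hy)
  have hlW : pairsProd l = W (2 * n : ℕ) ^ k := by
    have := hword m le_rfl
    rw [hm_def, List.take_length, ← hm_def] at this
    rw [← this, ← hpow, hk]
    push_cast
    rfl
  obtain ⟨c, rfl⟩ := isConj_iff.1 h
  refine fun htop ↦ hne (top_le_iff.1 (htop ▸ Subgroup.normalClosure_le_normal ?_))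
  rw [Set.singleton_subset_iff, hlW]
  exact Subgroup.normalClosure_normal.conj_mem _
    (pow_mem (Subgroup.subset_normalClosure (Set.mem_singleton _)) k) c

theorem normalClosure_ne_top_of_surjective {G H : Type*} [Group G] [Group H] {f : G →* H}
    (hf : Function.Surjective f) {w : G} (h : Subgroup.normalClosure {f w} ≠ ⊤) :
    Subgroup.normalClosure {w} ≠ ⊤ := by
  intro htop
  have := Subgroup.map_normalClosure {w} f hf
  rw [htop, Subgroup.map_top_of_surjective f hf, Set.image_singleton] at this
  exact h this.symm

theorem Monoid.Coprod.map_surjective {A' B' : Type*} [Group A'] [Group B'] {f : A →* A'}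
    {g : B →* B'} (hf : Function.Surjective f) (hg : Function.Surjective g) :
    Function.Surjective (Coprod.map f g) := by
  intro w
  induction w using Coprod.induction_on with
  | inl a => obtain ⟨a, rfl⟩ := hf a; exact ⟨inl a, rfl⟩
  | inr b => obtain ⟨b, rfl⟩ := hg b; exact ⟨inr b, rfl⟩
  | mul v w hv hw =>
    obtain ⟨v, rfl⟩ := hv
    obtain ⟨w, rfl⟩ := hw
    exact ⟨v * w, map_mul _ _ _⟩

end FreeProduct

/-- If each of the nontrivial groups `A` and `B` surjects onto some nontrivial
left-orderable group, then the free product `A ∗ B` has normal rank greater than one. -/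
theorem freeProduct_normal_rank_gt_one_of_leftOrderable_quotients
    {A B : Type*} [Group A] [Group B] [Nontrivial A] [Nontrivial B]
    (hA : ∃ (Q : Type) (_ : Group Q), Nontrivial Q ∧ IsLeftOrderable Q ∧
      ∃ f : A →* Q, Function.Surjective f)
    (hB : ∃ (Q : Type) (_ : Group Q), Nontrivial Q ∧ IsLeftOrderable Q ∧
      ∃ f : B →* Q, Function.Surjective f) :
    ∀ w : Monoid.Coprod A B, Subgroup.normalClosure {w} ≠ ⊤ := by
  obtain ⟨_, _, _, hA, f, hf⟩ := hA
  obtain ⟨_, _, _, hB, g, hg⟩ := hB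
  exact fun w ↦ normalClosure_ne_top_of_surjective (Coprod.map_surjective hf hg)
    (normalClosure_ne_top_of_isLeftOrderable hA hB _)
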